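/- Let Ω ⊂ ℝ³ be a bounded open set with Lipschitz boundary, let 6/5 ≤ α < 3/2, and let F : Ω → ℝ^{3×3} be measurable with ∫_Ω d^{−α/2} |F|^{3/2} dx < ∞. Then there exists a weak solution v ∈ W^{1,3}_{0,σ}(Ω, d^α) of the system ω × v + curl(d^α |ω| ω) + ∇π = div F, div v = 0, v|_{∂Ω} = 0, with ω = curl v; that is, for every φ ∈ C^∞_{0,σ}(Ω): ∫_Ω [ (ω × v) · φ + d^α |ω| ω · curl φ ] dx = −∫_Ω F : ∇φ dx. -/

import Mathlib

noncomputable section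

open MeasureTheory Real Filter Topology Bornology ENNReal NNReal

/-- Euclidean 3-space. -/
abbrev E3 : Type := EuclideanSpace ℝ (Fin 3)

/-- Euclidean 2-space. -/
abbrev E2 : Type := EuclideanSpace ℝ (Fin 2)

/-- The `i`-th standard basis vector of `E3`. -/
def ee (i : Fin 3) : E3 := EuclideanSpace.single i 1

/-- Partial derivative `∂ᵢ f` of a scalar function. -/
def pds (f : E3 → ℝ) (i : Fin 3) (x : E3) : ℝ := fderiv ℝ f x (ee i)

/-- Partial derivative `∂ᵢ vⱼ` of a vector field. -/
def pd (v : E3 → E3) (i j : Fin 3) (x : E3) : ℝ := fderiv ℝ v x (ee i) j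

/-- Build a vector of `E3` from coordinates. -/
def mk3 (a b c : ℝ) : E3 := (WithLp.equiv 2 (Fin 3 → ℝ)).symm ![a, b, c]

/-- Build a vector of `E2` from coordinates. -/
def mk2 (a b : ℝ) : E2 := (WithLp.equiv 2 (Fin 2 → ℝ)).symm ![a, b]

/-- First two coordinates `x'` of a point of `E3`. -/
def proj12 (y : E3) : E2 := mk2 (y 0) (y 1)

/-- Gradient of a scalar function, as a vector field. -/
def grad3 (f : E3 → ℝ) (x : E3) : E3 := mk3 (pds f 0 x) (pds f 1 x) (pds f 2 x)

/-- Gradient matrix `(∇v)ᵢⱼ = ∂ᵢ vⱼ` of a vector field. -/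
def gradv (v : E3 → E3) (x : E3) (i j : Fin 3) : ℝ := pd v i j x

/-- Divergence of a vector field. -/
def vdiv (v : E3 → E3) (x : E3) : ℝ := ∑ i, pd v i i x

/-- Curl `∇ × v` of a vector field. -/
def vcurl (v : E3 → E3) (x : E3) : E3 :=
  mk3 (pd v 1 2 x - pd v 2 1 x) (pd v 2 0 x - pd v 0 2 x) (pd v 0 1 x - pd v 1 0 x)

/-- Curl computed from a (weak) gradient matrix `G`, `(curl v)₁ = G₂₃ - G₃₂` etc. -/
def curlOf (G : E3 → Fin 3 → Fin 3 → ℝ) (x : E3) : E3 :=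
  mk3 (G x 1 2 - G x 2 1) (G x 2 0 - G x 0 2) (G x 0 1 - G x 1 0)

/-- Divergence computed from a (weak) gradient matrix. -/
def divOf (G : E3 → Fin 3 → Fin 3 → ℝ) (x : E3) : ℝ := ∑ i, G x i i

/-- Cross product on `E3`. -/
def cross3 (a b : E3) : E3 :=
  mk3 (a 1 * b 2 - a 2 * b 1) (a 2 * b 0 - a 0 * b 2) (a 0 * b 1 - a 1 * b 0)

/-- Euclidean dot product on `E3`. -/
def dot3 (a b : E3) : ℝ := ∑ i, a i * b i

/-- Frobenius (double-dot) product of two 3×3 matrices. -/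
def mdot (A B : Fin 3 → Fin 3 → ℝ) : ℝ := ∑ i, ∑ j, A i j * B i j

/-- Frobenius (Euclidean) norm of a 3×3 matrix. -/
def frob (M : Fin 3 → Fin 3 → ℝ) : ℝ := Real.sqrt (∑ i, ∑ j, (M i j) ^ 2)

/-- Symmetric part of a 3×3 matrix. -/
def symm3 (M : Fin 3 → Fin 3 → ℝ) (i j : Fin 3) : ℝ := (M i j + M j i) / 2

/-- Distance to the boundary of `Ω`. -/
def dB (Ω : Set E3) (x : E3) : ℝ := Metric.infDist x (frontier Ω)

/-- Scalar test functions: smooth compactly supported inside `Ω`. -/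
structure IsTestS (Ω : Set E3) (ψ : E3 → ℝ) : Prop where
  smooth : ContDiff ℝ (⊤ : ℕ∞) ψ
  compsupp : HasCompactSupport ψ
  suppin : tsupport ψ ⊆ Ω

/-- Vector test functions: smooth compactly supported inside `Ω`. -/
structure IsTest (Ω : Set E3) (φ : E3 → E3) : Prop where
  smooth : ContDiff ℝ (⊤ : ℕ∞) φ
  compsupp : HasCompactSupport φ
  suppin : tsupport φ ⊆ Ω

/-- Solenoidal (divergence-free) vector test functions `C^∞_{0,σ}(Ω)`. -/
structure IsTestSol (Ω : Set E3) (φ : E3 → E3) extends IsTest Ω φ : Prop where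
  sol : ∀ x, vdiv φ x = 0

/-- `G` is the distributional gradient of the vector field `v` on `Ω`. -/
def HasWeakGrad (Ω : Set E3) (v : E3 → E3) (G : E3 → Fin 3 → Fin 3 → ℝ) : Prop :=
  ∀ ψ : E3 → ℝ, IsTestS Ω ψ → ∀ i j,
    ∫ x in Ω, v x j * pds ψ i x = - ∫ x in Ω, G x i j * ψ x

/-- `G` is the distributional gradient of the scalar function `u` on `Ω`. -/
def HasWeakGradS (Ω : Set E3) (u : E3 → ℝ) (G : E3 → E3) : Prop :=
  ∀ ψ : E3 → ℝ, IsTestS Ω ψ → ∀ i,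
    ∫ x in Ω, u x * pds ψ i x = - ∫ x in Ω, G x i * ψ x

/-- Membership `v ∈ W^{1,p}_{0,σ}(Ω, d^α)` (with distributional gradient `G`):
`v` is measurable, `G` is its distributional gradient, the weighted norm is finite and
`v` is approximated by smooth compactly supported *solenoidal* fields in the weighted norm.
The unweighted space corresponds to `α = 0`. -/
structure MemW1pSigma (Ω : Set E3) (p α : ℝ) (v : E3 → E3)
    (G : E3 → Fin 3 → Fin 3 → ℝ) : Prop where
  meas : AEStronglyMeasurable v (volume.restrict Ω)
  weak_grad : HasWeakGrad Ω v G
  finite : IntegrableOn (fun x => dB Ω x ^ α * (‖v x‖ ^ p + frob (G x) ^ p)) Ω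
  approx : ∃ φ : ℕ → E3 → E3, (∀ n, IsTestSol Ω (φ n)) ∧
    Tendsto (fun n => ∫ x in Ω, dB Ω x ^ α *
        (‖v x - φ n x‖ ^ p + frob (fun i j => G x i j - gradv (φ n) x i j) ^ p))
      atTop (nhds 0)

/-- Membership `v ∈ W^{1,p}_0(Ω, d^α)` (with distributional gradient `G`):
as `MemW1pSigma` but approximating fields need not be divergence free. -/
structure MemW1p0 (Ω : Set E3) (p α : ℝ) (v : E3 → E3)
    (G : E3 → Fin 3 → Fin 3 → ℝ) : Prop where
  meas : AEStronglyMeasurable v (volume.restrict Ω)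
  weak_grad : HasWeakGrad Ω v G
  finite : IntegrableOn (fun x => dB Ω x ^ α * (‖v x‖ ^ p + frob (G x) ^ p)) Ω
  approx : ∃ φ : ℕ → E3 → E3, (∀ n, IsTest Ω (φ n)) ∧
    Tendsto (fun n => ∫ x in Ω, dB Ω x ^ α *
        (‖v x - φ n x‖ ^ p + frob (fun i j => G x i j - gradv (φ n) x i j) ^ p))
      atTop (nhds 0)

/-- A bounded open set of `ℝ³` with Lipschitz (`C^{0,1}`) boundary: near every boundary
point, after a rigid change of coordinates, the boundary is the graph of a Lipschitz
function `a` (with Lipschitz constant `r < 1`) and `Ω` lies locally above the graph. -/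
structure IsLipschitzDomain (Ω : Set E3) : Prop where
  nonempty : Ω.Nonempty
  isOpen : IsOpen Ω
  isBounded : IsBounded Ω
  charts : ∀ P ∈ frontier Ω, ∃ (f : E3 ≃ᵢ E3) (R R' r : ℝ) (a : E2 → ℝ),
    f P = 0 ∧ 0 < R ∧ 0 < R' ∧ 0 < r ∧ r < 1 ∧
    LipschitzWith (Real.toNNReal r) a ∧
    (∀ x' : E2, ‖x'‖ < R → |a x'| < R') ∧
    (∀ y : E3, ‖proj12 y‖ < R → |y 2| < R' →
      (f.symm y ∈ frontier Ω ↔ y 2 = a (proj12 y))) ∧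
    (∀ y : E3, ‖proj12 y‖ < R →
      a (proj12 y) < y 2 → y 2 < a (proj12 y) + R' → f.symm y ∈ Ω)

/-- A bounded open set of `ℝ³` with smooth (`C^∞`) boundary. -/
structure IsSmoothDomain (Ω : Set E3) : Prop where
  nonempty : Ω.Nonempty
  isOpen : IsOpen Ω
  isBounded : IsBounded Ω
  charts : ∀ P ∈ frontier Ω, ∃ (f : E3 ≃ᵢ E3) (R R' : ℝ) (a : E2 → ℝ),
    f P = 0 ∧ 0 < R ∧ 0 < R' ∧ ContDiff ℝ (⊤ : ℕ∞) a ∧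
    (∀ x' : E2, ‖x'‖ < R → |a x'| < R') ∧
    (∀ y : E3, ‖proj12 y‖ < R → |y 2| < R' →
      (f.symm y ∈ frontier Ω ↔ y 2 = a (proj12 y))) ∧
    (∀ y : E3, ‖proj12 y‖ < R →
      a (proj12 y) < y 2 → y 2 < a (proj12 y) + R' → f.symm y ∈ Ω)

/-- The axis-parallel closed cube with center `c` and half side-length `h`. -/
def cube (c : E3) (h : ℝ) : Set E3 := {x | ∀ i, |x i - c i| ≤ h}

/-- Average of (the nonnegative part of) `f` over a set, valued in `ℝ≥0∞`. -/
def lavg (s : Set E3) (f : E3 → ℝ) : ℝ≥0∞ :=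
  (∫⁻ x in s, ENNReal.ofReal (f x)) / volume s

/-- The Muckenhoupt `A_p` condition for a weight `w` on `ℝ³`:
`(⨍_Q w)(⨍_Q w^{-1/(p-1)})^{p-1} ≤ C` uniformly over all cubes `Q`. -/
def IsMuckenhouptAp (w : E3 → ℝ) (p : ℝ) : Prop :=
  ∃ C : ℝ, ∀ (c : E3) (h : ℝ), 0 < h →
    lavg (cube c h) w * (lavg (cube c h) (fun x => w x ^ (-1 / (p - 1)))) ^ (p - 1)
      ≤ ENNReal.ofReal C

section
/-- Smooth compactly supported scalar function. -/
structure CSf (f : E3 → ℝ) : Prop where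
  smooth : ContDiff ℝ (⊤ : ℕ∞) f
  supp : HasCompactSupport f

lemma CSf.cont {f : E3 → ℝ} (h : CSf f) : Continuous f := h.smooth.continuous
lemma CSf.diff {f : E3 → ℝ} (h : CSf f) : Differentiable ℝ f := h.smooth.differentiable (by simp)
lemma CSf.integrable {f : E3 → ℝ} (h : CSf f) : Integrable f := h.cont.integrable_of_hasCompactSupport h.supp
lemma CSf.bdd {f : E3 → ℝ} (h : CSf f) : ∃ M, 0 ≤ M ∧ ∀ x, |f x| ≤ M := by
  obtain ⟨M, hM⟩ := h.supp.exists_bound_of_continuous h.cont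
  exact ⟨M, (norm_nonneg _).trans (hM 0), hM⟩
lemma CSf.pds {f : E3 → ℝ} (h : CSf f) (i : Fin 3) : CSf (pds f i) := by
  constructor
  · have := (h.smooth.fderiv_right (m := (⊤ : ℕ∞)) (by simp)).clm_apply (contDiff_const (c := ee i))
    exact this
  · exact h.supp.fderiv_apply ℝ (ee i)
lemma CSf.fcont {f : E3 → ℝ} (h : CSf f) : Continuous (fderiv ℝ f) :=
  h.smooth.continuous_fderiv (by simp)
lemma CSf.fbdd {f : E3 → ℝ} (h : CSf f) : ∃ M, 0 ≤ M ∧ ∀ x, ‖fderiv ℝ f x‖ ≤ M := by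
  obtain ⟨M, hM⟩ := (h.supp.fderiv ℝ).exists_bound_of_continuous h.fcont
  exact ⟨M, (norm_nonneg _).trans (hM 0), hM⟩
lemma CSf.rad {f : E3 → ℝ} (h : CSf f) : ∃ ρ, 0 ≤ ρ ∧ ∀ x, f x ≠ 0 → ‖x‖ ≤ ρ := by
  obtain ⟨r, hr⟩ := h.supp.isCompact.isBounded.subset_closedBall (0:E3)
  refine ⟨max r 0, le_max_right _ _, fun x hx => ?_⟩
  have := hr (subset_tsupport f hx)
  exact (by simpa using this : ‖x‖ ≤ r).trans (le_max_left _ _)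
lemma CSf.add {f g : E3 → ℝ} (h : CSf f) (h' : CSf g) : CSf (fun x => f x + g x) :=
  ⟨h.smooth.add h'.smooth, h.supp.add h'.supp⟩
lemma CSf.mul {f g : E3 → ℝ} (h : CSf f) (h' : CSf g) : CSf (fun x => f x * g x) :=
  ⟨h.smooth.mul h'.smooth, h.supp.mul_right⟩
lemma CSf.cmul {f : E3 → ℝ} (c : ℝ) (h : CSf f) : CSf (fun x => c * f x) :=
  ⟨contDiff_const.mul h.smooth, h.supp.mul_left⟩
lemma CSf.zero : CSf (fun _ => 0) := ⟨contDiff_const, HasCompactSupport.zero⟩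
lemma CSf.neg {f : E3 → ℝ} (h : CSf f) : CSf (fun x => - f x) := by
  have := h.cmul (-1); simpa using this
lemma CSf.sub {f g : E3 → ℝ} (h : CSf f) (h' : CSf g) : CSf (fun x => f x - g x) := by
  simpa [sub_eq_add_neg] using h.add h'.neg
lemma CSf.sum3 {f : Fin 3 → E3 → ℝ} (h : ∀ i, CSf (f i)) : CSf (fun x => ∑ i, f i x) := by
  simp only [Fin.sum_univ_three]
  exact ((h 0).add (h 1)).add (h 2)

lemma fderiv_apply_eq_sum (f : E3 → ℝ) (x v : E3) : fderiv ℝ f x v = ∑ l, v l * pds f l x := by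
  have hw : v = ∑ i, v i • ee i := by
    ext j
    simp [ee, Finset.sum_apply, Pi.single_apply]
  conv_lhs => rw [hw]
  simp [map_sum, pds]

/-- Laplacian. -/
def lap (f : E3 → ℝ) (x : E3) : ℝ := ∑ l, pds (pds f l) l x
lemma CSf.lap {f : E3 → ℝ} (h : CSf f) : CSf (lap f) := CSf.sum3 fun i => (h.pds i).pds i

lemma ibp_line {f f' g g' : E3 → ℝ} {v : E3} (h1 : Integrable (fun x => f' x * g x))
    (h2 : Integrable (fun x => f x * g' x)) (h3 : Integrable (fun x => f x * g x))
    (hf : ∀ x, HasLineDerivAt ℝ f (f' x) x v) (hg : ∀ x, HasLineDerivAt ℝ g (g' x) x v) :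
    ∫ x, f x * g' x = - ∫ x, f' x * g x :=
  integral_bilinear_hasLineDerivAt_right_eq_neg_left_of_integrable
    (B := ContinuousLinearMap.mul ℝ ℝ) h1 h2 h3 (fun x _ => hf x) (fun x _ => hg x)

lemma CSf.line {f : E3 → ℝ} (h : CSf f) (i : Fin 3) (x : E3) :
    HasLineDerivAt ℝ f (_root_.pds f i x) x (ee i) :=
  (h.diff x).hasFDerivAt.hasLineDerivAt _

/-! Gaussian -/
lemma gauss_int (b : ℝ) (hb : 0 < b) : Integrable (fun z : E3 => Real.exp (-b * ‖z‖ ^ 2)) := by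
  by_contra h
  have h1 := GaussianFourier.integral_rexp_neg_mul_sq_norm (V := E3) hb
  rw [integral_undef h] at h1
  have : 0 < (π / b) ^ (Module.finrank ℝ E3 / 2 : ℝ) := by positivity
  linarith

def gc : ℝ := (∫ z : E3, Real.exp (-(1/2) * ‖z‖ ^ 2))⁻¹
def gam (z : E3) : ℝ := gc * Real.exp (-(1/2) * ‖z‖ ^ 2)
lemma gc_pos : 0 < gc := by
  unfold gc
  rw [GaussianFourier.integral_rexp_neg_mul_sq_norm (V := E3) (by norm_num)]
  positivity
lemma gam_pos (z : E3) : 0 < gam z := mul_pos gc_pos (Real.exp_pos _)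
lemma gam_le (z : E3) : gam z ≤ gc := by
  unfold gam
  have h1 := gc_pos
  have : Real.exp (-(1/2) * ‖z‖ ^ 2) ≤ 1 := Real.exp_le_one_iff.2 (by nlinarith [sq_nonneg ‖z‖])
  nlinarith
lemma gam_cont : Continuous gam := by unfold gam; fun_prop
lemma gam_one : ∫ z, gam z = 1 := by
  unfold gam
  rw [integral_const_mul, gc]
  refine inv_mul_cancel₀ ?_
  rw [GaussianFourier.integral_rexp_neg_mul_sq_norm (V := E3) (by norm_num)]
  positivity
lemma gam_mom (k : ℕ) : Integrable (fun z => (1 + ‖z‖) ^ k * gam z) := by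
  have hb := (gauss_int (1/4) (by norm_num)).const_mul (gc * (k.factorial * Real.exp 2))
  refine hb.mono' (by have := gam_cont; exact (by fun_prop : Continuous _).aestronglyMeasurable) ?_
  refine Eventually.of_forall fun z => ?_
  rw [Real.norm_eq_abs, abs_of_nonneg (mul_nonneg (by positivity) (gam_pos z).le)]
  unfold gam
  have h1 : (1 + ‖z‖) ^ k ≤ k.factorial * Real.exp (1 + ‖z‖) := by
    have := Real.pow_div_factorial_le_exp (1 + ‖z‖) (by positivity) k
    rw [div_le_iff₀ (by positivity)] at this
    linarith
  have h2 : Real.exp (1 + ‖z‖) * Real.exp (-(1/2) * ‖z‖ ^ 2) ≤ Real.exp 2 * Real.exp (-(1/4) * ‖z‖^2) := by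
    rw [← Real.exp_add, ← Real.exp_add]
    apply Real.exp_le_exp.2
    nlinarith [sq_nonneg (‖z‖ - 2)]
  have := gc_pos
  calc (1 + ‖z‖) ^ k * (gc * Real.exp (-(1/2) * ‖z‖ ^ 2))
      ≤ (k.factorial * Real.exp (1 + ‖z‖)) * (gc * Real.exp (-(1/2) * ‖z‖ ^ 2)) := by gcongr
    _ = gc * k.factorial * (Real.exp (1 + ‖z‖) * Real.exp (-(1/2) * ‖z‖ ^ 2)) := by ring
    _ ≤ gc * k.factorial * (Real.exp 2 * Real.exp (-(1/4) * ‖z‖^2)) := by gcongr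
    _ = _ := by ring
lemma gam_int : Integrable gam := by simpa using gam_mom 0

/-- Heat-type averaging. -/
def Hs (s : ℝ) (f : E3 → ℝ) (x : E3) : ℝ := ∫ z, gam z * f (x - s • z)

lemma Hs_intg {f : E3 → ℝ} (hf : CSf f) (s : ℝ) (x : E3) :
    Integrable (fun z => gam z * f (x - s • z)) := by
  obtain ⟨M, hM0, hM⟩ := hf.bdd
  refine (gam_int.mul_const M).mono' ?_ (Eventually.of_forall fun z => ?_)
  · have := gam_cont
    have := hf.cont
    exact (by fun_prop : Continuous _).aestronglyMeasurable
  · rw [norm_mul, Real.norm_eq_abs, abs_of_pos (gam_pos z)]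
    exact mul_le_mul_of_nonneg_left (hM _) (gam_pos z).le

lemma Hs_deriv_aux {f : E3 → ℝ} (hf : CSf f) (s c : ℝ) (x v : E3) :
    HasDerivAt (fun t : ℝ => ∫ z, gam z * f ((x + t • v) - (s + t * c) • z))
      (∫ z, gam z * fderiv ℝ f (x - s • z) (v - c • z)) 0 := by
  obtain ⟨M, hM0, hM⟩ := hf.fbdd
  have hg := gam_cont
  have hfc := hf.cont
  have hfc' := hf.fcont
  have key := hasDerivAt_integral_of_dominated_loc_of_deriv_le (μ := (volume : Measure E3))
    (F := fun (t : ℝ) z => gam z * f ((x + t • v) - (s + t * c) • z)) (x₀ := (0:ℝ))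
    (s := Set.univ)
    (F' := fun (t : ℝ) z => gam z * fderiv ℝ f ((x + t • v) - (s + t * c) • z) (v - c • z))
    (bound := fun z => (M * (‖v‖ + |c|)) * ((1 + ‖z‖) ^ 1 * gam z)) Filter.univ_mem
    (Eventually.of_forall fun t => (by fun_prop : Continuous _).aestronglyMeasurable)
    (by simpa using Hs_intg hf s x)
    ((by fun_prop : Continuous _).aestronglyMeasurable)
    (Eventually.of_forall fun z t _ => ?_)
    ((gam_mom 1).const_mul _)
    (Eventually.of_forall fun z t _ => ?_)
  · simpa using key.2
  · rw [norm_mul, Real.norm_eq_abs, abs_of_pos (gam_pos z)]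
    have h1 : ‖fderiv ℝ f ((x + t • v) - (s + t * c) • z) (v - c • z)‖ ≤ M * (‖v‖ + |c| * ‖z‖) := by
      refine (ContinuousLinearMap.le_opNorm _ _).trans ?_
      have : ‖v - c • z‖ ≤ ‖v‖ + |c| * ‖z‖ := by
        refine (norm_sub_le _ _).trans ?_
        rw [norm_smul, Real.norm_eq_abs]
      have h3 := hM ((x + t • v) - (s + t * c) • z)
      gcongr
    have h2 : M * (‖v‖ + |c| * ‖z‖) ≤ (M * (‖v‖ + |c|)) * (1 + ‖z‖) := by
      have : 0 ≤ M * ‖v‖ * ‖z‖ := by positivity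
      have : 0 ≤ M * |c| := by positivity
      nlinarith
    have := gam_pos z
    calc _ ≤ gam z * ((M * (‖v‖ + |c|)) * (1 + ‖z‖)) := by gcongr; exact h1.trans h2
      _ = _ := by ring
  · refine HasDerivAt.const_mul (gam z) ?_
    have hp : HasDerivAt (fun t : ℝ => (x + t • v) - (s + t * c) • z) (v - c • z) t := by
      have h1 : HasDerivAt (fun t : ℝ => x + t • v) ((1:ℝ) • v) t :=
        ((hasDerivAt_id t).smul_const v).const_add x
      have h2 : HasDerivAt (fun t : ℝ => (s + t * c) • z) ((1 * c) • z) t :=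
        (((hasDerivAt_id t).mul_const c).const_add s).smul_const z
      exact (h1.sub h2).congr_deriv (by simp)
    exact (hf.diff _).hasFDerivAt.comp_hasDerivAt t hp

lemma Hs_line {f : E3 → ℝ} (hf : CSf f) (s : ℝ) (x : E3) (i : Fin 3) :
    HasLineDerivAt ℝ (Hs s f) (Hs s (pds f i) x) x (ee i) := by
  have := Hs_deriv_aux hf s 0 x (ee i)
  unfold HasLineDerivAt
  simpa [Hs, pds] using this

lemma gam_line (z : E3) (l : Fin 3) : HasLineDerivAt ℝ gam (- (z l * gam z)) z (ee l) := by
  unfold HasLineDerivAt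
  have h1 : ∀ t : ℝ, ‖z + t • ee l‖ ^ 2 = ‖z‖ ^ 2 + 2 * t * z l + t ^ 2 := by
    intro t
    rw [norm_add_sq_real, inner_smul_right, norm_smul, mul_pow]
    have : inner ℝ z (ee l) = z l := by simp [ee, EuclideanSpace.inner_single_right]
    rw [this]
    simp [ee]; ring
  have h2 : (fun t : ℝ => gam (z + t • ee l)) = fun t => gc * Real.exp (-(1/2) * (‖z‖ ^ 2 + 2 * t * z l + t ^ 2)) := by
    funext t; unfold gam; rw [h1]
  rw [h2]
  have h3 : HasDerivAt (fun t : ℝ => -(1/2) * (‖z‖ ^ 2 + 2 * t * z l + t ^ 2)) (- z l) 0 := by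
    have ha : HasDerivAt (fun t : ℝ => ‖z‖ ^ 2 + 2 * t * z l + t ^ 2) (2 * z l) 0 := by
      have hb := ((((hasDerivAt_id (0:ℝ)).const_mul 2).mul_const (z l)).const_add (‖z‖ ^ 2)).add
        ((hasDerivAt_id (0:ℝ)).pow 2)
      exact hb.congr_deriv (by simp)
    exact (ha.const_mul (-(1/2))).congr_deriv (by ring)
  exact ((h3.exp).const_mul gc).congr_deriv (by simp [gam]; ring)

lemma Hs_sderiv {f : E3 → ℝ} (hf : CSf f) (s : ℝ) (x : E3) :
    HasDerivAt (fun s => Hs s f x) (s * Hs s (lap f) x) s := by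
  have h0 := Hs_deriv_aux hf s 1 x 0
  have h1 : HasDerivAt (fun s => Hs s f x) (∫ z, gam z * fderiv ℝ f (x - s • z) (-z)) s := by
    have h2 : HasDerivAt (fun t => t - s) 1 s := (hasDerivAt_id s).sub_const s
    have h3 := HasDerivAt.comp (h₂ := fun t : ℝ => ∫ z, gam z * f ((x + t • (0:E3)) - (s + t * 1) • z))
      s (by simpa using h0) h2
    simpa [Hs, Function.comp_def] using h3
  convert h1 using 1
  -- integrate by parts in `z`
  have hg := gam_cont
  have hl : ∀ l : Fin 3, ∫ z, gam z * (s * pds (pds f l) l (x - s • z)) =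
      ∫ z, - z l * gam z * pds f l (x - s • z) := by
    intro l
    have hpl := hf.pds l
    have hpll := hpl.pds l
    have hint1 : Integrable (fun z : E3 => (-(z l * gam z)) * pds f l (x - s • z)) := by
      obtain ⟨M, hM0, hM⟩ := hpl.bdd
      have := hpl.cont
      refine ((gam_mom 1).mul_const M).mono' (by exact (by fun_prop : Continuous _).aestronglyMeasurable)
        (Eventually.of_forall fun z => ?_)
      rw [norm_mul, norm_neg, norm_mul, Real.norm_eq_abs (gam z), abs_of_pos (gam_pos z)]
      have h5 : ‖z l‖ ≤ (1 + ‖z‖) ^ 1 := by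
        have := PiLp.norm_apply_le z l; linarith
      have := gam_pos z
      gcongr
      exact hM _
    have hint2 : Integrable (fun z : E3 => gam z * (s * pds (pds f l) l (x - s • z))) := by
      have := (Hs_intg hpll s x).const_mul s
      refine this.congr (Eventually.of_forall fun z => ?_)
      simp; ring
    have hint3 := Hs_intg hpl s x
    have hlin : ∀ z, HasLineDerivAt ℝ (fun z => pds f l (x - s • z)) (-(s * pds (pds f l) l (x - s • z))) z (ee l) := by
      intro z
      have hd : HasFDerivAt (fun z : E3 => x - s • z) (-(s • ContinuousLinearMap.id ℝ E3)) z := by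
        exact ((hasFDerivAt_id (𝕜 := ℝ) z).const_smul s).const_sub x
      have h6 := (((hpl.diff (x - s • z)).hasFDerivAt).comp z hd).hasLineDerivAt (ee l)
      have h7 : (fderiv ℝ (pds f l) (x - s • z) ∘SL (-(s • ContinuousLinearMap.id ℝ E3))) (ee l)
          = -(s * pds (pds f l) l (x - s • z)) := by
        simp; left; rfl
      rw [h7] at h6
      exact h6
    have := ibp_line (f := gam) (f' := fun z => -(z l * gam z)) (g := fun z => pds f l (x - s • z))
      (g' := fun z => -(s * pds (pds f l) l (x - s • z))) (v := ee l) hint1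
      (by simpa using hint2.neg) hint3 (fun z => gam_line z l) hlin
    simp only [mul_neg, integral_neg, neg_inj, neg_mul] at this ⊢
    rw [this]
  have hI : ∀ l : Fin 3, Integrable (fun z : E3 => gam z * pds (pds f l) l (x - s • z)) :=
    fun l => Hs_intg ((hf.pds l).pds l) s x
  have hJ : ∀ l : Fin 3, Integrable (fun z : E3 => - z l * gam z * pds f l (x - s • z)) := by
    intro l
    obtain ⟨M, hM0, hM⟩ := (hf.pds l).bdd
    have := (hf.pds l).cont
    refine ((gam_mom 1).mul_const M).mono' (by exact (by fun_prop : Continuous _).aestronglyMeasurable)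
      (Eventually.of_forall fun z => ?_)
    rw [norm_mul, norm_mul, norm_neg, Real.norm_eq_abs (gam z), abs_of_pos (gam_pos z)]
    have h5 : ‖z l‖ ≤ (1 + ‖z‖) ^ 1 := by
      have := PiLp.norm_apply_le z l; linarith
    have := gam_pos z
    gcongr
    exact hM _
  calc s * Hs s (lap f) x = ∑ l, ∫ z, gam z * (s * pds (pds f l) l (x - s • z)) := by
        rw [Hs, ← integral_const_mul, ← integral_finsetSum]
        · congr 1; funext z; simp only [lap, Fin.sum_univ_three]; ring
        · intro l _
          refine ((hI l).const_mul s).congr (Eventually.of_forall fun z => ?_)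
          simp; ring
    _ = ∑ l, ∫ z, - z l * gam z * pds f l (x - s • z) := Finset.sum_congr rfl fun l _ => hl l
    _ = _ := by
        rw [← integral_finsetSum _ (fun l _ => hJ l)]
        congr 1; funext z
        rw [fderiv_apply_eq_sum]
        simp only [Fin.sum_univ_three, PiLp.neg_apply]; ring

/-- decay -/
lemma Hs_decay {f : E3 → ℝ} (hf : CSf f) (S : ℝ) (hS : 0 ≤ S) :
    ∃ C, 0 ≤ C ∧ ∀ s, |s| ≤ S → ∀ x, |Hs s f x| ≤ C * (1 + ‖x‖) ^ (-4:ℝ) := by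
  obtain ⟨M, hM0, hM⟩ := hf.bdd
  obtain ⟨ρ, hρ0, hρ⟩ := hf.rad
  refine ⟨M * ((1 + ρ) * (1 + S)) ^ 4 * ∫ z, (1 + ‖z‖) ^ 4 * gam z, ?_, fun s hs x => ?_⟩
  · have : 0 ≤ ∫ z, (1 + ‖z‖) ^ 4 * gam z := integral_nonneg fun z =>
      mul_nonneg (by positivity) (gam_pos z).le
    positivity
  rw [Real.rpow_neg (by positivity), ← div_eq_mul_inv, le_div_iff₀ (by positivity)]
  rw [show (4:ℝ) = ((4:ℕ):ℝ) by norm_num, Real.rpow_natCast]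
  rw [← integral_const_mul]
  rw [← abs_of_nonneg (show 0 ≤ (1 + ‖x‖) ^ 4 by positivity), ← abs_mul, Hs, ← integral_mul_const]
  refine (abs_integral_le_integral_abs).trans ?_
  refine integral_mono_of_nonneg (Eventually.of_forall fun z => abs_nonneg _)
    ((gam_mom 4).const_mul _) (Eventually.of_forall fun z => ?_)
  beta_reduce
  by_cases h0 : f (x - s • z) = 0
  · rw [h0]; simp
    have := gam_pos z
    positivity
  have h1 := hρ _ h0
  have h2 : ‖x‖ ≤ ρ + S * ‖z‖ := by
    have : x = (x - s • z) + s • z := by simp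
    rw [this]
    refine (norm_add_le _ _).trans ?_
    rw [norm_smul, Real.norm_eq_abs]
    gcongr
  have h3 : 1 + ‖x‖ ≤ (1 + ρ) * (1 + S) * (1 + ‖z‖) := by
    have := norm_nonneg z
    have a1 : 0 ≤ ρ * S := by positivity
    have a2 : 0 ≤ ρ * ‖z‖ := by positivity
    have a3 : 0 ≤ ρ * S * ‖z‖ := by positivity
    nlinarith
  have h4 : (1 + ‖x‖) ^ 4 ≤ ((1 + ρ) * (1 + S) * (1 + ‖z‖)) ^ 4 := by gcongr
  rw [abs_mul, abs_mul, abs_of_pos (gam_pos z), abs_of_nonneg (show 0 ≤ (1 + ‖x‖) ^ 4 by positivity)]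
  have := gam_pos z
  calc gam z * |f (x - s • z)| * (1 + ‖x‖) ^ 4 ≤ gam z * M * ((1 + ρ) * (1 + S) * (1 + ‖z‖)) ^ 4 := by
        gcongr; exact hM _
    _ = _ := by ring

lemma jb_int : Integrable (fun x : E3 => (1 + ‖x‖) ^ (-4:ℝ)) :=
  integrable_one_add_norm (by simp; norm_num)

lemma Hs_cont {f : E3 → ℝ} (hf : CSf f) (s : ℝ) : Continuous (Hs s f) := by
  obtain ⟨M, hM0, hM⟩ := hf.bdd
  have hg := gam_cont
  have hfc := hf.cont
  refine continuous_of_dominated (bound := fun z => gam z * M) ?_ ?_ (gam_int.mul_const M) ?_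
  · intro x; exact (by fun_prop : Continuous _).aestronglyMeasurable
  · intro x; refine Eventually.of_forall fun z => ?_
    rw [norm_mul, Real.norm_eq_abs, abs_of_pos (gam_pos z)]
    exact mul_le_mul_of_nonneg_left (hM _) (gam_pos z).le
  · refine Eventually.of_forall fun z => ?_
    fun_prop

lemma Hs_zero (f : E3 → ℝ) (x : E3) : Hs 0 f x = f x := by
  simp [Hs, integral_mul_const, gam_one]

lemma Hs_sup {f : E3 → ℝ} (hf : CSf f) : ∃ C, 0 ≤ C ∧ ∀ s, 0 < s → ∀ x, |Hs s f x| ≤ C * (s ^ 3)⁻¹ := by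
  refine ⟨gc * ∫ y, |f y|, mul_nonneg gc_pos.le (integral_nonneg fun _ => abs_nonneg _), fun s hs x => ?_⟩
  have habs_int : Integrable (fun z => |f (x - s • z)|) := by
    have h1 : Integrable (fun z => |f (x - z)|) := (hf.integrable.comp_sub_left x).abs
    exact h1.comp_smul hs.ne'
  have h2 : ∫ z, |f (x - s • z)| = (s ^ 3)⁻¹ * ∫ y, |f y| := by
    have := Measure.integral_comp_smul (volume : Measure E3) (fun z => |f (x - z)|) s
    rw [this]
    simp [abs_of_pos hs]
    left
    exact integral_sub_left_eq_self (fun y => |f y|) volume x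
  rw [Hs]
  refine (abs_integral_le_integral_abs).trans ?_
  calc ∫ z, |gam z * f (x - s • z)| ≤ ∫ z, gc * |f (x - s • z)| := by
        refine integral_mono_of_nonneg (Eventually.of_forall fun z => abs_nonneg _)
          (habs_int.const_mul gc) (Eventually.of_forall fun z => ?_)
        beta_reduce
        rw [abs_mul, abs_of_pos (gam_pos z)]
        have := gam_le z
        gcongr
    _ = _ := by rw [integral_const_mul, h2]; ring

lemma Hs_L1 {f : E3 → ℝ} (hf : CSf f) (s : ℝ) : ∫ x, |Hs s f x| ≤ ∫ x, |f x| := by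
  have hg := gam_cont
  have hfc := hf.cont
  have h1 : ∫⁻ x, ‖Hs s f x‖ₑ ≤ ∫⁻ x, ‖f x‖ₑ := by
    calc ∫⁻ x, ‖Hs s f x‖ₑ ≤ ∫⁻ x, ∫⁻ z, ‖gam z * f (x - s • z)‖ₑ :=
          lintegral_mono fun x => enorm_integral_le_lintegral_enorm _
      _ = ∫⁻ z, ∫⁻ x, ‖gam z * f (x - s • z)‖ₑ := by
          refine lintegral_lintegral_swap ?_
          have hc : Continuous (fun p : E3 × E3 => gam p.2 * f (p.1 - s • p.2)) := by fun_prop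
          exact hc.enorm.measurable.aemeasurable
      _ = ∫⁻ z, ‖gam z‖ₑ * ∫⁻ x, ‖f x‖ₑ := by
          refine lintegral_congr fun z => ?_
          simp only [enorm_mul]
          rw [lintegral_const_mul _ (by exact (by fun_prop : Continuous _).measurable)]
          congr 1
          exact lintegral_sub_right_eq_self (fun x => ‖f x‖ₑ) (s • z)
      _ = (∫⁻ z, ‖gam z‖ₑ) * ∫⁻ x, ‖f x‖ₑ := by
          rw [lintegral_mul_const _ hg.enorm.measurable]
      _ = _ := by
          have : ∫⁻ z, ‖gam z‖ₑ = 1 := by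
            have := ofReal_integral_norm_eq_lintegral_enorm gam_int
            rw [← this]
            simp only [Real.norm_eq_abs, abs_of_pos (gam_pos _), gam_one]; simp
          rw [this, one_mul]
  have hfin : ∫⁻ x, ‖f x‖ₑ ≠ ⊤ := hf.integrable.2.ne
  have e1 := integral_norm_eq_lintegral_enorm (μ := volume) (Hs_cont hf s).aestronglyMeasurable
  have e2 := integral_norm_eq_lintegral_enorm (μ := volume) hf.cont.aestronglyMeasurable
  simp only [Real.norm_eq_abs] at e1 e2
  rw [e1, e2]
  exact ENNReal.toReal_mono hfin h1
end

section
def brho (ε y : ℝ) : ℝ := √(y ^ 2 + ε ^ 2)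
def bR (ε x y : ℝ) : ℝ := x ^ 2 + brho ε y
def bB (ε x y : ℝ) : ℝ := bR ε x y * √(bR ε x y)
def bBx (ε x y : ℝ) : ℝ := 3 * x * √(bR ε x y)
def bBy (ε x y : ℝ) : ℝ := (3/2) * √(bR ε x y) * (y / brho ε y)
def bRd (ε x y a b : ℝ) : ℝ := 2 * x * a + (y / brho ε y) * b
def bBxd (ε x y a b : ℝ) : ℝ := 3 * a * √(bR ε x y) + 3 * x * (bRd ε x y a b / (2 * √(bR ε x y)))
def bByd (ε x y a b : ℝ) : ℝ := (3/2) * (bRd ε x y a b / (2 * √(bR ε x y))) * (y / brho ε y)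
  + (3/2) * √(bR ε x y) * ((b * brho ε y - y * ((y / brho ε y) * b)) / brho ε y ^ 2)

lemma brho_ge {ε : ℝ} (hε : 0 < ε) (y : ℝ) : ε ≤ brho ε y := by
  unfold brho; apply Real.le_sqrt_of_sq_le; nlinarith [sq_nonneg y]
lemma brho_pos {ε : ℝ} (hε : 0 < ε) (y : ℝ) : 0 < brho ε y := hε.trans_le (brho_ge hε y)
lemma brho_sq {ε : ℝ} (hε : 0 < ε) (y : ℝ) : brho ε y ^ 2 = y ^ 2 + ε ^ 2 := by
  unfold brho; rw [Real.sq_sqrt (by positivity)]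
lemma brho_abs {ε : ℝ} (hε : 0 < ε) (y : ℝ) : |y| ≤ brho ε y := by
  unfold brho; apply Real.abs_le_sqrt; nlinarith [sq_nonneg ε]
lemma brho_le {ε : ℝ} (hε : 0 < ε) (y : ℝ) : brho ε y ≤ |y| + ε := by
  unfold brho
  rw [Real.sqrt_le_left (by positivity)]
  have := abs_nonneg y
  have := sq_abs y
  nlinarith
lemma bR_ge {ε : ℝ} (hε : 0 < ε) (x y : ℝ) : brho ε y ≤ bR ε x y := by unfold bR; nlinarith [sq_nonneg x]
lemma bR_pos {ε : ℝ} (hε : 0 < ε) (x y : ℝ) : 0 < bR ε x y := (brho_pos hε y).trans_le (bR_ge hε x y)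
lemma bfrac {ε : ℝ} (hε : 0 < ε) (y : ℝ) : |y / brho ε y| ≤ 1 := by
  rw [abs_div, abs_of_pos (brho_pos hε y)]
  exact (div_le_one (brho_pos hε y)).2 (brho_abs hε y)
lemma brho_deriv {ε : ℝ} (hε : 0 < ε) {G : ℝ → ℝ} {G' t : ℝ} (hG : HasDerivAt G G' t) :
    HasDerivAt (fun t => brho ε (G t)) ((G t / brho ε (G t)) * G') t := by
  have h1 : HasDerivAt (fun t => G t ^ 2 + ε ^ 2) (2 * G t * G') t :=
    ((hG.pow 2).add_const (ε ^ 2)).congr_deriv (by simp)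
  have := brho_pos hε (G t)
  exact (h1.sqrt (by positivity)).congr_deriv (by unfold brho at *; field_simp)
lemma bR_deriv {ε : ℝ} (hε : 0 < ε) {F G : ℝ → ℝ} {F' G' t : ℝ} (hF : HasDerivAt F F' t) (hG : HasDerivAt G G' t) :
    HasDerivAt (fun t => bR ε (F t) (G t)) (bRd ε (F t) (G t) F' G') t :=
  ((hF.pow 2).add (brho_deriv hε hG)).congr_deriv (by simp [bRd])
lemma bRs_deriv {ε : ℝ} (hε : 0 < ε) {F G : ℝ → ℝ} {F' G' t : ℝ} (hF : HasDerivAt F F' t) (hG : HasDerivAt G G' t) :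
    HasDerivAt (fun t => √(bR ε (F t) (G t))) (bRd ε (F t) (G t) F' G' / (2 * √(bR ε (F t) (G t)))) t :=
  (bR_deriv hε hF hG).sqrt (bR_pos hε _ _).ne'
lemma bB_deriv {ε : ℝ} (hε : 0 < ε) {F G : ℝ → ℝ} {F' G' t : ℝ} (hF : HasDerivAt F F' t) (hG : HasDerivAt G G' t) :
    HasDerivAt (fun t => bB ε (F t) (G t)) (bBx ε (F t) (G t) * F' + bBy ε (F t) (G t) * G') t := by
  refine ((bR_deriv hε hF hG).mul (bRs_deriv hε hF hG)).congr_deriv ?_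
  have h1 := Real.sqrt_pos.2 (bR_pos hε (F t) (G t))
  have h2 := Real.sq_sqrt (bR_pos hε (F t) (G t)).le
  simp only [bBx, bBy, bRd]
  set q := √(bR ε (F t) (G t)) with hq
  rw [show bR ε (F t) (G t) = q ^ 2 from h2.symm]
  field_simp
  ring
lemma bBx_deriv {ε : ℝ} (hε : 0 < ε) {F G : ℝ → ℝ} {F' G' t : ℝ} (hF : HasDerivAt F F' t) (hG : HasDerivAt G G' t) :
    HasDerivAt (fun t => bBx ε (F t) (G t)) (bBxd ε (F t) (G t) F' G') t :=
  ((hF.const_mul 3).mul (bRs_deriv hε hF hG)).congr_deriv (by simp [bBxd])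
lemma bBy_deriv {ε : ℝ} (hε : 0 < ε) {F G : ℝ → ℝ} {F' G' t : ℝ} (hF : HasDerivAt F F' t) (hG : HasDerivAt G G' t) :
    HasDerivAt (fun t => bBy ε (F t) (G t)) (bByd ε (F t) (G t) F' G') t :=
  (((bRs_deriv hε hF hG).const_mul (3/2)).mul
    (hG.div (brho_deriv hε hG) (brho_pos hε _).ne')).congr_deriv (by simp only [bByd, Pi.div_apply])

lemma bell_form {ε : ℝ} (hε : 0 < ε) (x y a b : ℝ) :
    a * bBxd ε x y a b + b * bByd ε x y a b
      = 3 * √(bR ε x y) * a ^ 2 + 3 / (4 * √(bR ε x y)) * bRd ε x y a b ^ 2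
        + (3/2) * √(bR ε x y) * (ε ^ 2 / brho ε y ^ 3) * b ^ 2 := by
  have h1 := Real.sqrt_pos.2 (bR_pos hε x y)
  have h3 := brho_pos hε y
  have h4 : ε ^ 2 = brho ε y ^ 2 - y ^ 2 := by rw [brho_sq hε]; ring
  rw [h4]
  simp only [bBxd, bByd, bRd]
  set q := √(bR ε x y)
  set r := brho ε y
  field_simp
  ring

lemma bell_lower {ε : ℝ} (hε : 0 < ε) (x y a b : ℝ) :
    (1/3) * (√(bR ε x y) * a ^ 2 + b ^ 2 / √(bR ε x y)) ≤ a * bBxd ε x y a b + b * bByd ε x y a b := by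
  rw [bell_form hε]
  have h1 := Real.sqrt_pos.2 (bR_pos hε x y)
  have h2 := Real.sq_sqrt (bR_pos hε x y).le
  have h3 := brho_pos hε y
  have h4 := brho_sq hε y
  have h5 := bR_ge hε x y
  have hx : x ^ 2 ≤ √(bR ε x y) ^ 2 := by
    rw [h2, bR]; linarith
  set q := √(bR ε x y) with hq
  set r := brho ε y
  set D := bRd ε x y a b with hD
  have hDe : (y / r) * b = D - 2 * x * a := by simp only [hD, bRd]; ring
  have hb : b ^ 2 = (D - 2 * x * a) ^ 2 + ε ^ 2 / r ^ 2 * b ^ 2 := by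
    rw [← hDe]; field_simp; rw [h4]
  have h6 : (D - 2 * x * a) ^ 2 ≤ 2 * D ^ 2 + 8 * q ^ 2 * a ^ 2 := by
    have : x ^ 2 * a ^ 2 ≤ q ^ 2 * a ^ 2 := by gcongr
    nlinarith [sq_nonneg (D + 2 * x * a)]
  have h7 : ε ^ 2 / r ^ 2 * b ^ 2 / q ≤ q * (ε ^ 2 / r ^ 3) * b ^ 2 := by
    rw [div_le_iff₀ h1]
    have h8 : r ≤ q ^ 2 := by rw [h2]; exact h5
    have : q * (ε ^ 2 / r ^ 3) * b ^ 2 * q = (q ^ 2 / r) * (ε ^ 2 / r ^ 2 * b ^ 2) := by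
      field_simp
    rw [this]
    have h9 : 1 ≤ q ^ 2 / r := by rw [le_div_iff₀ h3]; linarith
    have : 0 ≤ ε ^ 2 / r ^ 2 * b ^ 2 := by positivity
    nlinarith
  have h10 : b ^ 2 / q ≤ 2 * D ^ 2 / q + 8 * q * a ^ 2 + q * (ε ^ 2 / r ^ 3) * b ^ 2 := by
    calc b ^ 2 / q = (D - 2 * x * a) ^ 2 / q + ε ^ 2 / r ^ 2 * b ^ 2 / q := by
          rw [← add_div, ← hb]
      _ ≤ (2 * D ^ 2 + 8 * q ^ 2 * a ^ 2) / q + q * (ε ^ 2 / r ^ 3) * b ^ 2 := by gcongr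
      _ = _ := by field_simp
  have h11 : 3 / (4 * q) * D ^ 2 = (3/4) * (D ^ 2 / q) := by field_simp
  have h12 : 2 * D ^ 2 / q = 2 * (D ^ 2 / q) := by ring
  have h13 : 0 ≤ D ^ 2 / q := by positivity
  have h14 : 0 ≤ q * (ε ^ 2 / r ^ 3) * b ^ 2 := by positivity
  have h15 : 0 ≤ q * a ^ 2 := by positivity
  rw [h11]
  nlinarith

lemma bell_sum {ε : ℝ} (hε : 0 < ε) (x y : ℝ) (a b : Fin 3 → ℝ) (i k : Fin 3) :
    (2/3) * |a i * b k| ≤ ∑ l, (a l * bBxd ε x y (a l) (b l) + b l * bByd ε x y (a l) (b l)) := by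
  have h1 := Real.sqrt_pos.2 (bR_pos hε x y)
  set q := √(bR ε x y) with hq
  have h2 : ∑ l, (1/3) * (q * a l ^ 2 + b l ^ 2 / q) ≤
    ∑ l, (a l * bBxd ε x y (a l) (b l) + b l * bByd ε x y (a l) (b l)) :=
    Finset.sum_le_sum fun l _ => bell_lower hε x y (a l) (b l)
  refine le_trans ?_ h2
  have h3 : q * a i ^ 2 ≤ ∑ l, q * a l ^ 2 :=
    Finset.single_le_sum (f := fun l => q * a l ^ 2) (fun l _ => by positivity) (Finset.mem_univ i)
  have h4 : b k ^ 2 / q ≤ ∑ l, b l ^ 2 / q :=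
    Finset.single_le_sum (f := fun l => b l ^ 2 / q) (fun l _ => by positivity) (Finset.mem_univ k)
  rw [← Finset.mul_sum, Finset.sum_add_distrib]
  have h5 : 2 * |a i * b k| ≤ q * a i ^ 2 + b k ^ 2 / q := by
    rw [abs_mul]
    have e : q * a i ^ 2 + b k ^ 2 / q - 2 * (|a i| * |b k|) = (q * |a i| - |b k|) ^ 2 / q := by
      rw [← sq_abs (a i), ← sq_abs (b k)]; field_simp; ring
    have : 0 ≤ (q * |a i| - |b k|) ^ 2 / q := by positivity
    linarith
  linarith

/-- Bounds. -/
lemma bell_bounds {ε : ℝ} (hε : 0 < ε) (M : ℝ) (hM : 0 ≤ M) : ∃ C, 0 ≤ C ∧ ∀ x y, |x| ≤ M → |y| ≤ M →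
    |bBx ε x y| ≤ C ∧ |bBy ε x y| ≤ C ∧ ∀ a b, |bBxd ε x y a b| ≤ C * (|a| + |b|) ∧
      |bByd ε x y a b| ≤ C * (|a| + |b|) := by
  set Q := √(M ^ 2 + M + ε) with hQ
  have hQ0 : 0 ≤ Q := Real.sqrt_nonneg _
  set T := 1 + (2 * √ε)⁻¹ with hT
  have hsε := Real.sqrt_pos.2 hε
  have hT0 : 0 ≤ T := by positivity
  refine ⟨3 * M * Q + 3 * Q + 3 * M * T + 3/2 * T + 3 * Q / ε, by positivity, fun x y hx hy => ?_⟩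
  have h1 := Real.sqrt_pos.2 (bR_pos hε x y)
  have h2 := Real.sq_sqrt (bR_pos hε x y).le
  have hrp := brho_pos hε y
  have hfr := bfrac hε y
  have hq : √(bR ε x y) ≤ Q := by
    apply Real.sqrt_le_sqrt
    unfold bR
    have := brho_le hε y
    have : x ^ 2 ≤ M ^ 2 := by rw [← sq_abs]; gcongr
    linarith
  have hqε : √ε ≤ √(bR ε x y) := Real.sqrt_le_sqrt ((brho_ge hε y).trans (bR_ge hε x y))
  have hxq : |x| ≤ √(bR ε x y) := by
    apply Real.abs_le_sqrt; unfold bR; linarith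
  have hrε := brho_ge hε y
  set q := √(bR ε x y) with hqd
  set r := brho ε y with hr
  have hD : ∀ a b, |bRd ε x y a b / (2 * q)| ≤ T * (|a| + |b|) := by
    intro a b
    rw [abs_div, abs_of_pos (show 0 < 2 * q by positivity), div_le_iff₀ (by positivity)]
    have e1 : |bRd ε x y a b| ≤ 2 * q * |a| + |b| := by
      unfold bRd
      refine (abs_add_le _ _).trans ?_
      rw [abs_mul, abs_mul, abs_mul, abs_two]
      have : |y / brho ε y| * |b| ≤ 1 * |b| := by gcongr
      have : 2 * |x| * |a| ≤ 2 * q * |a| := by gcongr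
      linarith
    have e2 : |b| ≤ (2 * √ε)⁻¹ * |b| * (2 * q) := by
      have : 1 ≤ (2 * √ε)⁻¹ * (2 * q) := by
        rw [inv_mul_eq_div, le_div_iff₀ (by positivity)]; linarith
      calc |b| = 1 * |b| := (one_mul _).symm
        _ ≤ ((2 * √ε)⁻¹ * (2 * q)) * |b| := by gcongr
        _ = _ := by ring
    have e3 : 0 ≤ (2 * √ε)⁻¹ * |a| * (2 * q) := by positivity
    have e4 : 0 ≤ |b| * (2 * q) := by positivity
    rw [hT]
    nlinarith
  refine ⟨?_, ?_, fun a b => ⟨?_, ?_⟩⟩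
  · unfold bBx
    rw [abs_mul, abs_mul, abs_of_pos (by norm_num : (0:ℝ) < 3), abs_of_pos h1]
    have : 3 * |x| * q ≤ 3 * M * Q := by gcongr
    have : 0 ≤ 3 * M * T := by positivity
    have : 0 ≤ 3 * Q / ε := by positivity
    linarith
  · unfold bBy
    rw [abs_mul, abs_mul, abs_of_pos (by norm_num : (0:ℝ) < 3/2), abs_of_pos h1]
    have : 3/2 * q * |y / brho ε y| ≤ 3/2 * Q * 1 := by gcongr
    have : 0 ≤ 3 * M * T := by positivity
    have : 0 ≤ 3 * Q / ε := by positivity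
    have : 0 ≤ 3 * M * Q := by positivity
    linarith
  · unfold bBxd
    refine (abs_add_le _ _).trans ?_
    rw [abs_mul, abs_mul, abs_mul (3 * x), abs_mul 3 x, abs_of_pos (by norm_num : (0:ℝ) < 3), abs_of_pos h1]
    have e1 : 3 * |a| * q ≤ 3 * |a| * Q := by gcongr
    have e2 : 3 * |x| * |bRd ε x y a b / (2 * q)| ≤ 3 * M * (T * (|a| + |b|)) := by
      gcongr; exact hD a b
    have e3 : 0 ≤ (3 * M * Q + 3/2 * T + 3 * Q / ε) * (|a| + |b|) := by positivity
    have e4 : 0 ≤ Q * |b| := by positivity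
    nlinarith
  · unfold bByd
    refine (abs_add_le _ _).trans ?_
    rw [abs_mul, abs_mul, abs_mul (3/2 * _), abs_mul (3/2) (√ (bR ε x y)), abs_of_pos (by norm_num : (0:ℝ) < 3/2), ← hqd, abs_of_pos h1]
    have e2 : 3/2 * |bRd ε x y a b / (2 * q)| * |y / brho ε y| ≤ 3/2 * (T * (|a| + |b|)) * 1 := by
      gcongr; exact hD a b
    have e3 : |(b * r - y * ((y / r) * b)) / r ^ 2| ≤ 2 * |b| / ε := by
      rw [abs_div, abs_of_pos (show 0 < r ^ 2 by positivity), div_le_div_iff₀ (by positivity) hε]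
      have f1 : |b * r - y * ((y / r) * b)| ≤ 2 * |b| * r := by
        refine (abs_sub _ _).trans ?_
        rw [abs_mul, abs_mul, abs_mul, abs_of_pos hrp]
        have := brho_abs hε y
        have : |y| * (|y / r| * |b|) ≤ r * (1 * |b|) := by gcongr
        linarith
      calc |b * r - y * ((y / r) * b)| * ε ≤ 2 * |b| * r * r := by gcongr
        _ = _ := by ring
    have e4 : 3/2 * q * |(b * r - y * ((y / r) * b)) / r ^ 2| ≤ 3/2 * Q * (2 * |b| / ε) := by gcongr
    have e5 : 3/2 * Q * (2 * |b| / ε) = 3 * Q / ε * |b| := by ring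
    have e6 : 0 ≤ (3 * M * Q + 3 * Q + 3 * M * T) * (|a| + |b|) := by positivity
    have e7 : 0 ≤ 3 * Q / ε * |a| := by positivity
    nlinarith

lemma bB_lower {ε : ℝ} (hε : 0 < ε) (x y : ℝ) : ε * √ε ≤ bB ε x y := by
  have h1 : ε ≤ bR ε x y := (brho_ge hε y).trans (bR_ge hε x y)
  have h2 := Real.sqrt_le_sqrt h1
  unfold bB
  gcongr
  exact (bR_pos hε x y).le
lemma bB_upper {ε : ℝ} (hε : 0 < ε) (x y : ℝ) : bB ε x y - ε * √ε ≤ (x ^ 2 + |y|) * (√(bR ε x y) + √ε) := by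
  have h1 : ε ≤ bR ε x y := (brho_ge hε y).trans (bR_ge hε x y)
  have h2 := Real.sqrt_le_sqrt h1
  have h3 : bR ε x y - ε ≤ x ^ 2 + |y| := by unfold bR; have := brho_le hε y; linarith
  have h4 := Real.sq_sqrt hε.le
  have h5 := Real.sq_sqrt (bR_pos hε x y).le
  have h6 := Real.sqrt_pos.2 hε
  unfold bB
  set q := √(bR ε x y)
  set e := √ε
  have h7 : 0 ≤ x ^ 2 + |y| := by positivity
  have h8 : bR ε x y * q - ε * e ≤ (bR ε x y - ε) * (q + e) := by
    have : 0 ≤ q * e * (q - e) := mul_nonneg (mul_nonneg (h6.le.trans h2) h6.le) (by linarith)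
    have e1 : bR ε x y * q = q ^ 3 := by rw [← h5]; ring
    have e2 : ε * e = e ^ 3 := by calc ε * e = e ^ 2 * e := by rw [h4]
        _ = e ^ 3 := by ring
    have e3 : (bR ε x y - ε) * (q + e) = (q ^ 2 - e ^ 2) * (q + e) := by rw [h5, h4]
    rw [e1, e2, e3]
    nlinarith
  refine h8.trans ?_
  gcongr
lemma bB_cont {ε : ℝ} (hε : 0 < ε) : Continuous (fun p : ℝ × ℝ => bB ε p.1 p.2) := by
  unfold bB bR brho; fun_prop
lemma bBx_cont {ε : ℝ} (hε : 0 < ε) : Continuous (fun p : ℝ × ℝ => bBx ε p.1 p.2) := by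
  unfold bBx bR brho; fun_prop
lemma bBy_cont {ε : ℝ} (hε : 0 < ε) : Continuous (fun p : ℝ × ℝ => bBy ε p.1 p.2) := by
  have h : ∀ p : ℝ × ℝ, √(p.2 ^ 2 + ε ^ 2) ≠ 0 := fun p => (brho_pos hε p.2).ne'
  unfold bBy bR brho; fun_prop (disch := exact h)
lemma bBxd_cont {ε : ℝ} (hε : 0 < ε) : Continuous (fun p : (ℝ × ℝ) × (ℝ × ℝ) => bBxd ε p.1.1 p.1.2 p.2.1 p.2.2) := by
  have h : ∀ p : (ℝ × ℝ) × (ℝ × ℝ), √(p.1.2 ^ 2 + ε ^ 2) ≠ 0 := fun p => (brho_pos hε p.1.2).ne'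
  have h' : ∀ p : (ℝ × ℝ) × (ℝ × ℝ), 2 * √(p.1.1 ^ 2 + √(p.1.2 ^ 2 + ε ^ 2)) ≠ 0 := fun p => by
    have := Real.sqrt_pos.2 (bR_pos hε p.1.1 p.1.2)
    unfold bR brho at this
    positivity
  unfold bBxd bRd bR brho; fun_prop (disch := first | exact h | exact h')
lemma bByd_cont {ε : ℝ} (hε : 0 < ε) : Continuous (fun p : (ℝ × ℝ) × (ℝ × ℝ) => bByd ε p.1.1 p.1.2 p.2.1 p.2.2) := by
  have h : ∀ p : (ℝ × ℝ) × (ℝ × ℝ), √(p.1.2 ^ 2 + ε ^ 2) ≠ 0 := fun p => (brho_pos hε p.1.2).ne'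
  have h2 : ∀ p : (ℝ × ℝ) × (ℝ × ℝ), √(p.1.2 ^ 2 + ε ^ 2) ^ 2 ≠ 0 := fun p => pow_ne_zero 2 (h p)
  have h' : ∀ p : (ℝ × ℝ) × (ℝ × ℝ), 2 * √(p.1.1 ^ 2 + √(p.1.2 ^ 2 + ε ^ 2)) ≠ 0 := fun p => by
    have := Real.sqrt_pos.2 (bR_pos hε p.1.1 p.1.2)
    unfold bR brho at this
    positivity
  unfold bByd bRd bR brho; fun_prop (disch := first | exact h | exact h' | exact h2)
end

section
lemma pds_comm {f : E3 → ℝ} (hf : CSf f) (i j : Fin 3) (x : E3) :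
    pds (pds f i) j x = pds (pds f j) i x := by
  have h := second_derivative_symmetric (𝕜 := ℝ) (f := f) (f' := fderiv ℝ f)
    (f'' := fderiv ℝ (fderiv ℝ f) x) (x := x)
    (fun y => (hf.diff y).hasFDerivAt)
    (((hf.smooth.fderiv_right (m := (⊤ : ℕ∞)) (by simp)).differentiable (by simp) x).hasFDerivAt)
  have key : ∀ i j : Fin 3, pds (pds f i) j x = fderiv ℝ (fderiv ℝ f) x (ee j) (ee i) := by
    intro i j
    have hd : DifferentiableAt ℝ (fderiv ℝ f) x :=
      (hf.smooth.fderiv_right (m := (⊤ : ℕ∞)) (by simp)).differentiable (by simp) x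
    have h1 : HasFDerivAt (fun y => fderiv ℝ f y (ee i)) ((fderiv ℝ (fderiv ℝ f) x).flip (ee i)) x := by
      have := hd.hasFDerivAt.clm_apply (hasFDerivAt_const (ee i) x)
      exact this.congr_fderiv (by ext; simp)
    show fderiv ℝ (fun y => fderiv ℝ f y (ee i)) x (ee j) = _
    rw [h1.fderiv]; rfl
  rw [key, key, h]

lemma Hs_bdd {f : E3 → ℝ} {M : ℝ} (hM : ∀ x, |f x| ≤ M) (s : ℝ) (x : E3) :
    |Hs s f x| ≤ M := by
  rw [Hs, ← Real.norm_eq_abs]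
  refine (norm_integral_le_of_norm_le (gam_int.mul_const M) (Eventually.of_forall fun z => ?_)).trans ?_
  · rw [norm_mul, Real.norm_eq_abs, abs_of_pos (gam_pos z)]
    exact mul_le_mul_of_nonneg_left (hM _) (gam_pos z).le
  · rw [integral_mul_const, gam_one, one_mul]

lemma int_of_decay {h : E3 → ℝ} (hc : Continuous h) {C : ℝ}
    (hb : ∀ x, |h x| ≤ C * (1 + ‖x‖) ^ (-4:ℝ)) : Integrable h :=
  (jb_int.const_mul C).mono' hc.aestronglyMeasurable (Eventually.of_forall hb)

lemma Hs_int {f : E3 → ℝ} (hf : CSf f) (s : ℝ) : Integrable (Hs s f) := by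
  obtain ⟨C, _, hC⟩ := Hs_decay hf |s| (abs_nonneg s)
  exact int_of_decay (Hs_cont hf s) (hC s le_rfl)

lemma Hs_bmul_int {f h : E3 → ℝ} (hf : CSf f) (s : ℝ) (hc : Continuous h) {M : ℝ}
    (hM : ∀ x, |h x| ≤ M) : Integrable (fun x => h x * Hs s f x) :=
  (Hs_int hf s).bdd_mul hc.aestronglyMeasurable (Eventually.of_forall hM)

lemma Hs_mul_int {f g : E3 → ℝ} (hf : CSf f) (hg : CSf g) (s : ℝ) :
    Integrable (fun x => Hs s f x * Hs s g x) := by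
  obtain ⟨M, _, hM⟩ := hf.bdd
  exact Hs_bmul_int hg s (Hs_cont hf s) (Hs_bdd hM s)

lemma ibpH {f g : E3 → ℝ} (hf : CSf f) (hg : CSf g) (s : ℝ) (l : Fin 3) :
    ∫ x, Hs s f x * Hs s (pds g l) x = - ∫ x, Hs s (pds f l) x * Hs s g x :=
  ibp_line (Hs_mul_int (hf.pds l) hg s) (Hs_mul_int hf (hg.pds l) s) (Hs_mul_int hf hg s)
    (fun x => Hs_line hf s x l) (fun x => Hs_line hg s x l)

lemma Hs_sum {f : Fin 3 → E3 → ℝ} (hf : ∀ i, CSf (f i)) (s : ℝ) (x : E3) :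
    Hs s (fun x => ∑ i, f i x) x = ∑ i, Hs s (f i) x := by
  simp only [Hs, Finset.mul_sum]
  rw [integral_finsetSum _ (fun i _ => Hs_intg (hf i) s x)]

lemma Psi_deriv {u g : E3 → ℝ} (hu : CSf u) (hg : CSf g) (s : ℝ) :
    HasDerivAt (fun s => ∫ x, Hs s u x * Hs s g x)
      (∫ x, ((s * Hs s (lap u) x) * Hs s g x + Hs s u x * (s * Hs s (lap g) x))) s := by
  obtain ⟨C1, hC10, hC1⟩ := Hs_decay hu.lap (|s| + 1) (by positivity)
  obtain ⟨C2, hC20, hC2⟩ := Hs_decay hg.lap (|s| + 1) (by positivity)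
  obtain ⟨Mu, hMu0, hMu⟩ := hu.bdd
  obtain ⟨Mg, hMg0, hMg⟩ := hg.bdd
  have cu := fun s => Hs_cont hu s
  have cg := fun s => Hs_cont hg s
  have clu := fun s => Hs_cont hu.lap s
  have clg := fun s => Hs_cont hg.lap s
  have key := hasDerivAt_integral_of_dominated_loc_of_deriv_le (μ := (volume : Measure E3))
    (F := fun (s : ℝ) x => Hs s u x * Hs s g x) (x₀ := s)
    (s := Metric.ball s 1)
    (F' := fun (s : ℝ) x => (s * Hs s (lap u) x) * Hs s g x + Hs s u x * (s * Hs s (lap g) x))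
    (bound := fun x => ((|s| + 1) * (C1 * Mg + C2 * Mu)) * (1 + ‖x‖) ^ (-4:ℝ)) (Metric.ball_mem_nhds s one_pos)
    (Eventually.of_forall fun t => ((cu t).mul (cg t)).aestronglyMeasurable)
    (Hs_mul_int hu hg s)
    ((((clu s).const_mul s).mul (cg s)).add ((cu s).mul ((clg s).const_mul s))).aestronglyMeasurable
    (Eventually.of_forall fun x t ht => ?_)
    (jb_int.const_mul _)
    (Eventually.of_forall fun x t _ => ?_)
  · exact key.2
  · have ht' : |t| ≤ |s| + 1 := by
      rw [Metric.mem_ball, Real.dist_eq] at ht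
      have := abs_sub_abs_le_abs_sub t s
      linarith
    have h1 := hC1 t ht' x
    have h2 := hC2 t ht' x
    have h3 := Hs_bdd hMu t x
    have h4 := Hs_bdd hMg t x
    have hj : 0 ≤ (1 + ‖x‖) ^ (-4:ℝ) := by positivity
    rw [Real.norm_eq_abs]
    refine (abs_add_le _ _).trans ?_
    rw [abs_mul, abs_mul, abs_mul, abs_mul]
    calc _ ≤ (|s| + 1) * (C1 * (1 + ‖x‖) ^ (-4:ℝ)) * Mg + Mu * ((|s| + 1) * (C2 * (1 + ‖x‖) ^ (-4:ℝ))) := by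
          gcongr
      _ = _ := by ring
  · exact (Hs_sderiv hu t x).mul (Hs_sderiv hg t x)

lemma Psi_deriv2 {u g : E3 → ℝ} {f : Fin 3 → E3 → ℝ} (hu : CSf u) (hg : CSf g) (hf : ∀ i, CSf (f i))
    (hlap : ∀ x, lap u x = ∑ i, pds (f i) i x) (k : Fin 3) (s : ℝ) :
    HasDerivAt (fun s => ∫ x, Hs s (pds u k) x * Hs s g x)
      (-2 * s * ∑ i, ∫ x, Hs s (pds (f i) i) x * Hs s (pds g k) x) s := by
  refine (Psi_deriv (hu.pds k) hg s).congr_deriv ?_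
  have i1 := Hs_mul_int (hu.pds k).lap hg s
  have i2 := Hs_mul_int (hu.pds k) hg.lap s
  have e0 : ∫ x, ((s * Hs s (lap (pds u k)) x) * Hs s g x + Hs s (pds u k) x * (s * Hs s (lap g) x))
      = s * (∫ x, Hs s (lap (pds u k)) x * Hs s g x) + s * ∫ x, Hs s (pds u k) x * Hs s (lap g) x := by
    rw [← integral_const_mul, ← integral_const_mul, ← integral_add (i1.const_mul s) (i2.const_mul s)]
    congr 1; funext x; ring
  have hl1 : lap (pds u k) = pds (lap u) k := by
    funext x
    have : fderiv ℝ (lap u) x = ∑ l, fderiv ℝ (pds (pds u l) l) x := by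
      have : lap u = fun x => ∑ l, pds (pds u l) l x := rfl
      rw [this, fderiv_fun_sum (fun l _ => (((hu.pds l).pds l).diff x))]
    simp only [lap]
    unfold pds at this ⊢
    rw [this]
    simp only [_root_.sum_apply]
    refine Finset.sum_congr rfl fun l _ => ?_
    have a1 := pds_comm (hu.pds l) l k x
    have a2 : pds (pds u k) l = pds (pds u l) k := funext fun y => pds_comm hu k l y
    have a3 : pds (pds (pds u k) l) l x = pds (pds (pds u l) l) k x := by rw [a2, ← a1]
    exact a3
  have e1 : ∫ x, Hs s (lap (pds u k)) x * Hs s g x = - ∫ x, Hs s (lap u) x * Hs s (pds g k) x := by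
    rw [hl1, ibpH hu.lap hg s k, neg_neg]
  have e2 : ∫ x, Hs s (pds u k) x * Hs s (lap g) x = ∫ x, Hs s (lap (pds u k)) x * Hs s g x := by
    have b1 : ∀ x, Hs s (lap g) x = ∑ l, Hs s (pds (pds g l) l) x := fun x => Hs_sum (fun l => (hg.pds l).pds l) s x
    have b2 : ∀ x, Hs s (lap (pds u k)) x = ∑ l, Hs s (pds (pds (pds u k) l) l) x :=
      fun x => Hs_sum (fun l => ((hu.pds k).pds l).pds l) s x
    simp only [b1, b2, Finset.mul_sum, Finset.sum_mul]
    rw [integral_finsetSum _ (fun l _ => Hs_mul_int (hu.pds k) ((hg.pds l).pds l) s),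
      integral_finsetSum _ (fun l _ => Hs_mul_int (((hu.pds k).pds l).pds l) hg s)]
    refine Finset.sum_congr rfl fun l _ => ?_
    rw [ibpH (hu.pds k) (hg.pds l) s l, ibpH ((hu.pds k).pds l) hg s l, neg_neg]
  have e3 : ∫ x, Hs s (lap u) x * Hs s (pds g k) x = ∑ i, ∫ x, Hs s (pds (f i) i) x * Hs s (pds g k) x := by
    rw [← integral_finsetSum _ (fun i _ => Hs_mul_int ((hf i).pds i) (hg.pds k) s)]
    congr 1; funext x
    rw [← Finset.sum_mul, ← Hs_sum (fun i => (hf i).pds i) s x]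
    congr 2
    funext y; exact hlap y
  rw [e0, e2, e1, e3]; ring

lemma Psi_lim {u g : E3 → ℝ} (hu : CSf u) (hg : CSf g) :
    Tendsto (fun s => ∫ x, Hs s u x * Hs s g x) atTop (𝓝 0) := by
  obtain ⟨C, hC0, hC⟩ := Hs_sup hu
  have h1 : Tendsto (fun s : ℝ => C * (s ^ 3)⁻¹ * ∫ x, |g x|) atTop (𝓝 0) := by
    have : Tendsto (fun s : ℝ => (s ^ 3)⁻¹) atTop (𝓝 0) :=
      tendsto_inv_atTop_zero.comp (tendsto_pow_atTop (by norm_num))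
    simpa using (this.const_mul C).mul_const (∫ x, |g x|)
  refine squeeze_zero_norm' ?_ h1
  filter_upwards [eventually_gt_atTop 0] with s hs
  rw [Real.norm_eq_abs]
  refine (abs_integral_le_integral_abs).trans ?_
  calc ∫ x, |Hs s u x * Hs s g x| ≤ ∫ x, C * (s ^ 3)⁻¹ * |Hs s g x| := by
        refine integral_mono_of_nonneg (Eventually.of_forall fun z => abs_nonneg _)
          ((Hs_int hg s).abs.const_mul _) (Eventually.of_forall fun z => ?_)
        beta_reduce
        rw [abs_mul]
        have := hC s hs z
        gcongr
    _ = C * (s ^ 3)⁻¹ * ∫ x, |Hs s g x| := integral_const_mul _ _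
    _ ≤ _ := by
        have := Hs_L1 hg s
        gcongr
end

section
lemma bB_dom {ε : ℝ} (hε : 0 < ε) {M : ℝ} {x y : ℝ} (hx : |x| ≤ M) (hy : |y| ≤ M) :
    |bB ε x y - ε * √ε| ≤ ((M + 1) * (√(M ^ 2 + M + ε) + √ε)) * (|x| + |y|) := by
  have h1 := bB_upper hε x y
  have h2 := bB_lower hε x y
  rw [abs_of_nonneg (by linarith)]
  have h3 : bR ε x y ≤ M ^ 2 + M + ε := by
    unfold bR; have := brho_le hε y
    have : x ^ 2 ≤ M ^ 2 := by rw [← sq_abs]; gcongr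
    linarith
  have h4 := Real.sqrt_le_sqrt h3
  have h5 : x ^ 2 + |y| ≤ (M + 1) * (|x| + |y|) := by
    rw [← sq_abs]
    have := abs_nonneg x
    have := abs_nonneg y
    nlinarith
  have hM : 0 ≤ M := (abs_nonneg x).trans hx
  calc _ ≤ (x ^ 2 + |y|) * (√(bR ε x y) + √ε) := h1
    _ ≤ ((M + 1) * (|x| + |y|)) * (√(M ^ 2 + M + ε) + √ε) := by gcongr
    _ = _ := by ring

def PhiE (ε : ℝ) (f g : E3 → ℝ) (s : ℝ) : ℝ := ∫ x, (bB ε (Hs s f x) (Hs s g x) - ε * √ε)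

lemma Phi_intg {ε : ℝ} (hε : 0 < ε) {f g : E3 → ℝ} (hf : CSf f) (hg : CSf g) (s : ℝ) :
    Integrable (fun x => bB ε (Hs s f x) (Hs s g x) - ε * √ε) := by
  obtain ⟨Mf, hMf0, hMf⟩ := hf.bdd
  obtain ⟨Mg, hMg0, hMg⟩ := hg.bdd
  refine (((Hs_int hf s).abs.add (Hs_int hg s).abs).const_mul
    ((max Mf Mg + 1) * (√((max Mf Mg) ^ 2 + (max Mf Mg) + ε) + √ε))).mono' ?_
    (Eventually.of_forall fun x => ?_)
  · exact (((bB_cont hε).comp ((Hs_cont hf s).prodMk (Hs_cont hg s))).sub continuous_const).aestronglyMeasurable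
  · exact bB_dom hε ((Hs_bdd hMf s x).trans (le_max_left _ _)) ((Hs_bdd hMg s x).trans (le_max_right _ _))

lemma Phi_nonneg {ε : ℝ} (hε : 0 < ε) (f g : E3 → ℝ) (s : ℝ) : 0 ≤ PhiE ε f g s :=
  integral_nonneg fun x => by have := bB_lower hε (Hs s f x) (Hs s g x); simpa using this

lemma Phi_deriv {ε : ℝ} (hε : 0 < ε) {f g : E3 → ℝ} (hf : CSf f) (hg : CSf g) (s : ℝ) :
    HasDerivAt (PhiE ε f g)
      (∫ x, (bBx ε (Hs s f x) (Hs s g x) * (s * Hs s (lap f) x)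
        + bBy ε (Hs s f x) (Hs s g x) * (s * Hs s (lap g) x))) s := by
  obtain ⟨C1, hC10, hC1⟩ := Hs_decay hf.lap (|s| + 1) (by positivity)
  obtain ⟨C2, hC20, hC2⟩ := Hs_decay hg.lap (|s| + 1) (by positivity)
  obtain ⟨Mf, hMf0, hMf⟩ := hf.bdd
  obtain ⟨Mg, hMg0, hMg⟩ := hg.bdd
  obtain ⟨C, hC0, hC⟩ := bell_bounds hε (max Mf Mg) (hMf0.trans (le_max_left _ _))
  have cx := (bBx_cont hε).comp ((Hs_cont hf s).prodMk (Hs_cont hg s))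
  have cy := (bBy_cont hε).comp ((Hs_cont hf s).prodMk (Hs_cont hg s))
  have key := hasDerivAt_integral_of_dominated_loc_of_deriv_le (μ := (volume : Measure E3))
    (F := fun (s : ℝ) x => bB ε (Hs s f x) (Hs s g x) - ε * √ε) (x₀ := s)
    (s := Metric.ball s 1)
    (F' := fun (s : ℝ) x => bBx ε (Hs s f x) (Hs s g x) * (s * Hs s (lap f) x)
        + bBy ε (Hs s f x) (Hs s g x) * (s * Hs s (lap g) x))
    (bound := fun x => (C * (|s| + 1) * (C1 + C2)) * (1 + ‖x‖) ^ (-4:ℝ)) (Metric.ball_mem_nhds s one_pos)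
    (Eventually.of_forall fun t => (Phi_intg hε hf hg t).aestronglyMeasurable)
    (Phi_intg hε hf hg s)
    ((cx.mul ((Hs_cont hf.lap s).const_mul s)).add (cy.mul ((Hs_cont hg.lap s).const_mul s))).aestronglyMeasurable
    (Eventually.of_forall fun x t ht => ?_)
    (jb_int.const_mul _)
    (Eventually.of_forall fun x t _ => ?_)
  · exact key.2
  · have ht' : |t| ≤ |s| + 1 := by
      rw [Metric.mem_ball, Real.dist_eq] at ht
      have := abs_sub_abs_le_abs_sub t s
      linarith
    have h1 := hC1 t ht' x
    have h2 := hC2 t ht' x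
    obtain ⟨h3, h4, -⟩ := hC _ _ ((Hs_bdd hMf t x).trans (le_max_left _ _)) ((Hs_bdd hMg t x).trans (le_max_right _ _))
    have hj : 0 ≤ (1 + ‖x‖) ^ (-4:ℝ) := by positivity
    rw [Real.norm_eq_abs]
    refine (abs_add_le _ _).trans ?_
    rw [abs_mul, abs_mul, abs_mul, abs_mul]
    calc _ ≤ C * ((|s| + 1) * (C1 * (1 + ‖x‖) ^ (-4:ℝ))) + C * ((|s| + 1) * (C2 * (1 + ‖x‖) ^ (-4:ℝ))) := by
          gcongr
      _ = _ := by ring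
  · exact ((bB_deriv hε (Hs_sderiv hf t x) (Hs_sderiv hg t x)).sub_const _).congr_deriv (by ring)

lemma line_bell {ε : ℝ} (hε : 0 < ε) {F G : E3 → ℝ} {F' G' : ℝ} {x v : E3}
    (hF : HasLineDerivAt ℝ F F' x v) (hG : HasLineDerivAt ℝ G G' x v) :
    HasLineDerivAt ℝ (fun x => bBx ε (F x) (G x)) (bBxd ε (F x) (G x) F' G') x v ∧
    HasLineDerivAt ℝ (fun x => bBy ε (F x) (G x)) (bByd ε (F x) (G x) F' G') x v := by
  unfold HasLineDerivAt at *
  constructor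
  · simpa using bBx_deriv hε hF hG
  · simpa using bBy_deriv hε hF hG

lemma Phi_ibp {ε : ℝ} (hε : 0 < ε) {f g : E3 → ℝ} (hf : CSf f) (hg : CSf g) (s : ℝ) (hs : 0 ≤ s) (i k : Fin 3) :
    (∫ x, (bBx ε (Hs s f x) (Hs s g x) * (s * Hs s (lap f) x)
        + bBy ε (Hs s f x) (Hs s g x) * (s * Hs s (lap g) x)))
    ≤ - ((2/3) * s * ∫ x, |Hs s (pds f i) x * Hs s (pds g k) x|) := by
  obtain ⟨Mf, hMf0, hMf⟩ := hf.bdd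
  obtain ⟨Mg, hMg0, hMg⟩ := hg.bdd
  obtain ⟨C, hC0, hC⟩ := bell_bounds hε (max Mf Mg) (hMf0.trans (le_max_left _ _))
  have cx := (bBx_cont hε).comp ((Hs_cont hf s).prodMk (Hs_cont hg s))
  have cy := (bBy_cont hε).comp ((Hs_cont hf s).prodMk (Hs_cont hg s))
  have B := fun x => hC _ _ ((Hs_bdd hMf s x).trans (le_max_left _ _)) ((Hs_bdd hMg s x).trans (le_max_right _ _))
  have cxd := fun l => (bBxd_cont hε).comp (((Hs_cont hf s).prodMk (Hs_cont hg s)).prodMk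
    ((Hs_cont (hf.pds l) s).prodMk (Hs_cont (hg.pds l) s)))
  have cyd := fun l => (bByd_cont hε).comp (((Hs_cont hf s).prodMk (Hs_cont hg s)).prodMk
    ((Hs_cont (hf.pds l) s).prodMk (Hs_cont (hg.pds l) s)))
  choose Nf hNf0 hNf using fun l => (hf.pds l).bdd
  choose Ng hNg0 hNg using fun l => (hg.pds l).bdd
  have Bxd : ∀ l x, |bBxd ε (Hs s f x) (Hs s g x) (Hs s (pds f l) x) (Hs s (pds g l) x)| ≤ C * (Nf l + Ng l) := by
    intro l x
    refine ((B x).2.2 _ _).1.trans ?_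
    have := Hs_bdd (hNf l) s x
    have := Hs_bdd (hNg l) s x
    gcongr
  have Byd : ∀ l x, |bByd ε (Hs s f x) (Hs s g x) (Hs s (pds f l) x) (Hs s (pds g l) x)| ≤ C * (Nf l + Ng l) := by
    intro l x
    refine ((B x).2.2 _ _).2.trans ?_
    have := Hs_bdd (hNf l) s x
    have := Hs_bdd (hNg l) s x
    gcongr
  have Ix : ∀ {h : E3 → ℝ}, CSf h → Integrable (fun x => bBx ε (Hs s f x) (Hs s g x) * Hs s h x) :=
    fun hh => Hs_bmul_int hh s cx (fun x => (B x).1)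
  have Iy : ∀ {h : E3 → ℝ}, CSf h → Integrable (fun x => bBy ε (Hs s f x) (Hs s g x) * Hs s h x) :=
    fun hh => Hs_bmul_int hh s cy (fun x => (B x).2.1)
  have Ixd : ∀ l, Integrable (fun x => bBxd ε (Hs s f x) (Hs s g x) (Hs s (pds f l) x) (Hs s (pds g l) x) * Hs s (pds f l) x) :=
    fun l => Hs_bmul_int (hf.pds l) s (cxd l) (Bxd l)
  have Iyd : ∀ l, Integrable (fun x => bByd ε (Hs s f x) (Hs s g x) (Hs s (pds f l) x) (Hs s (pds g l) x) * Hs s (pds g l) x) :=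
    fun l => Hs_bmul_int (hg.pds l) s (cyd l) (Byd l)
  have e1 : ∀ l, ∫ x, bBx ε (Hs s f x) (Hs s g x) * Hs s (pds (pds f l) l) x =
      - ∫ x, bBxd ε (Hs s f x) (Hs s g x) (Hs s (pds f l) x) (Hs s (pds g l) x) * Hs s (pds f l) x := fun l =>
    ibp_line (Ixd l) (Ix ((hf.pds l).pds l)) (Ix (hf.pds l))
      (fun x => (line_bell hε (Hs_line hf s x l) (Hs_line hg s x l)).1) (fun x => Hs_line (hf.pds l) s x l)
  have e2 : ∀ l, ∫ x, bBy ε (Hs s f x) (Hs s g x) * Hs s (pds (pds g l) l) x =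
      - ∫ x, bByd ε (Hs s f x) (Hs s g x) (Hs s (pds f l) x) (Hs s (pds g l) x) * Hs s (pds g l) x := fun l =>
    ibp_line (Iyd l) (Iy ((hg.pds l).pds l)) (Iy (hg.pds l))
      (fun x => (line_bell hε (Hs_line hf s x l) (Hs_line hg s x l)).2) (fun x => Hs_line (hg.pds l) s x l)
  have e3 : (∫ x, (bBx ε (Hs s f x) (Hs s g x) * (s * Hs s (lap f) x)
        + bBy ε (Hs s f x) (Hs s g x) * (s * Hs s (lap g) x)))
      = s * ∑ l, ((∫ x, bBx ε (Hs s f x) (Hs s g x) * Hs s (pds (pds f l) l) x)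
        + ∫ x, bBy ε (Hs s f x) (Hs s g x) * Hs s (pds (pds g l) l) x) := by
    simp_rw [← fun l => integral_add (Ix ((hf.pds l).pds l)) (Iy ((hg.pds l).pds l))]
    have hh := integral_finsetSum (μ := (volume : Measure E3)) Finset.univ
      (fun (l : Fin 3) _ => (Ix ((hf.pds l).pds l)).add (Iy ((hg.pds l).pds l)))
    simp only [Pi.add_apply] at hh
    rw [← hh, ← integral_const_mul]
    congr 1; funext x
    have b1 : Hs s (lap f) x = ∑ l, Hs s (pds (pds f l) l) x := Hs_sum (fun l => (hf.pds l).pds l) s x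
    have b2 : Hs s (lap g) x = ∑ l, Hs s (pds (pds g l) l) x := Hs_sum (fun l => (hg.pds l).pds l) s x
    rw [b1, b2]
    simp only [Fin.sum_univ_three]; ring
  have e4 : ∑ l, ((∫ x, bBx ε (Hs s f x) (Hs s g x) * Hs s (pds (pds f l) l) x)
        + ∫ x, bBy ε (Hs s f x) (Hs s g x) * Hs s (pds (pds g l) l) x)
      = - ∫ x, ∑ l, (Hs s (pds f l) x * bBxd ε (Hs s f x) (Hs s g x) (Hs s (pds f l) x) (Hs s (pds g l) x)
        + Hs s (pds g l) x * bByd ε (Hs s f x) (Hs s g x) (Hs s (pds f l) x) (Hs s (pds g l) x)) := by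
    have := integral_finsetSum (μ := (volume : Measure E3)) Finset.univ (fun (l : Fin 3) _ => (Ixd l).add (Iyd l))
    simp only [Pi.add_apply] at this
    simp_rw [e1, e2, ← neg_add, Finset.sum_neg_distrib, neg_inj, ← fun l => integral_add (Ixd l) (Iyd l)]
    rw [← this]
    congr 1; funext x
    refine Finset.sum_congr rfl fun l _ => by ring
  rw [e3, e4]
  have e5 : (2/3) * ∫ x, |Hs s (pds f i) x * Hs s (pds g k) x| ≤
      ∫ x, ∑ l, (Hs s (pds f l) x * bBxd ε (Hs s f x) (Hs s g x) (Hs s (pds f l) x) (Hs s (pds g l) x)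
        + Hs s (pds g l) x * bByd ε (Hs s f x) (Hs s g x) (Hs s (pds f l) x) (Hs s (pds g l) x)) := by
    rw [← integral_const_mul]
    refine integral_mono ((Hs_mul_int (hf.pds i) (hg.pds k) s).abs.const_mul _) ?_ fun x => ?_
    · have := integrable_finsetSum (μ := (volume : Measure E3)) Finset.univ (fun (l : Fin 3) _ => (Ixd l).add (Iyd l))
      refine this.congr (Eventually.of_forall fun x => ?_)
      simp only [Pi.add_apply]
      refine Finset.sum_congr rfl fun l _ => by ring
    · exact bell_sum hε _ _ (fun l => Hs s (pds f l) x) (fun l => Hs s (pds g l) x) i k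
  nlinarith

lemma cz_eps {ε : ℝ} (hε : 0 < ε) {u g : E3 → ℝ} {f : Fin 3 → E3 → ℝ} (hu : CSf u) (hg : CSf g) (hf : ∀ i, CSf (f i))
    (hlap : ∀ x, lap u x = ∑ i, pds (f i) i x) (k : Fin 3) :
    ∫ x, pds u k x * g x ≤ 3 * ∑ i, ∫ x, (bB ε (f i x) (g x) - ε * √ε) := by
  set D : ℝ → ℝ := fun s => 3 * ∑ i, PhiE ε (f i) g s - ∫ x, Hs s (pds u k) x * Hs s g x with hD
  have hd : ∀ s, HasDerivAt D (3 * ∑ i, (∫ x, (bBx ε (Hs s (f i) x) (Hs s g x) * (s * Hs s (lap (f i)) x)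
        + bBy ε (Hs s (f i) x) (Hs s g x) * (s * Hs s (lap g) x)))
        - (-2 * s * ∑ i, ∫ x, Hs s (pds (f i) i) x * Hs s (pds g k) x)) s := by
    intro s
    exact ((HasDerivAt.fun_sum fun i _ => Phi_deriv hε (hf i) hg s).const_mul 3).sub
      (Psi_deriv2 hu hg hf hlap k s)
  have hanti : AntitoneOn D (Set.Ici 0) := by
    refine antitoneOn_of_deriv_nonpos (convex_Ici 0) (fun s _ => (hd s).continuousAt.continuousWithinAt)
      (fun s _ => (hd s).differentiableAt.differentiableWithinAt) fun s hs => ?_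
    rw [interior_Ici] at hs
    have hs0 : 0 ≤ s := le_of_lt hs
    rw [(hd s).deriv]
    have h1 := Finset.sum_le_sum fun (i : Fin 3) (_ : i ∈ Finset.univ) => Phi_ibp hε (hf i) hg s hs0 i k
    have h2 : ∑ i, ∫ x, Hs s (pds (f i) i) x * Hs s (pds g k) x ≤
        ∑ i, ∫ x, |Hs s (pds (f i) i) x * Hs s (pds g k) x| := by
      refine Finset.sum_le_sum fun i _ => (le_abs_self _).trans abs_integral_le_integral_abs
    rw [Finset.sum_neg_distrib, ← Finset.mul_sum] at h1
    nlinarith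
  have h0 : ∀ s, 0 ≤ s → - (∫ x, Hs s (pds u k) x * Hs s g x) ≤ D 0 := by
    intro s hs
    refine le_trans ?_ (hanti (Set.mem_Ici.2 le_rfl) (Set.mem_Ici.2 hs) hs)
    have : 0 ≤ ∑ i, PhiE ε (f i) g s := Finset.sum_nonneg fun i _ => Phi_nonneg hε _ _ _
    simp only [hD]; linarith
  have h1 : 0 ≤ D 0 := by
    have := (Psi_lim (hu.pds k) hg).neg
    rw [neg_zero] at this
    refine le_of_tendsto this ?_
    filter_upwards [eventually_ge_atTop 0] with s hs using h0 s hs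
  simp only [hD, PhiE, Hs_zero] at h1
  linarith
end

section
lemma s32_le (a b : ℝ) (ha : 0 ≤ a) (hb : 0 ≤ b) : (a ^ 2 + b) * √(a ^ 2 + b) ≤ 3 * (a ^ 3 + b * √b) := by
  have h3 : √2 ≤ 3 / 2 := by
    rw [Real.sqrt_le_left (by norm_num)]; norm_num
  have hsb := Real.sqrt_nonneg b
  rcases le_total b (a ^ 2) with h | h
  · have h1 : √(a ^ 2 + b) ≤ √2 * a := by
      rw [← Real.sqrt_sq ha, ← Real.sqrt_mul (by norm_num)]
      apply Real.sqrt_le_sqrt; rw [Real.sqrt_sq ha]; linarith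
    calc (a ^ 2 + b) * √(a ^ 2 + b) ≤ (2 * a ^ 2) * (3/2 * a) := by
          gcongr
          · linarith
          · exact h1.trans (by gcongr)
      _ = 3 * a ^ 3 := by ring
      _ ≤ _ := by have : 0 ≤ b * √b := by positivity
                  linarith
  · have h1 : √(a ^ 2 + b) ≤ √2 * √b := by
      rw [← Real.sqrt_mul (by norm_num)]
      apply Real.sqrt_le_sqrt; linarith
    calc (a ^ 2 + b) * √(a ^ 2 + b) ≤ (2 * b) * (3/2 * √b) := by
          gcongr
          · linarith
          · exact h1.trans (by gcongr)
      _ = 3 * (b * √b) := by ring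
      _ ≤ _ := by have : 0 ≤ a ^ 3 := by positivity
                  linarith

lemma cs_int {h : E3 → ℝ} (hc : Continuous h) (hs : HasCompactSupport h) : Integrable h :=
  hc.integrable_of_hasCompactSupport hs

lemma cs_of {f g : E3 → ℝ} {H : ℝ → ℝ → ℝ} (hf : HasCompactSupport f) (hg : HasCompactSupport g)
    (h0 : H 0 0 = 0) : HasCompactSupport (fun x => H (f x) (g x)) :=
  hf.comp₂_left hg h0

lemma s32_int {f g : E3 → ℝ} (hf : CSf f) (hg : CSf g) : Integrable (fun x => |f x| ^ 3 + |g x| * √|g x|) := by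
  have := hf.cont
  have := hg.cont
  exact cs_int (by fun_prop) (cs_of (H := fun a b => |a| ^ 3 + |b| * √|b|) hf.supp hg.supp (by simp))

lemma cz_D {u g : E3 → ℝ} {f : Fin 3 → E3 → ℝ} (hu : CSf u) (hg : CSf g) (hf : ∀ i, CSf (f i))
    (hlap : ∀ x, lap u x = ∑ i, pds (f i) i x) (k : Fin 3) :
    ∫ x, pds u k x * g x ≤ 9 * ∑ i, ∫ x, (|f i x| ^ 3 + |g x| * √|g x|) := by
  have hgc := hg.cont
  have hfc := fun i => (hf i).cont
  have I1 : ∀ i, Integrable (fun x => (f i x ^ 2 + |g x|) * √(f i x ^ 2 + |g x|)) := fun i => by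
    have := hfc i
    exact cs_int (by fun_prop) (cs_of (H := fun a b => (a ^ 2 + |b|) * √(a ^ 2 + |b|)) (hf i).supp hg.supp (by simp))
  have I2 : ∀ i, Integrable (fun x => f i x ^ 2 + |g x|) := fun i => by
    have := hfc i
    exact cs_int (by fun_prop) (cs_of (H := fun a b => a ^ 2 + |b|) (hf i).supp hg.supp (by simp))
  have h1 : ∀ e : ℝ, 0 < e → ∫ x, pds u k x * g x ≤
      3 * ∑ i, ((∫ x, (f i x ^ 2 + |g x|) * √(f i x ^ 2 + |g x|)) + 2 * e * ∫ x, (f i x ^ 2 + |g x|)) := by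
    intro e he
    have hε : 0 < e ^ 2 := by positivity
    refine (cz_eps hε hu hg hf hlap k).trans ?_
    gcongr with i _
    rw [← integral_const_mul, ← integral_add (I1 i) ((I2 i).const_mul _)]
    refine integral_mono_of_nonneg (Eventually.of_forall fun x => ?_) ((I1 i).add ((I2 i).const_mul _))
      (Eventually.of_forall fun x => ?_)
    · have := bB_lower hε (f i x) (g x); simpa using this
    · beta_reduce
      refine (bB_upper hε _ _).trans ?_
      have hS : 0 ≤ f i x ^ 2 + |g x| := by positivity
      have a1 : √(bR (e ^ 2) (f i x) (g x)) ≤ √(f i x ^ 2 + |g x|) + e := by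
        rw [Real.sqrt_le_left (by positivity)]
        have := brho_le hε (g x)
        unfold bR
        have b1 := Real.sq_sqrt hS
        have := Real.sqrt_nonneg (f i x ^ 2 + |g x|)
        nlinarith
      have a2 : √(e ^ 2) = e := Real.sqrt_sq he.le
      rw [a2]
      nlinarith
  have h2 : ∫ x, pds u k x * g x ≤ 3 * ∑ i, (∫ x, (f i x ^ 2 + |g x|) * √(f i x ^ 2 + |g x|)) := by
    have ht : Tendsto (fun e : ℝ => 3 * ∑ i, ((∫ x, (f i x ^ 2 + |g x|) * √(f i x ^ 2 + |g x|))
        + 2 * e * ∫ x, (f i x ^ 2 + |g x|))) (𝓝[>] 0)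
        (𝓝 (3 * ∑ i, (∫ x, (f i x ^ 2 + |g x|) * √(f i x ^ 2 + |g x|)))) := by
      have hc : Continuous (fun e : ℝ => 3 * ∑ i, ((∫ x, (f i x ^ 2 + |g x|) * √(f i x ^ 2 + |g x|))
        + 2 * e * ∫ x, (f i x ^ 2 + |g x|))) := by fun_prop
      have := (hc.tendsto 0).mono_left (nhdsWithin_le_nhds (s := Set.Ioi 0))
      simpa using this
    refine ge_of_tendsto ht ?_
    filter_upwards [self_mem_nhdsWithin] with e he using h1 e he
  refine h2.trans ?_
  have : ∀ i, (∫ x, (f i x ^ 2 + |g x|) * √(f i x ^ 2 + |g x|)) ≤ 3 * ∫ x, (|f i x| ^ 3 + |g x| * √|g x|) := by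
    intro i
    rw [← integral_const_mul]
    refine integral_mono (I1 i) ((s32_int (hf i) hg).const_mul 3) fun x => ?_
    have := s32_le |f i x| |g x| (abs_nonneg _) (abs_nonneg _)
    simpa using this
  have := Finset.sum_le_sum fun (i : Fin 3) (_ : i ∈ Finset.univ) => this i
  rw [← Finset.mul_sum] at this
  linarith

lemma CSf.cube_int {f : E3 → ℝ} (hf : CSf f) : Integrable (fun x => |f x| ^ 3) := by
  have := hf.cont
  exact cs_int (by fun_prop) (hf.supp.comp_left (g := fun a => |a| ^ 3) (by simp))

lemma cz_scalar {u : E3 → ℝ} {f : Fin 3 → E3 → ℝ} (hu : CSf u) (hf : ∀ i, CSf (f i))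
    (hlap : ∀ x, lap u x = ∑ i, pds (f i) i x) (k : Fin 3) :
    ∫ x, |pds u k x| ^ 3 ≤ 472392 * ∑ i, ∫ x, |f i x| ^ 3 := by
  have hw := hu.pds k
  set w := pds u k with hwd
  have hwc := hw.cont
  have I32 : Integrable (fun x => |w x| * √|w x|) :=
    cs_int (by fun_prop) (hw.supp.comp_left (g := fun a => |a| * √|a|) (by simp))
  set W := ∫ x, |w x| ^ 3
  set F := ∑ i, ∫ x, |f i x| ^ 3
  have key : ∀ δ : ℝ, 0 < δ → (1/26244 : ℝ) * W ≤ 9 * F + 1/2 * (1/26244) * (W + δ * √δ * ∫ x, |w x| * √|w x|) := by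
    intro δ hδ
    have hsm : ContDiff ℝ (⊤ : ℕ∞) (fun x => √(w x ^ 2 + δ ^ 2)) :=
      ContDiff.sqrt ((hw.smooth.pow 2).add contDiff_const) (fun x => by positivity)
    have hg : CSf (fun x => (1/26244 : ℝ) * (w x * √(w x ^ 2 + δ ^ 2))) :=
      ⟨contDiff_const.mul (hw.smooth.mul hsm), (hw.supp.mul_right).mul_left⟩
    have h1 := cz_D hu hg hf hlap k
    have h2 : (1/26244 : ℝ) * W ≤ ∫ x, w x * ((1/26244 : ℝ) * (w x * √(w x ^ 2 + δ ^ 2))) := by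
      rw [← integral_const_mul]
      refine integral_mono (hw.cube_int.const_mul _) (hw.mul hg).integrable fun x => ?_
      beta_reduce
      have : |w x| ≤ √(w x ^ 2 + δ ^ 2) := by
        apply Real.le_sqrt_of_sq_le; rw [sq_abs]; nlinarith
      have h3 : |w x| ^ 3 = w x ^ 2 * |w x| := by rw [← sq_abs]; ring
      rw [h3]
      nlinarith [mul_le_mul_of_nonneg_left this (sq_nonneg (w x))]
    have Iq : Integrable (fun x => (1/26244 * (1/162) * 3 : ℝ) * (|w x| ^ 3 + δ * √δ * (|w x| * √|w x|))) :=
      (hw.cube_int.add (I32.const_mul _)).const_mul _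
    have h3 : ∀ i, ∫ x, (|f i x| ^ 3 + |(1/26244 : ℝ) * (w x * √(w x ^ 2 + δ ^ 2))| *
          √|(1/26244 : ℝ) * (w x * √(w x ^ 2 + δ ^ 2))|) ≤
        (∫ x, |f i x| ^ 3) + 1/26244 * (1/162) * 3 * (W + δ * √δ * ∫ x, |w x| * √|w x|) := by
      intro i
      rw [← integral_const_mul (δ * √δ), ← integral_add hw.cube_int (I32.const_mul _), ← integral_const_mul,
        ← integral_add (hf i).cube_int Iq]
      refine integral_mono (s32_int (hf i) hg) ((hf i).cube_int.add Iq)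
        fun x => ?_
      beta_reduce
      have b1 : |(1/26244 : ℝ) * (w x * √(w x ^ 2 + δ ^ 2))| ≤ 1/26244 * (|w x| ^ 2 + δ * |w x|) := by
        rw [abs_mul, abs_mul, abs_of_pos (by norm_num : (0:ℝ) < 1/26244), abs_of_nonneg (Real.sqrt_nonneg _)]
        have : √(w x ^ 2 + δ ^ 2) ≤ |w x| + δ := by
          rw [Real.sqrt_le_left (by positivity)]
          have := abs_nonneg (w x)
          rw [← sq_abs]; nlinarith
        have h0 := abs_nonneg (w x)
        calc _ ≤ 1/26244 * (|w x| * (|w x| + δ)) := by gcongr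
          _ = _ := by ring
      have b2 : √(1/26244 * (|w x| ^ 2 + δ * |w x|)) = 1/162 * √(|w x| ^ 2 + δ * |w x|) := by
        rw [Real.sqrt_mul (by norm_num), show (1/26244:ℝ) = (1/162) ^ 2 by norm_num, Real.sqrt_sq (by norm_num)]
      have b3 := s32_le |w x| (δ * |w x|) (abs_nonneg _) (by positivity)
      rw [Real.sqrt_mul hδ.le] at b3
      have b4 : |(1/26244 : ℝ) * (w x * √(w x ^ 2 + δ ^ 2))| * √|(1/26244 : ℝ) * (w x * √(w x ^ 2 + δ ^ 2))|
          ≤ (1/26244 * (|w x| ^ 2 + δ * |w x|)) * (1/162 * √(|w x| ^ 2 + δ * |w x|)) := by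
        rw [← b2]; gcongr
      have b5 : (1/26244 * (|w x| ^ 2 + δ * |w x|)) * (1/162 * √(|w x| ^ 2 + δ * |w x|))
        = 1/26244 * (1/162) * ((|w x| ^ 2 + δ * |w x|) * √(|w x| ^ 2 + δ * |w x|)) := by ring
      have b6 : 3 * (|w x| ^ 3 + δ * |w x| * (√δ * √|w x|)) = 3 * (|w x| ^ 3 + δ * √δ * (|w x| * √|w x|)) := by ring
      linarith
    have h4 := Finset.sum_le_sum fun (i : Fin 3) (_ : i ∈ Finset.univ) => h3 i
    rw [Finset.sum_add_distrib] at h4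
    simp only [Finset.sum_const, Finset.card_univ, Fintype.card_fin, nsmul_eq_mul] at h4
    push_cast at h4
    have h5 := h2.trans (h1.trans (mul_le_mul_of_nonneg_left h4 (by norm_num)))
    linarith
  have key2 : (1/26244 : ℝ) * W ≤ 9 * F + 1/2 * (1/26244) * (W + 0 * √0 * ∫ x, |w x| * √|w x|) := by
    have hc : Continuous (fun δ : ℝ => 9 * F + 1/2 * (1/26244) * (W + δ * √δ * ∫ x, |w x| * √|w x|)) := by fun_prop
    refine ge_of_tendsto ((hc.tendsto 0).mono_left (nhdsWithin_le_nhds (s := Set.Ioi 0))) ?_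
    filter_upwards [self_mem_nhdsWithin] with e he using key e he
  linarith

lemma pd_eq {v : E3 → E3} (hv : Differentiable ℝ v) (i j : Fin 3) (x : E3) :
    pd v i j x = pds (fun y => v y j) i x := by
  unfold pd pds
  have h := ((EuclideanSpace.proj (𝕜 := ℝ) j : E3 →L[ℝ] ℝ).hasFDerivAt.comp x (hv x).hasFDerivAt)
  have : fderiv ℝ (fun y => v y j) x = (EuclideanSpace.proj (𝕜 := ℝ) j : E3 →L[ℝ] ℝ) ∘L fderiv ℝ v x := h.fderiv
  rw [this]; rfl

/-- smooth compactly supported vector fields -/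
structure CSv (U : E3 → E3) : Prop where
  smooth : ContDiff ℝ (⊤ : ℕ∞) U
  supp : HasCompactSupport U
lemma CSv.comp {U : E3 → E3} (h : CSv U) (j : Fin 3) : CSf (fun x => U x j) :=
  ⟨(EuclideanSpace.proj (𝕜 := ℝ) j : E3 →L[ℝ] ℝ).contDiff.comp h.smooth,
    h.supp.comp_left (g := fun y : E3 => y j) (by simp)⟩
lemma CSv.diff {U : E3 → E3} (h : CSv U) : Differentiable ℝ U := h.smooth.differentiable (by simp)
lemma CSv.pd {U : E3 → E3} (h : CSv U) (i j : Fin 3) : CSf (pd U i j) := by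
  have : _root_.pd U i j = _root_.pds (fun y => U y j) i := funext fun x => pd_eq h.diff i j x
  rw [this]; exact (h.comp j).pds i
lemma CSv.div {U : E3 → E3} (h : CSv U) : CSf (vdiv U) := CSf.sum3 fun i => h.pd i i

lemma mk3_0 (a b c : ℝ) : mk3 a b c 0 = a := rfl
lemma mk3_1 (a b c : ℝ) : mk3 a b c 1 = b := rfl
lemma mk3_2 (a b c : ℝ) : mk3 a b c 2 = c := rfl

lemma mk3_eq (a b c : ℝ) : mk3 a b c = a • ee 0 + b • ee 1 + c • ee 2 := by
  ext i; fin_cases i <;> simp [mk3, ee]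

lemma CSv.curl_cont {U : E3 → E3} (h : CSv U) : Continuous (vcurl U) := by
  have := fun i j => (h.pd i j).cont
  unfold vcurl
  simp only [mk3_eq]
  fun_prop
lemma CSv.curl_supp {U : E3 → E3} (h : CSv U) : HasCompactSupport (vcurl U) := by
  have h1 : HasCompactSupport (fun x => fderiv ℝ U x) := h.supp.fderiv ℝ
  refine h1.mono' ?_
  intro x hx
  refine subset_tsupport _ ?_
  intro h0
  apply hx
  simp only [vcurl, _root_.pd, h0, mk3_eq]
  simp
lemma CSv.curl_int {U : E3 → E3} (h : CSv U) : Integrable (fun x => ‖vcurl U x‖ ^ 3) :=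
  cs_int (h.curl_cont.norm.pow 3) (h.curl_supp.comp_left (g := fun y : E3 => ‖y‖ ^ 3) (by simp))

/-- div-curl estimate -/
lemma cz_main {U : E3 → E3} (h : CSv U) (k j : Fin 3) :
    ∫ x, |pd U k j x| ^ 3 ≤ 1417176 * ((∫ x, ‖vcurl U x‖ ^ 3) + ∫ x, |vdiv U x| ^ 3) := by
  set f : Fin 3 → E3 → ℝ := fun i x => (pd U i j x - pd U j i x) + (if i = j then 1 else 0) * vdiv U x with hfd
  have hf : ∀ i, CSf (f i) := fun i => ((h.pd i j).sub (h.pd j i)).add (h.div.cmul _)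
  have hlap : ∀ x, lap (fun x => U x j) x = ∑ i, pds (f i) i x := by
    intro x
    have e1 : ∀ i, pds (f i) i x = pds (pd U i j) i x - pds (pd U j i) i x + (if i = j then 1 else 0) * pds (vdiv U) i x := by
      intro i
      unfold pds
      have := (((((h.pd i j).diff x).hasFDerivAt.sub ((h.pd j i).diff x).hasFDerivAt).add
        ((h.div.diff x).hasFDerivAt.const_mul (if i = j then (1:ℝ) else 0)))).fderiv
      have h2 : fderiv ℝ (f i) x = _ := this
      rw [h2]; split_ifs <;> simp
    have e2 : pds (vdiv U) j x = ∑ i, pds (pd U i i) j x := by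
      unfold pds
      have : vdiv U = fun x => ∑ i, pd U i i x := rfl
      rw [this, fderiv_fun_sum (fun l _ => ((h.pd l l).diff x))]
      simp
    have e3 : ∀ i, pds (pd U j i) i x = pds (pd U i i) j x := by
      intro i
      have q1 : pd U j i = pds (fun y => U y i) j := funext fun x => pd_eq h.diff j i x
      have q2 : pd U i i = pds (fun y => U y i) i := funext fun x => pd_eq h.diff i i x
      rw [q1, q2]; exact pds_comm (h.comp i) j i x
    have e4 : lap (fun x => U x j) x = ∑ i, pds (pd U i j) i x := by
      unfold lap
      refine Finset.sum_congr rfl fun i _ => ?_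
      have q1 : pd U i j = pds (fun y => U y j) i := funext fun x => pd_eq h.diff i j x
      rw [q1]
    simp only [e1, e3, Finset.sum_add_distrib, Finset.sum_sub_distrib, ite_mul, one_mul, zero_mul,
      Finset.sum_ite_eq', Finset.mem_univ, if_true]
    rw [e4, e2]; ring
  have h1 := cz_scalar (h.comp j) hf hlap k
  have e0 : (fun x => |pd U k j x| ^ 3) = fun x => |pds (fun x => U x j) k x| ^ 3 := by
    funext x; rw [pd_eq h.diff]
  rw [e0]
  refine h1.trans ?_
  have h2 : ∀ i, ∫ x, |f i x| ^ 3 ≤ (∫ x, ‖vcurl U x‖ ^ 3) + ∫ x, |vdiv U x| ^ 3 := by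
    intro i
    rw [← integral_add h.curl_int h.div.cube_int]
    refine integral_mono (hf i).cube_int (h.curl_int.add h.div.cube_int) fun x => ?_
    beta_reduce
    by_cases hij : i = j
    · have : |f i x| = |vdiv U x| := by simp [hfd, hij]
      rw [this]
      have : 0 ≤ ‖vcurl U x‖ ^ 3 := by positivity
      linarith
    · have h3 : |f i x| ≤ ‖vcurl U x‖ := by
        have a0 := PiLp.norm_apply_le (vcurl U x) 0
        have a1 := PiLp.norm_apply_le (vcurl U x) 1
        have a2 := PiLp.norm_apply_le (vcurl U x) 2
        simp only [Real.norm_eq_abs, vcurl, mk3_0, mk3_1, mk3_2] at a0 a1 a2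
        simp only [hfd, if_neg hij, zero_mul, add_zero]
        rw [abs_sub_comm] at a0 a1 a2
        have a0' := a0
        have a1' := a1
        have a2' := a2
        rw [abs_sub_comm] at a0' a1' a2'
        revert hij
        fin_cases i <;> fin_cases j <;> simp <;> assumption
      have : |f i x| ^ 3 ≤ ‖vcurl U x‖ ^ 3 := by gcongr
      have : 0 ≤ |vdiv U x| ^ 3 := by positivity
      linarith
  have h3 := Finset.sum_le_sum fun (i : Fin 3) (_ : i ∈ Finset.univ) => h2 i
  simp only [Finset.sum_const, Finset.card_univ, Fintype.card_fin, nsmul_eq_mul] at h3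
  push_cast at h3
  linarith
end

section
/-- distance to the boundary as an extended nonnegative real -/
def dE (Ω : Set E3) (y : E3) : ℝ≥0∞ := ENNReal.ofReal (dB Ω y)

lemma rpow_anti {a b : ℝ≥0∞} (h : a ≤ b) {s : ℝ} (hs : 0 ≤ s) : b ^ (-s) ≤ a ^ (-s) := by
  rw [ENNReal.rpow_neg, ENNReal.rpow_neg]
  exact ENNReal.inv_le_inv.2 (ENNReal.rpow_le_rpow h hs)

lemma half_line_int {s : ℝ} (hs1 : s < 1) {R : ℝ} (hR : 0 < R) :
    ∫⁻ t in Set.Ioo 0 R, (ENNReal.ofReal |t|) ^ (-s) = ENNReal.ofReal (R ^ (1 - s) / (1 - s)) := by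
  have h1 : ∫⁻ t in Set.Ioo 0 R, (ENNReal.ofReal |t|) ^ (-s) = ∫⁻ t in Set.Ioo 0 R, ENNReal.ofReal (t ^ (-s)) := by
    refine setLIntegral_congr_fun measurableSet_Ioo fun t ht => ?_
    rw [abs_of_pos ht.1, ENNReal.ofReal_rpow_of_pos ht.1]
  have h2 := intervalIntegral.intervalIntegrable_rpow' (a := 0) (b := R) (r := -s) (by linarith)
  rw [intervalIntegrable_iff_integrableOn_Ioo_of_le hR.le] at h2
  rw [h1, ← ofReal_integral_eq_lintegral_ofReal h2]
  · congr 1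
    rw [← integral_Ioc_eq_integral_Ioo, ← intervalIntegral.integral_of_le hR.le, integral_rpow (Or.inl (by linarith))]
    rw [Real.zero_rpow (by linarith), show -s + 1 = 1 - s by ring]; simp
  · exact (ae_restrict_iff' measurableSet_Ioo).2 (Eventually.of_forall fun t ht => Real.rpow_nonneg ht.1.le _)

lemma line_int {s : ℝ} (hs0 : 0 ≤ s) (hs1 : s < 1) {R : ℝ} (hR : 0 < R) (p a : ℝ) :
    ∫⁻ t in Set.Ioo (p - R) (p + R), (ENNReal.ofReal |t - a|) ^ (-s) ≤
      ENNReal.ofReal ((2 / (1 - s) + 2) * R ^ (1 - s)) := by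
  have hm : Measurable (fun t : ℝ => (ENNReal.ofReal |t - a|) ^ (-s)) := by fun_prop
  have h1 : Set.Ioo (p - R) (p + R) ⊆ (Set.Ioo (a - R) a ∪ {a}) ∪ (Set.Ioo a (a + R) ∪ (Set.Ioo (p - R) (p + R) ∩ {t | R ≤ |t - a|})) := by
    intro t ht
    by_cases h : R ≤ |t - a|
    · exact Or.inr (Or.inr ⟨ht, h⟩)
    · rw [not_le, abs_lt] at h
      rcases lt_trichotomy t a with h' | h' | h'
      · exact Or.inl (Or.inl ⟨by linarith, h'⟩)
      · exact Or.inl (Or.inr h')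
      · exact Or.inr (Or.inl ⟨h', by linarith⟩)
  have e1 : ∫⁻ t in Set.Ioo a (a + R), (ENNReal.ofReal |t - a|) ^ (-s) = ENNReal.ofReal (R ^ (1 - s) / (1 - s)) := by
    rw [← half_line_int hs1 hR]
    have := (measurePreserving_sub_right (volume : Measure ℝ) a).setLIntegral_comp_preimage (s := Set.Ioo 0 R)
      measurableSet_Ioo (f := fun t => (ENNReal.ofReal |t|) ^ (-s)) (by fun_prop)
    rw [← this]
    congr 2
    ext t; simp; intro _; constructor <;> intro h <;> linarith
  have e2 : ∫⁻ t in Set.Ioo (a - R) a, (ENNReal.ofReal |t - a|) ^ (-s) = ENNReal.ofReal (R ^ (1 - s) / (1 - s)) := by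
    rw [← half_line_int hs1 hR]
    have := (Measure.measurePreserving_sub_left (volume : Measure ℝ) a).setLIntegral_comp_preimage (s := Set.Ioo 0 R)
      measurableSet_Ioo (f := fun t => (ENNReal.ofReal |t|) ^ (-s)) (by fun_prop)
    rw [← this]
    have hset : Set.Ioo (a - R) a = (fun x => a - x) ⁻¹' Set.Ioo 0 R := by
      ext t; simp [and_comm]
    rw [hset]
    refine lintegral_congr fun t => ?_
    rw [abs_sub_comm]
  have e3 : ∫⁻ t in Set.Ioo (p - R) (p + R) ∩ {t | R ≤ |t - a|}, (ENNReal.ofReal |t - a|) ^ (-s)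
      ≤ ENNReal.ofReal (2 * R ^ (1 - s)) := by
    calc _ ≤ ∫⁻ t in Set.Ioo (p - R) (p + R) ∩ {t | R ≤ |t - a|}, (ENNReal.ofReal R) ^ (-s) := by
          refine setLIntegral_mono' (measurableSet_Ioo.inter (measurableSet_le measurable_const (by fun_prop))) fun t ht => ?_
          exact rpow_anti (ENNReal.ofReal_le_ofReal ht.2) hs0
      _ = (ENNReal.ofReal R) ^ (-s) * volume (Set.Ioo (p - R) (p + R) ∩ {t | R ≤ |t - a|}) := by
          rw [setLIntegral_const]
      _ ≤ (ENNReal.ofReal R) ^ (-s) * volume (Set.Ioo (p - R) (p + R)) := by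
          gcongr; exact Set.inter_subset_left
      _ = _ := by
          rw [Real.volume_Ioo, ENNReal.ofReal_rpow_of_pos hR, ← ENNReal.ofReal_mul (by positivity)]
          congr 1
          rw [show (1 - s) = -s + 1 by ring, Real.rpow_add_one hR.ne']; ring
  have e4 : ∫⁻ t in ({a} : Set ℝ), (ENNReal.ofReal |t - a|) ^ (-s) = 0 := by
    rw [Measure.restrict_singleton]; simp
  calc _ ≤ _ := lintegral_mono_set h1
    _ ≤ _ := lintegral_union_le _ _ _
    _ ≤ _ := add_le_add (lintegral_union_le _ _ _) (lintegral_union_le _ _ _)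
    _ ≤ (ENNReal.ofReal (R ^ (1 - s) / (1 - s)) + 0) + (ENNReal.ofReal (R ^ (1 - s) / (1 - s)) + ENNReal.ofReal (2 * R ^ (1 - s))) := by
        rw [e1, e2, e4]; gcongr
    _ = _ := by
        have : 0 < 1 - s := by linarith
        rw [add_zero, ← ENNReal.ofReal_add (by positivity) (by positivity), ← ENNReal.ofReal_add (by positivity) (by positivity)]
        congr 1; field_simp; ring

/-- The splitting `ℝ³ = ℝ × ℝ²`. -/
def splitF (y : E3) : ℝ × (Fin 2 → ℝ) := (y 2, fun j => y (Fin.succAbove 2 j))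

lemma splitF_eq (y : E3) : splitF y = (y 2, fun j => y (Fin.succAbove 2 j)) := rfl

lemma split_mp : MeasurePreserving splitF volume volume :=
  (volume_preserving_piFinSuccAbove (fun _ : Fin 3 => ℝ) 2).comp (PiLp.volume_preserving_ofLp (Fin 3))

lemma graph_int {s : ℝ} (hs0 : 0 ≤ s) (hs1 : s < 1) {R : ℝ} (hR : 0 < R) (x : E3) (a : E2 → ℝ) (ha : Continuous a) :
    ∫⁻ y in Metric.ball x R, (ENNReal.ofReal |y 2 - a (proj12 y)|) ^ (-s) ≤
      ENNReal.ofReal (4 * (2 / (1 - s) + 2) * R ^ (3 - s)) := by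
  set T : Set (Fin 2 → ℝ) := Set.univ.pi fun j => Set.Ioo (x (Fin.succAbove 2 j) - R) (x (Fin.succAbove 2 j) + R)
  set S : Set ℝ := Set.Ioo (x 2 - R) (x 2 + R)
  set H : ℝ × (Fin 2 → ℝ) → ℝ≥0∞ := fun p => (ENNReal.ofReal |p.1 - a (mk2 (p.2 0) (p.2 1))|) ^ (-s)
  have hH : Measurable H := by
    have : Continuous (fun p : ℝ × (Fin 2 → ℝ) => mk2 (p.2 0) (p.2 1)) := by
      unfold mk2
      refine (PiLp.continuous_toLp 2 _).comp ?_
      refine continuous_pi fun i => ?_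
      fin_cases i <;> simp <;> fun_prop
    have h2 : Continuous (fun p : ℝ × (Fin 2 → ℝ) => |p.1 - a (mk2 (p.2 0) (p.2 1))|) := by fun_prop
    exact (h2.measurable.ennreal_ofReal).pow_const _
  have hST : MeasurableSet (S ×ˢ T) := measurableSet_Ioo.prod (MeasurableSet.univ_pi fun _ => measurableSet_Ioo)
  have h1 := split_mp.setLIntegral_comp_preimage hST hH
  have hc : ∀ y ∈ Metric.ball x R, ∀ j, y j ∈ Set.Ioo (x j - R) (x j + R) := by
    intro y hy j
    have h2 := PiLp.norm_apply_le (y - x) j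
    rw [Metric.mem_ball, dist_eq_norm] at hy
    have h3 : |y j - x j| < R := by simpa using h2.trans_lt hy
    rw [abs_lt] at h3
    exact ⟨by linarith, by linarith⟩
  have hval : ∀ y : E3, (ENNReal.ofReal |y 2 - a (proj12 y)|) ^ (-s) = H (splitF y) := by
    intro y
    have e0 : Fin.succAbove (2 : Fin 3) 0 = 0 := by decide
    have e1 : Fin.succAbove (2 : Fin 3) 1 = 1 := by decide
    simp only [H, splitF_eq, proj12, e0, e1]
  simp only [hval]
  calc _ ≤ ∫⁻ y in splitF ⁻¹' (S ×ˢ T), H (splitF y) := by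
        refine lintegral_mono_set ?_
        intro y hy
        rw [Set.mem_preimage, splitF_eq]
        exact ⟨hc y hy 2, fun j _ => hc y hy _⟩
    _ = ∫⁻ p in S ×ˢ T, H p := h1
    _ = ∫⁻ q in T, ∫⁻ t in S, H (t, q) := setLIntegral_prod_symm _ hH.aemeasurable
    _ ≤ ∫⁻ q in T, ENNReal.ofReal ((2 / (1 - s) + 2) * R ^ (1 - s)) :=
        lintegral_mono fun q => line_int hs0 hs1 hR (x 2) (a (mk2 (q 0) (q 1)))
    _ = ENNReal.ofReal ((2 / (1 - s) + 2) * R ^ (1 - s)) * volume T := setLIntegral_const _ _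
    _ = _ := by
        have h0 : 0 < 1 - s := by linarith
        rw [Real.volume_pi_Ioo]
        simp only [Fin.prod_univ_two]
        rw [← ENNReal.ofReal_mul (by linarith), ← ENNReal.ofReal_mul (by positivity)]
        congr 1
        rw [show 3 - s = (1 - s) + 2 by ring, Real.rpow_add hR]
        norm_num
        ring
end

section
lemma rpow_neg_le {X d c : ℝ≥0∞} (hc1 : 1 ≤ c) (hc : c ≠ ⊤) (h : X ≤ c * d) {s : ℝ} (hs0 : 0 ≤ s) (hs1 : s ≤ 1) :
    d ^ (-s) ≤ c * X ^ (-s) := by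
  have hc0 : c ≠ 0 := (zero_lt_one.trans_le hc1).ne'
  have h1 : X ^ s ≤ c * d ^ s := by
    refine (ENNReal.rpow_le_rpow h hs0).trans ?_
    rw [ENNReal.mul_rpow_of_nonneg _ _ hs0]
    gcongr
    simpa using ENNReal.rpow_le_rpow_of_exponent_le hc1 hs1
  rw [ENNReal.rpow_neg, ENNReal.rpow_neg]
  have h2 := ENNReal.inv_le_inv.2 h1
  rw [ENNReal.mul_inv (Or.inl hc0) (Or.inl hc)] at h2
  calc (d ^ s)⁻¹ = c * (c⁻¹ * (d ^ s)⁻¹) := by rw [← mul_assoc, ENNReal.mul_inv_cancel hc0 hc, one_mul]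
    _ ≤ _ := by gcongr

section
variable {Ω : Set E3}

lemma frontier_cpt (hΩ : IsLipschitzDomain Ω) : IsCompact (frontier Ω) :=
  hΩ.isBounded.isCompact_closure.of_isClosed_subset isClosed_frontier frontier_subset_closure

lemma frontier_ne (hΩ : IsLipschitzDomain Ω) : (frontier Ω).Nonempty := by
  rw [Set.nonempty_iff_ne_empty]
  intro h
  rcases isClopen_iff.1 (isClopen_iff_frontier_eq_empty.2 h) with h1 | h1
  · exact hΩ.nonempty.ne_empty h1
  · have := hΩ.isBounded
    rw [h1] at this
    exact NormedSpace.unbounded_univ ℝ E3 this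

lemma dB_pos (hΩ : IsLipschitzDomain Ω) {x : E3} (hx : x ∈ Ω) : 0 < dB Ω x := by
  refine (isClosed_frontier.notMem_iff_infDist_pos (frontier_ne hΩ)).1 ?_
  intro h
  rw [hΩ.isOpen.frontier_eq] at h
  exact h.2 hx

lemma dB_nonneg (x : E3) : 0 ≤ dB Ω x := Metric.infDist_nonneg

lemma dB_le (x y : E3) : dB Ω x ≤ dB Ω y + dist x y := Metric.infDist_le_infDist_add_dist

lemma dB_cont : Continuous (dB Ω) := Metric.continuous_infDist_pt _

lemma proj12_norm_le (y : E3) : ‖proj12 y‖ ≤ ‖y‖ := by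
  rw [EuclideanSpace.norm_eq, EuclideanSpace.norm_eq]
  apply Real.sqrt_le_sqrt
  simp only [Fin.sum_univ_two, Fin.sum_univ_three]
  have h0 : proj12 y 0 = y 0 := rfl
  have h1 : proj12 y 1 = y 1 := rfl
  rw [h0, h1]
  nlinarith [sq_nonneg ‖y 2‖]

lemma proj12_sub (y z : E3) : proj12 y - proj12 z = proj12 (y - z) := by
  ext i; fin_cases i <;> rfl

lemma isom_mp (f : E3 ≃ᵢ E3) : MeasurePreserving f volume volume := by
  have h1 := f.toRealLinearIsometryEquiv.measurePreserving
  have h2 := (measurePreserving_add_right (volume : Measure E3) (f 0)).comp h1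
  have h3 : ⇑f = (fun x => x + f 0) ∘ ⇑f.toRealLinearIsometryEquiv := by
    funext x
    simp [IsometryEquiv.toRealLinearIsometryEquiv_apply]
  rw [h3]; exact h2

lemma chart_int (hΩ : IsLipschitzDomain Ω) {s : ℝ} (hs0 : 0 ≤ s) (hs1 : s < 1) {P : E3} (hP : P ∈ frontier Ω) :
    ∃ ρ > 0, ∀ x R, 0 < R → Metric.ball x R ⊆ Metric.ball P ρ →
      ∫⁻ y in Metric.ball x R, (dE Ω y) ^ (-s) ≤ ENNReal.ofReal (2 * (4 * (2 / (1 - s) + 2) * R ^ (3 - s))) := by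
  obtain ⟨f, R0, R1, r, a, fP, hR0, hR1, hr0, hr1, ha, -, hfr, -⟩ := hΩ.charts P hP
  refine ⟨min R0 R1 / 2, by positivity, fun x R hR hsub => ?_⟩
  have key : ∀ y ∈ Metric.ball x R, (dE Ω y) ^ (-s) ≤ 2 * (ENNReal.ofReal |(f y) 2 - a (proj12 (f y))|) ^ (-s) := by
    intro y hy
    have hy := Metric.mem_ball.1 (hsub hy)
    obtain ⟨Q, hQ, hQd⟩ := (frontier_cpt hΩ).exists_infDist_eq_dist (frontier_ne hΩ) y
    have h1 : dist y Q ≤ dist y P := hQd ▸ Metric.infDist_le_dist_of_mem hP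
    have h2 : ‖f Q‖ < min R0 R1 := by
      have : ‖f Q‖ = dist Q P := by rw [← f.dist_eq Q P, fP, dist_zero_right]
      rw [this]
      have := dist_triangle_left Q P y
      linarith
    have h3 : (f Q) 2 = a (proj12 (f Q)) := by
      refine (hfr (f Q) ((proj12_norm_le _).trans_lt (h2.trans_le (min_le_left _ _))) ?_).1 (by simpa using hQ)
      exact (PiLp.norm_apply_le (f Q) 2).trans_lt (h2.trans_le (min_le_right _ _))
    have h4 : |(f y) 2 - a (proj12 (f y))| ≤ 2 * dB Ω y := by
      have e1 : |(f y) 2 - (f Q) 2| ≤ dist y Q := by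
        rw [← f.dist_eq, dist_eq_norm]; exact PiLp.norm_apply_le (f y - f Q) 2
      have e2 : |a (proj12 (f Q)) - a (proj12 (f y))| ≤ dist y Q := by
        have := ha.dist_le_mul (proj12 (f Q)) (proj12 (f y))
        rw [Real.dist_eq, dist_eq_norm, proj12_sub] at this
        have e3 := proj12_norm_le (f Q - f y)
        rw [← dist_eq_norm, f.dist_eq, dist_comm] at e3
        rw [Real.coe_toNNReal _ hr0.le] at this
        have e4 : r * ‖proj12 (f Q - f y)‖ ≤ 1 * ‖proj12 (f Q - f y)‖ := by gcongr
        linarith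
      have e5 := abs_add_le ((f y) 2 - (f Q) 2) (a (proj12 (f Q)) - a (proj12 (f y)))
      rw [h3, sub_add_sub_cancel] at e5
      have : dB Ω y = dist y Q := hQd
      rw [h3] at e1
      linarith
    have h5 : (ENNReal.ofReal |(f y) 2 - a (proj12 (f y))|) ≤ 2 * dE Ω y := by
      refine (ENNReal.ofReal_le_ofReal h4).trans_eq ?_
      rw [ENNReal.ofReal_mul zero_le_two]; simp [dE]
    exact rpow_neg_le one_le_two (by simp) h5 hs0 hs1.le
  have hm : Measurable fun z : E3 => (ENNReal.ofReal |z 2 - a (proj12 z)|) ^ (-s) := by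
    have : Continuous proj12 := by
      refine LipschitzWith.continuous (K := 1) (LipschitzWith.of_dist_le_mul fun y z => ?_)
      rw [dist_eq_norm, dist_eq_norm, proj12_sub]; simpa using proj12_norm_le _
    have h2 : Continuous (fun z : E3 => |z 2 - a (proj12 z)|) := by
      have := ha.continuous.comp this
      have h3 : Continuous fun z : E3 => z 2 := by fun_prop
      exact (h3.sub this).abs
    exact (h2.measurable.ennreal_ofReal).pow_const _
  calc _ ≤ ∫⁻ y in Metric.ball x R, 2 * (ENNReal.ofReal |(f y) 2 - a (proj12 (f y))|) ^ (-s) :=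
        setLIntegral_mono' measurableSet_ball key
    _ = 2 * ∫⁻ y in Metric.ball x R, (ENNReal.ofReal |(f y) 2 - a (proj12 (f y))|) ^ (-s) :=
        lintegral_const_mul' _ _ (by simp)
    _ = 2 * ∫⁻ z in Metric.ball (f x) R, (ENNReal.ofReal |z 2 - a (proj12 z)|) ^ (-s) := by
        rw [← (isom_mp f).setLIntegral_comp_preimage measurableSet_ball hm]
        rw [f.preimage_ball]; simp
    _ ≤ 2 * ENNReal.ofReal (4 * (2 / (1 - s) + 2) * R ^ (3 - s)) := by
        gcongr; exact graph_int hs0 hs1 hR _ a ha.continuous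
    _ = _ := by rw [ENNReal.ofReal_mul zero_le_two]; simp
end
end

section
section
variable {Ω : Set E3}

lemma far_int {s : ℝ} (hs0 : 0 ≤ s) (x : E3) {R : ℝ} (hR : 0 < R) (h : 2 * R ≤ dB Ω x) :
    ∫⁻ y in Metric.ball x R, (dE Ω y) ^ (-s) ≤
      ENNReal.ofReal ((volume (Metric.ball (0:E3) 1)).toReal * R ^ (3 - s)) := by
  calc _ ≤ ∫⁻ y in Metric.ball x R, (ENNReal.ofReal R) ^ (-s) := by
        refine setLIntegral_mono' measurableSet_ball fun y hy => rpow_anti (ENNReal.ofReal_le_ofReal ?_) hs0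
        have := dB_le (Ω := Ω) x y
        rw [Metric.mem_ball, dist_comm] at hy
        linarith
    _ = (ENNReal.ofReal R) ^ (-s) * volume (Metric.ball x R) := setLIntegral_const _ _
    _ = _ := by
        rw [Measure.addHaar_ball _ _ hR.le, ENNReal.ofReal_mul (by positivity),
          ENNReal.ofReal_toReal measure_ball_lt_top.ne, ENNReal.ofReal_rpow_of_pos hR, mul_comm, mul_assoc, mul_comm, mul_assoc]
        congr 1
        rw [← ENNReal.ofReal_mul (by positivity)]
        congr 1
        rw [finrank_euclideanSpace_fin, ← Real.rpow_natCast, ← Real.rpow_add hR]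
        congr 1; push_cast; ring

lemma star_small (hΩ : IsLipschitzDomain Ω) {s : ℝ} (hs0 : 0 ≤ s) (hs1 : s < 1) :
    ∃ δ > 0, ∃ C > 0, ∀ x R, 0 < R → R ≤ δ → 
      ∫⁻ y in Metric.ball x R, (dE Ω y) ^ (-s) ≤ ENNReal.ofReal (C * R ^ (3 - s)) := by
  have h := fun P : frontier Ω => chart_int hΩ hs0 hs1 P.2
  choose ρ hρ hc using h
  obtain ⟨δ, hδ, hL⟩ := lebesgue_number_lemma_of_metric (frontier_cpt hΩ) (c := fun P : frontier Ω => Metric.ball (P:E3) (ρ P))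
    (fun _ => Metric.isOpen_ball) (fun P hP => Set.mem_iUnion.2 ⟨⟨P, hP⟩, Metric.mem_ball_self (hρ _)⟩)
  have hs : 0 < 1 - s := by linarith
  refine ⟨δ / 4, by positivity, 2 * (4 * (2 / (1 - s) + 2)) + (volume (Metric.ball (0:E3) 1)).toReal, by positivity, fun x R hR hRδ => ?_⟩
  by_cases hx : 2 * R ≤ dB Ω x
  · refine (far_int hs0 x hR hx).trans (ENNReal.ofReal_le_ofReal ?_)
    have : 0 < R ^ (3 - s) := by positivity
    have : 0 < 2 * (4 * (2 / (1 - s) + 2)) * R ^ (3 - s) := by positivity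
    nlinarith
  · push Not at hx
    obtain ⟨Q, hQ, hQd⟩ := (frontier_cpt hΩ).exists_infDist_eq_dist (frontier_ne hΩ) x
    obtain ⟨P, hP⟩ := hL Q hQ
    refine (hc P x R hR (subset_trans ?_ hP)).trans (ENNReal.ofReal_le_ofReal ?_)
    · refine Metric.ball_subset_ball' ?_
      have : dist x Q < 2 * R := hQd ▸ hx
      linarith
    · have : 0 ≤ (volume (Metric.ball (0:E3) 1)).toReal * R ^ (3 - s) := by positivity
      nlinarith

lemma total_int (hΩ : IsLipschitzDomain Ω) {s : ℝ} (hs0 : 0 ≤ s) (hs1 : s < 1) :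
    ∫⁻ y in Ω, (dE Ω y) ^ (-s) < ⊤ := by
  obtain ⟨δ, hδ, C, hC, h⟩ := star_small hΩ hs0 hs1
  have := hΩ.isBounded.isCompact_closure.induction_on (p := fun S => ∫⁻ y in S, (dE Ω y) ^ (-s) < ⊤)
    (by simp) (fun S T hST hT => (lintegral_mono_set hST).trans_lt hT)
    (fun S T hS hT => (lintegral_union_le _ _ _).trans_lt (ENNReal.add_lt_top.2 ⟨hS, hT⟩))
    (fun x _ => ⟨Metric.ball x δ, mem_nhdsWithin_of_mem_nhds (Metric.ball_mem_nhds x hδ), (h x δ hδ le_rfl).trans_lt ENNReal.ofReal_lt_top⟩)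
  exact (lintegral_mono_set subset_closure).trans_lt this

/-- The basic geometric estimate. -/
lemma star_int (hΩ : IsLipschitzDomain Ω) {s : ℝ} (hs0 : 0 ≤ s) (hs1 : s < 1) :
    ∃ C > 0, ∀ x R, 0 < R →
      ∫⁻ y in Metric.ball x R ∩ Ω, (dE Ω y) ^ (-s) ≤ ENNReal.ofReal (C * R ^ (3 - s)) := by
  obtain ⟨δ, hδ, C, hC, h⟩ := star_small hΩ hs0 hs1
  set I := (∫⁻ y in Ω, (dE Ω y) ^ (-s)).toReal
  refine ⟨C + I / δ ^ (3 - s), by positivity, fun x R hR => ?_⟩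
  rcases le_total R δ with hR' | hR'
  · refine (lintegral_mono_set Set.inter_subset_left).trans ((h x R hR hR').trans (ENNReal.ofReal_le_ofReal ?_))
    gcongr
    have : 0 ≤ I / δ ^ (3 - s) := by positivity
    linarith
  · refine (lintegral_mono_set Set.inter_subset_right).trans ?_
    rw [← ENNReal.ofReal_toReal (total_int hΩ hs0 hs1).ne]
    refine ENNReal.ofReal_le_ofReal ?_
    have h1 : δ ^ (3 - s) ≤ R ^ (3 - s) := Real.rpow_le_rpow hδ.le hR' (by linarith)
    have h2 : 0 < δ ^ (3 - s) := by positivity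
    have h4 : 0 ≤ I := ENNReal.toReal_nonneg
    have h3 : I ≤ I / δ ^ (3 - s) * R ^ (3 - s) := by
      rw [div_mul_eq_mul_div, le_div_iff₀ h2]; gcongr
    have : 0 ≤ C * R ^ (3 - s) := by positivity
    change I ≤ _
    linarith
end
end

section
section
variable {Ω : Set E3}

lemma dE_meas : Measurable (dE Ω) := (dB_cont (Ω := Ω)).measurable.ennreal_ofReal

lemma annulus_int {s γ C : ℝ} (hγ : 0 ≤ γ)
    (hC : ∀ x R, 0 < R → ∫⁻ y in Metric.ball x R ∩ Ω, (dE Ω y) ^ (-s) ≤ ENNReal.ofReal (C * R ^ (3 - s)))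
    (x : E3) {a b : ℝ} (ha : 0 < a) (hb : 0 < b) :
    ∫⁻ y in {y | a ≤ dist x y} ∩ (Metric.ball x b ∩ Ω), (edist x y) ^ (-γ) * (dE Ω y) ^ (-s) ≤
      ENNReal.ofReal (a ^ (-γ) * (C * b ^ (3 - s))) := by
  have hm : MeasurableSet {y : E3 | a ≤ dist x y} := (isClosed_le continuous_const (by fun_prop)).measurableSet
  calc _ = ∫⁻ y in (Metric.ball x b ∩ Ω), {y | a ≤ dist x y}.indicator (fun y => (edist x y) ^ (-γ) * (dE Ω y) ^ (-s)) y := by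
        rw [lintegral_indicator hm, Measure.restrict_restrict hm]
    _ ≤ ∫⁻ y in (Metric.ball x b ∩ Ω), ENNReal.ofReal (a ^ (-γ)) * (dE Ω y) ^ (-s) := by
        refine lintegral_mono fun y => ?_
        by_cases hy : y ∈ {y | a ≤ dist x y}
        · rw [Set.indicator_of_mem hy]
          gcongr
          rw [edist_dist, ← ENNReal.ofReal_rpow_of_pos ha]
          exact rpow_anti (ENNReal.ofReal_le_ofReal hy) hγ
        · rw [Set.indicator_of_notMem hy]; exact zero_le
    _ = ENNReal.ofReal (a ^ (-γ)) * ∫⁻ y in (Metric.ball x b ∩ Ω), (dE Ω y) ^ (-s) := lintegral_const_mul' _ _ (by simp)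
    _ ≤ ENNReal.ofReal (a ^ (-γ)) * ENNReal.ofReal (C * b ^ (3 - s)) := by gcongr; exact hC x b hb
    _ = _ := by rw [← ENNReal.ofReal_mul (by positivity)]

lemma geo_sum {f : E3 → ℝ≥0∞} {A : ℕ → Set E3} {S : Set E3} (hS : ∀ᵐ y, y ∈ S → y ∈ ⋃ n, A n) {c q : ℝ} (hc : 0 ≤ c) (hq0 : 0 ≤ q) (hq1 : q < 1)
    (h : ∀ n, ∫⁻ y in A n, f y ≤ ENNReal.ofReal (c * q ^ n)) : ∫⁻ y in S, f y ≤ ENNReal.ofReal (c / (1 - q)) := by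
  calc _ ≤ ∫⁻ y in ⋃ n, A n, f y := lintegral_mono' (Measure.restrict_mono_ae hS) le_rfl
    _ ≤ ∑' n, ∫⁻ y in A n, f y := lintegral_iUnion_le _ _
    _ ≤ ∑' n, ENNReal.ofReal (c * q ^ n) := ENNReal.tsum_le_tsum h
    _ = ENNReal.ofReal (∑' n, c * q ^ n) := by
        rw [ENNReal.ofReal_tsum_of_nonneg (fun n => by positivity)]
        exact (summable_geometric_of_lt_one hq0 hq1).mul_left _
    _ = _ := by rw [(HasSum.mul_left c (hasSum_geometric_of_lt_one hq0 hq1)).tsum_eq]; rfl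

lemma near_int (hΩ : IsLipschitzDomain Ω) {s γ : ℝ} (hs0 : 0 ≤ s) (hs1 : s < 1) (hγ : 0 ≤ γ) (h3 : s + γ < 3) :
    ∃ C > 0, ∀ x R, 0 < R → ∫⁻ y in Metric.ball x R ∩ Ω, (edist x y) ^ (-γ) * (dE Ω y) ^ (-s) ≤
      ENNReal.ofReal (C * R ^ (3 - s - γ)) := by
  obtain ⟨C, hC, h⟩ := star_int hΩ hs0 hs1
  have hq0 : 0 < (2:ℝ) ^ (-(3 - s - γ)) := by positivity
  have hq1 : (2:ℝ) ^ (-(3 - s - γ)) < 1 := Real.rpow_lt_one_of_one_lt_of_neg one_lt_two (by linarith)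
  have hq2 : 0 < 1 - (2:ℝ) ^ (-(3 - s - γ)) := by linarith
  refine ⟨2 ^ γ * 2 ^ (3 - s) * C / (1 - (2:ℝ) ^ (-(3 - s - γ))), by positivity, fun x R hR => ?_⟩
  have := geo_sum (f := fun y => (edist x y) ^ (-γ) * (dE Ω y) ^ (-s)) (S := Metric.ball x R ∩ Ω)
    (A := fun n => {y | R * (1/2) ^ (n + 1) ≤ dist x y} ∩ (Metric.ball x (R * (2 * (1/2) ^ n)) ∩ Ω))
    (c := 2 ^ γ * 2 ^ (3 - s) * C * R ^ (3 - s - γ)) (q := (2:ℝ) ^ (-(3 - s - γ))) ?_ (by positivity) hq0.le hq1 ?_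
  · refine this.trans_eq ?_
    congr 1; ring
  · filter_upwards [Measure.ae_ne volume x] with y hyx hy
    have hd : 0 < dist x y := dist_pos.2 hyx.symm
    have hd2 : dist x y / R < 1 := by
      rw [div_lt_one hR]; rw [dist_comm]; exact hy.1
    obtain ⟨n, h1, h2⟩ := exists_nat_pow_near_of_lt_one (div_pos hd hR) hd2.le (y := (1/2:ℝ)) (by norm_num) (by norm_num)
    refine Set.mem_iUnion.2 ⟨n, ?_, ?_, hy.2⟩
    · rw [lt_div_iff₀ hR] at h1; rw [Set.mem_ofPred_eq]; linarith
    · rw [div_le_iff₀ hR] at h2; rw [Metric.mem_ball, dist_comm]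
      have : 0 < R * (1/2) ^ n := by positivity
      linarith
  · intro n
    refine (annulus_int hγ h x (by positivity) (by positivity)).trans_eq ?_
    congr 1
    have hh : ∀ m : ℕ, ((1:ℝ)/2) ^ m = 2 ^ (-(m:ℝ)) := by
      intro m; rw [Real.rpow_neg two_pos.le, Real.rpow_natCast]; simp
    rw [hh, hh, Real.mul_rpow hR.le (by positivity), Real.mul_rpow hR.le (by positivity), Real.mul_rpow two_pos.le (by positivity),
      ← Real.rpow_natCast, ← Real.rpow_mul two_pos.le, ← Real.rpow_mul two_pos.le, ← Real.rpow_mul two_pos.le]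
    have e1 : (2:ℝ) ^ (-((n+1:ℕ):ℝ) * -γ) = 2 ^ γ * (2:ℝ) ^ ((n:ℝ) * γ) := by
      rw [← Real.rpow_add two_pos]; congr 1; push_cast; ring
    have e2 : (2:ℝ) ^ (-(3 - s - γ) * (n:ℝ)) = 2 ^ ((n:ℝ) * γ) * (2:ℝ) ^ (-(n:ℝ) * (3 - s)) := by
      rw [← Real.rpow_add two_pos]; congr 1; ring
    have e3 : R ^ (3 - s - γ) = R ^ (-γ) * R ^ (3 - s) := by
      rw [← Real.rpow_add hR]; congr 1; ring
    rw [e1, e2, e3]; ring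

lemma outer_int (hΩ : IsLipschitzDomain Ω) {s γ : ℝ} (hs0 : 0 ≤ s) (hs1 : s < 1) (hγ : 0 ≤ γ) (h3 : 3 < s + γ) :
    ∃ C > 0, ∀ x R, 0 < R → ∫⁻ y in {y | R ≤ dist x y} ∩ Ω, (edist x y) ^ (-γ) * (dE Ω y) ^ (-s) ≤
      ENNReal.ofReal (C * R ^ (3 - s - γ)) := by
  obtain ⟨C, hC, h⟩ := star_int hΩ hs0 hs1
  have hq0 : 0 < (2:ℝ) ^ (3 - s - γ) := by positivity
  have hq1 : (2:ℝ) ^ (3 - s - γ) < 1 := Real.rpow_lt_one_of_one_lt_of_neg one_lt_two (by linarith)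
  have hq2 : 0 < 1 - (2:ℝ) ^ (3 - s - γ) := by linarith
  refine ⟨2 ^ (3 - s) * C / (1 - (2:ℝ) ^ (3 - s - γ)), by positivity, fun x R hR => ?_⟩
  have := geo_sum (f := fun y => (edist x y) ^ (-γ) * (dE Ω y) ^ (-s)) (S := {y | R ≤ dist x y} ∩ Ω)
    (A := fun n => {y | R * 2 ^ n ≤ dist x y} ∩ (Metric.ball x (R * 2 ^ (n+1)) ∩ Ω))
    (c := 2 ^ (3 - s) * C * R ^ (3 - s - γ)) (q := (2:ℝ) ^ (3 - s - γ)) ?_ (by positivity) hq0.le hq1 ?_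
  · refine this.trans_eq ?_
    congr 1; ring
  · refine Eventually.of_forall fun y hy => ?_
    have hd2 : 1 ≤ dist x y / R := by
      rw [le_div_iff₀ hR]; rw [one_mul]; exact hy.1
    obtain ⟨n, h1, h2⟩ := exists_nat_pow_near hd2 (one_lt_two)
    refine Set.mem_iUnion.2 ⟨n, ?_, ?_, hy.2⟩
    · rw [le_div_iff₀ hR] at h1; rw [Set.mem_ofPred_eq]; linarith
    · rw [div_lt_iff₀ hR] at h2; rw [Metric.mem_ball, dist_comm]; linarith
  · intro n
    refine (annulus_int hγ h x (by positivity) (by positivity)).trans_eq ?_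
    congr 1
    rw [Real.mul_rpow hR.le (by positivity), Real.mul_rpow hR.le (by positivity), ← Real.rpow_natCast, ← Real.rpow_natCast, ← Real.rpow_natCast,
      ← Real.rpow_mul (by norm_num), ← Real.rpow_mul (by norm_num), ← Real.rpow_mul (by norm_num)]
    have e1 : (2:ℝ) ^ (((n+1:ℕ):ℝ) * (3 - s)) = 2 ^ (3 - s) * (2:ℝ) ^ ((n:ℝ) * (3 - s)) := by
      rw [← Real.rpow_add two_pos]; congr 1; push_cast; ring
    have e2 : (2:ℝ) ^ ((3 - s - γ) * (n:ℝ)) = 2 ^ ((n:ℝ) * -γ) * (2:ℝ) ^ ((n:ℝ) * (3 - s)) := by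
      rw [← Real.rpow_add two_pos]; congr 1; ring
    have e3 : R ^ (3 - s - γ) = R ^ (-γ) * R ^ (3 - s) := by
      rw [← Real.rpow_add hR]; congr 1; ring
    rw [e1, e2, e3]; ring
end
end

section
section
variable {Ω : Set E3}

lemma holder3 {μ : Measure E3} {k p h : E3 → ℝ≥0∞} (hk : AEMeasurable k μ) (hp : AEMeasurable p μ) (hh : AEMeasurable h μ)
    (hp0 : ∀ᵐ y ∂μ, p y ≠ 0 ∧ p y ≠ ⊤) :
    (∫⁻ y, k y * h y ∂μ) ^ 3 ≤ (∫⁻ y, k y * p y ∂μ) ^ 2 * ∫⁻ y, k y * (p y ^ (-2:ℝ) * h y ^ 3) ∂μ := by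
  have hpq : (3/2:ℝ).HolderConjugate 3 := by
    rw [Real.holderConjugate_iff]; norm_num
  have H := ENNReal.lintegral_mul_le_Lp_mul_Lq μ hpq (f := fun y => (k y * p y) ^ (2/3:ℝ))
    (g := fun y => k y ^ (1/3:ℝ) * (p y ^ (-2/3:ℝ) * h y)) ((hk.mul hp).pow_const _) ((hk.pow_const _).mul ((hp.pow_const _).mul hh))
  have e1 : ∫⁻ y, k y * h y ∂μ = ∫⁻ y, ((fun y => (k y * p y) ^ (2/3:ℝ)) * (fun y => k y ^ (1/3:ℝ) * (p y ^ (-2/3:ℝ) * h y))) y ∂μ := by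
    refine lintegral_congr_ae ?_
    filter_upwards [hp0] with y hy
    simp only [Pi.mul_apply]
    rw [ENNReal.mul_rpow_of_nonneg _ _ (by norm_num)]
    have a1 : k y ^ (2/3:ℝ) * k y ^ (1/3:ℝ) = k y := by
      rw [← ENNReal.rpow_add_of_nonneg _ _ (by norm_num) (by norm_num)]; norm_num
    have a2 : p y ^ (2/3:ℝ) * p y ^ (-2/3:ℝ) = 1 := by
      rw [← ENNReal.rpow_add _ _ hy.1 hy.2]; norm_num
    calc k y * h y = (k y ^ (2/3:ℝ) * k y ^ (1/3:ℝ)) * (p y ^ (2/3:ℝ) * p y ^ (-2/3:ℝ)) * h y := by rw [a1, a2, mul_one]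
      _ = _ := by ring
  rw [← e1] at H
  have e2 : ∫⁻ y, ((k y * p y) ^ (2/3:ℝ)) ^ (3/2:ℝ) ∂μ = ∫⁻ y, k y * p y ∂μ := by
    refine lintegral_congr fun y => ?_
    rw [← ENNReal.rpow_mul]; norm_num
  have e3 : ∫⁻ y, (k y ^ (1/3:ℝ) * (p y ^ (-2/3:ℝ) * h y)) ^ (3:ℝ) ∂μ = ∫⁻ y, k y * (p y ^ (-2:ℝ) * h y ^ 3) ∂μ := by
    refine lintegral_congr fun y => ?_
    rw [ENNReal.mul_rpow_of_nonneg _ _ (by norm_num), ENNReal.mul_rpow_of_nonneg _ _ (by norm_num), ← ENNReal.rpow_mul, ← ENNReal.rpow_mul,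
      ← ENNReal.rpow_natCast]
    norm_num
  rw [e2, e3] at H
  calc _ ≤ ((∫⁻ y, k y * p y ∂μ) ^ (1 / (3/2:ℝ)) * (∫⁻ y, k y * (p y ^ (-2:ℝ) * h y ^ 3) ∂μ) ^ (1/3:ℝ)) ^ 3 := by gcongr
    _ = _ := by
      rw [mul_pow, ← ENNReal.rpow_natCast, ← ENNReal.rpow_natCast, ← ENNReal.rpow_natCast, ← ENNReal.rpow_mul, ← ENNReal.rpow_mul]
      norm_num

lemma schur3 {μ : Measure E3} [SFinite μ] {k : E3 → E3 → ℝ≥0∞} (hk : Measurable (Function.uncurry k))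
    {p q W V h : E3 → ℝ≥0∞} (hp : Measurable p) (hq : Measurable q) (hW : Measurable W) (hh : Measurable h)
    (hp0 : ∀ᵐ y ∂μ, p y ≠ 0 ∧ p y ≠ ⊤) {C1 C2 : ℝ≥0∞}
    (h1 : ∀ᵐ x ∂μ, ∫⁻ y, k x y * p y ∂μ ≤ C1 * q x)
    (h2 : ∀ᵐ y ∂μ, ∫⁻ x, W x * q x ^ 2 * k x y ∂μ ≤ C2 * (V y * p y ^ 2)) (hC : C2 ≠ ⊤) (hC1 : C1 ≠ ⊤) :
    ∫⁻ x, W x * (∫⁻ y, k x y * h y ∂μ) ^ 3 ∂μ ≤ C1 ^ 2 * C2 * ∫⁻ y, V y * h y ^ 3 ∂μ := by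
  have hkx : ∀ x, Measurable (k x) := fun x => hk.comp measurable_prodMk_left
  have hky : ∀ y, Measurable (fun x => k x y) := fun y => hk.comp measurable_prodMk_right
  calc _ ≤ ∫⁻ x, C1 ^ 2 * ∫⁻ y, (W x * q x ^ 2 * k x y) * (p y ^ (-2:ℝ) * h y ^ 3) ∂μ ∂μ := by
        refine lintegral_mono_ae ?_
        filter_upwards [h1] with x hx
        refine (mul_le_mul_right (holder3 (hkx x).aemeasurable hp.aemeasurable hh.aemeasurable hp0) _).trans ?_
        calc _ ≤ W x * ((C1 * q x) ^ 2 * ∫⁻ y, k x y * (p y ^ (-2:ℝ) * h y ^ 3) ∂μ) := by gcongr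
          _ = C1 ^ 2 * (W x * q x ^ 2 * ∫⁻ y, k x y * (p y ^ (-2:ℝ) * h y ^ 3) ∂μ) := by ring
          _ = _ := by
            have hmm : Measurable fun y => k x y * (p y ^ (-2:ℝ) * h y ^ 3) :=
              (hkx x).mul ((hp.pow_const _).mul (hh.pow_const _))
            rw [← lintegral_const_mul _ hmm]
            simp only [mul_assoc]
    _ = C1 ^ 2 * ∫⁻ x, ∫⁻ y, (W x * q x ^ 2 * k x y) * (p y ^ (-2:ℝ) * h y ^ 3) ∂μ ∂μ :=
        lintegral_const_mul' _ _ (by finiteness)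
    _ = C1 ^ 2 * ∫⁻ y, ∫⁻ x, (W x * q x ^ 2 * k x y) * (p y ^ (-2:ℝ) * h y ^ 3) ∂μ ∂μ := by
        rw [lintegral_lintegral_swap]
        refine Measurable.aemeasurable ?_
        refine (((hW.comp measurable_fst).mul ((hq.comp measurable_fst).pow_const _)).mul hk).mul
          (((hp.comp measurable_snd).pow_const _).mul ((hh.comp measurable_snd).pow_const _))
    _ ≤ C1 ^ 2 * ∫⁻ y, C2 * (V y * h y ^ 3) ∂μ := by
        refine mul_le_mul_right (lintegral_mono_ae ?_) _
        filter_upwards [h2, hp0] with y hy hpy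
        have hmm : Measurable fun x => W x * q x ^ 2 * k x y := (hW.mul (hq.pow_const _)).mul (hky y)
        rw [lintegral_mul_const _ hmm]
        calc _ ≤ C2 * (V y * p y ^ 2) * (p y ^ (-2:ℝ) * h y ^ 3) := by gcongr
          _ = C2 * (V y * h y ^ 3) * (p y ^ (2:ℝ) * p y ^ (-2:ℝ)) := by rw [← ENNReal.rpow_natCast (p y)]; push_cast; ring
          _ = _ := by rw [← ENNReal.rpow_add _ _ hpy.1 hpy.2]; simp
    _ = _ := by rw [lintegral_const_mul' _ _ hC, mul_assoc]

/-- The kernel controlling oscillation of Biot-Savart integrals. -/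
def KE (Ω : Set E3) (x y : E3) : ℝ≥0∞ := (edist x y) ^ (-2:ℝ) * (edist x y + dE Ω x)⁻¹

lemma KE_meas : Measurable (Function.uncurry (KE Ω)) := by
  have h1 : Measurable fun p : E3 × E3 => edist p.1 p.2 := measurable_edist
  exact (h1.pow_const _).mul (h1.add (dE_meas.comp measurable_fst)).inv

lemma dE_le (x y : E3) : dE Ω x ≤ dE Ω y + edist x y := by
  unfold dE
  rw [edist_dist, ← ENNReal.ofReal_add (dB_nonneg _) dist_nonneg]
  exact ENNReal.ofReal_le_ofReal (dB_le x y)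

lemma KE_symm (x y : E3) : KE Ω x y ≤ 2 * KE Ω y x := by
  unfold KE
  rw [edist_comm y x]
  have h : edist x y + dE Ω y ≤ 2 * (edist x y + dE Ω x) := by
    calc _ ≤ edist x y + (dE Ω x + edist y x) := by gcongr; exact dE_le y x
      _ = 2 * edist x y + dE Ω x := by rw [edist_comm y x]; ring
      _ ≤ 2 * edist x y + 2 * dE Ω x := by gcongr; exact le_mul_of_one_le_left' one_le_two
      _ = _ := by ring
  have := rpow_neg_le one_le_two (by simp) h zero_le_one le_rfl
  rw [ENNReal.rpow_neg_one, ENNReal.rpow_neg_one] at this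
  calc _ ≤ edist x y ^ (-2:ℝ) * (2 * (edist x y + dE Ω y)⁻¹) := by gcongr
    _ = _ := by ring

lemma S2 (hΩ : IsLipschitzDomain Ω) {s : ℝ} (hs0 : 0 < s) (hs1 : s < 1) :
    ∃ C : ℝ≥0∞, C ≠ ⊤ ∧ ∀ x ∈ Ω, ∫⁻ y in Ω, KE Ω x y * (dE Ω y) ^ (-s) ≤ C * (dE Ω x) ^ (-s) := by
  obtain ⟨C1, hC1, H1⟩ := near_int hΩ hs0.le hs1 (γ := 2) (by norm_num) (by linarith)
  obtain ⟨C2, hC2, H2⟩ := outer_int hΩ hs0.le hs1 (γ := 3) (by norm_num) (by linarith)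
  refine ⟨ENNReal.ofReal (C1 + C2), by simp, fun x hx => ?_⟩
  have hd := dB_pos hΩ hx
  have hsub : Ω ⊆ (Metric.ball x (dB Ω x) ∩ Ω) ∪ ({y | dB Ω x ≤ dist x y} ∩ Ω) := by
    intro y hy
    rcases lt_or_ge (dist x y) (dB Ω x) with h | h
    · exact Or.inl ⟨by rwa [Metric.mem_ball, dist_comm], hy⟩
    · exact Or.inr ⟨h, hy⟩
  have a1 : ∫⁻ y in Metric.ball x (dB Ω x) ∩ Ω, KE Ω x y * (dE Ω y) ^ (-s) ≤ ENNReal.ofReal (C1 * dB Ω x ^ (-s)) := by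
    calc _ ≤ ∫⁻ y in Metric.ball x (dB Ω x) ∩ Ω, (dE Ω x)⁻¹ * ((edist x y) ^ (-2:ℝ) * (dE Ω y) ^ (-s)) := by
          refine lintegral_mono fun y => ?_
          unfold KE
          calc _ ≤ (edist x y) ^ (-2:ℝ) * (dE Ω x)⁻¹ * dE Ω y ^ (-s) := by gcongr; exact le_add_self
            _ = _ := by ring
      _ = (dE Ω x)⁻¹ * ∫⁻ y in Metric.ball x (dB Ω x) ∩ Ω, ((edist x y) ^ (-2:ℝ) * (dE Ω y) ^ (-s)) :=
          lintegral_const_mul' _ _ (by simpa [dE] using hd)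
      _ ≤ (dE Ω x)⁻¹ * ENNReal.ofReal (C1 * dB Ω x ^ (3 - s - 2)) := by gcongr; exact H1 x _ hd
      _ = _ := by
          unfold dE
          rw [← ENNReal.ofReal_inv_of_pos hd, ← ENNReal.ofReal_mul (by positivity)]
          congr 1
          rw [show 3 - s - 2 = -s + 1 by ring, Real.rpow_add_one hd.ne']; field_simp
  have a2 : ∫⁻ y in {y | dB Ω x ≤ dist x y} ∩ Ω, KE Ω x y * (dE Ω y) ^ (-s) ≤ ENNReal.ofReal (C2 * dB Ω x ^ (-s)) := by
    calc _ ≤ ∫⁻ y in {y | dB Ω x ≤ dist x y} ∩ Ω, ((edist x y) ^ (-3:ℝ) * (dE Ω y) ^ (-s)) := by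
          refine setLIntegral_mono' ((isClosed_le continuous_const (by fun_prop)).measurableSet.inter hΩ.isOpen.measurableSet) fun y hy => ?_
          unfold KE
          gcongr
          have h0 : edist x y ≠ 0 := by
            rw [edist_dist]; simpa using hd.trans_le hy.1
          calc _ ≤ (edist x y) ^ (-2:ℝ) * (edist x y)⁻¹ := by gcongr; exact le_self_add
            _ = _ := by rw [← ENNReal.rpow_neg_one, ← ENNReal.rpow_add _ _ h0 (edist_ne_top _ _)]; norm_num
      _ ≤ _ := H2 x _ hd
      _ = _ := by congr 3; ring
  calc _ ≤ _ := lintegral_mono_set hsub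
    _ ≤ _ := lintegral_union_le _ _ _
    _ ≤ _ := add_le_add a1 a2
    _ = _ := by
      rw [dE, ENNReal.ofReal_rpow_of_pos hd, ← ENNReal.ofReal_mul (by positivity), ← ENNReal.ofReal_add (by positivity) (by positivity)]
      congr 1; ring

lemma S1 (hΩ : IsLipschitzDomain Ω) {s γ : ℝ} (hs0 : 0 ≤ s) (hs1 : s < 1) (hγ : 0 ≤ γ) (h3 : s + γ < 3) :
    ∃ C : ℝ≥0∞, C ≠ ⊤ ∧ ∀ x ∈ Ω, ∫⁻ y in Ω, (edist x y) ^ (-γ) * (dE Ω y) ^ (-s) ≤ C := by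
  obtain ⟨C1, hC1, H1⟩ := near_int hΩ hs0 hs1 hγ h3
  obtain ⟨D, hD⟩ := Metric.isBounded_iff.1 hΩ.isBounded
  refine ⟨ENNReal.ofReal (C1 * (|D| + 1) ^ (3 - s - γ)), by simp, fun x hx => ?_⟩
  refine (lintegral_mono_set ?_).trans (H1 x (|D| + 1) (by positivity))
  intro y hy
  refine ⟨?_, hy⟩
  rw [Metric.mem_ball]
  have := hD hy hx
  have := le_abs_self D
  linarith

lemma dE_ne0 (hΩ : IsLipschitzDomain Ω) {x : E3} (hx : x ∈ Ω) : dE Ω x ≠ 0 := by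
  simpa [dE] using dB_pos hΩ hx

lemma dE_neT (x : E3) : dE Ω x ≠ ⊤ := by simp [dE]

lemma ae_Om (hΩ : IsLipschitzDomain Ω) : ∀ᵐ x ∂(volume.restrict Ω), x ∈ Ω := ae_restrict_mem hΩ.isOpen.measurableSet

lemma P1 (hΩ : IsLipschitzDomain Ω) {α : ℝ} (h0 : 6/5 ≤ α) (h1 : α < 3/2) :
    ∃ C : ℝ≥0∞, C ≠ ⊤ ∧ ∀ h : E3 → ℝ≥0∞, Measurable h →
      ∫⁻ x in Ω, dE Ω x ^ α * (∫⁻ y in Ω, KE Ω x y * h y) ^ 3 ≤ C * ∫⁻ y in Ω, dE Ω y ^ α * h y ^ 3 := by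
  obtain ⟨C1, hC1, H1⟩ := S2 hΩ (s := 9/10) (by norm_num) (by norm_num)
  obtain ⟨C2, hC2, H2⟩ := S2 hΩ (s := 9/5 - α) (by linarith) (by linarith)
  refine ⟨C1 ^ 2 * (2 * C2), by finiteness, fun h hh => ?_⟩
  have hpw : ∀ x ∈ Ω, dE Ω x ^ α * (dE Ω x ^ (-(9/10):ℝ)) ^ 2 = dE Ω x ^ (-(9/5 - α)) := by
    intro x hx
    rw [← ENNReal.rpow_natCast, ← ENNReal.rpow_mul, ← ENNReal.rpow_add _ _ (dE_ne0 hΩ hx) (dE_neT x)]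
    congr 1; push_cast; ring
  refine schur3 (p := fun y => dE Ω y ^ (-(9/10):ℝ)) (q := fun y => dE Ω y ^ (-(9/10):ℝ)) (W := fun x => dE Ω x ^ α) (V := fun x => dE Ω x ^ α)
    KE_meas (dE_meas.pow_const _) (dE_meas.pow_const _) (dE_meas.pow_const _) hh ?_ ?_ ?_ (by finiteness) hC1
  · filter_upwards [ae_Om hΩ] with y hy
    exact ⟨(ENNReal.rpow_pos (pos_iff_ne_zero.2 (dE_ne0 hΩ hy)) (dE_neT y)).ne', ENNReal.rpow_ne_top_of_ne_zero (dE_ne0 hΩ hy) (dE_neT y)⟩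
  · filter_upwards [ae_Om hΩ] with x hx using H1 x hx
  · filter_upwards [ae_Om hΩ] with y hy
    calc _ ≤ ∫⁻ x in Ω, 2 * (KE Ω y x * dE Ω x ^ (-(9/5 - α))) := by
          refine setLIntegral_mono' hΩ.isOpen.measurableSet fun x hx => ?_
          rw [hpw x hx]
          calc _ ≤ dE Ω x ^ (-(9/5 - α)) * (2 * KE Ω y x) := by gcongr; exact KE_symm x y
            _ = _ := by ring
      _ = 2 * ∫⁻ x in Ω, (KE Ω y x * dE Ω x ^ (-(9/5 - α))) := lintegral_const_mul' _ _ (by simp)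
      _ ≤ 2 * (C2 * dE Ω y ^ (-(9/5 - α))) := by gcongr; exact H2 y hy
      _ = _ := by rw [hpw y hy, mul_assoc]

lemma P2 (hΩ : IsLipschitzDomain Ω) {α θ : ℝ} (h0 : 6/5 ≤ α) (h1 : α < 3/2) (hθ0 : 0 ≤ θ) (hθ1 : θ ≤ 1/8) :
    ∃ C : ℝ≥0∞, C ≠ ⊤ ∧ ∀ h : E3 → ℝ≥0∞, Measurable h →
      ∫⁻ x in Ω, dE Ω x ^ (-(α/2)) * (∫⁻ y in Ω, edist x y ^ (-(2 + θ)) * h y) ^ 3 ≤ C * ∫⁻ y in Ω, dE Ω y ^ α * h y ^ 3 := by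
  obtain ⟨C1, hC1, H1⟩ := S1 hΩ (s := α/2) (γ := 2 + θ) (by linarith) (by linarith) (by linarith) (by linarith)
  refine ⟨C1 ^ 2 * C1, by finiteness, fun h hh => ?_⟩
  have hpw : ∀ x ∈ Ω, dE Ω x ^ α * (dE Ω x ^ (-(α/2):ℝ)) ^ 2 = 1 := by
    intro x hx
    rw [← ENNReal.rpow_natCast, ← ENNReal.rpow_mul, ← ENNReal.rpow_add _ _ (dE_ne0 hΩ hx) (dE_neT x)]
    convert ENNReal.rpow_zero using 2
    push_cast; ring
  refine schur3 (k := fun x y => edist x y ^ (-(2 + θ))) (p := fun y => dE Ω y ^ (-(α/2):ℝ)) (q := fun y => 1) (W := fun x => dE Ω x ^ (-(α/2))) (V := fun x => dE Ω x ^ α)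
    (measurable_edist.pow_const _) (dE_meas.pow_const _) measurable_const (dE_meas.pow_const _) hh ?_ ?_ ?_ (by finiteness) hC1
  · filter_upwards [ae_Om hΩ] with y hy
    exact ⟨(ENNReal.rpow_pos (pos_iff_ne_zero.2 (dE_ne0 hΩ hy)) (dE_neT y)).ne', ENNReal.rpow_ne_top_of_ne_zero (dE_ne0 hΩ hy) (dE_neT y)⟩
  · filter_upwards [ae_Om hΩ] with x hx
    simpa using H1 x hx
  · filter_upwards [ae_Om hΩ] with y hy
    rw [hpw y hy, mul_one]
    refine le_trans (le_of_eq ?_) (H1 y hy)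
    refine lintegral_congr fun x => ?_
    rw [edist_comm, one_pow, mul_one, mul_comm]
end
end

section
/-- regularised norm -/
def nn (ε : ℝ) (z : E3) : ℝ := √(‖z‖ ^ 2 + ε ^ 2)
/-- regularised Biot-Savart kernel `z_i / |z|_ε^3`. -/
def kk (ε : ℝ) (i : Fin 3) (z : E3) : ℝ := z i / nn ε z ^ 3
/-- its gradient -/
def dkk (ε : ℝ) (l i : Fin 3) (z : E3) : ℝ := -(if l = i then 1 else 0) / nn ε z ^ 3 + 3 * z i * z l / nn ε z ^ 5

lemma nn_sq (ε : ℝ) (z : E3) : nn ε z ^ 2 = ‖z‖ ^ 2 + ε ^ 2 := Real.sq_sqrt (by positivity)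
lemma nn_nonneg (ε : ℝ) (z : E3) : 0 ≤ nn ε z := Real.sqrt_nonneg _
lemma nn_pos {ε : ℝ} (hε : 0 < ε) (z : E3) : 0 < nn ε z := Real.sqrt_pos.2 (by positivity)
lemma nn_zero (z : E3) : nn 0 z = ‖z‖ := by simp [nn]
lemma norm_le_nn (ε : ℝ) (z : E3) : ‖z‖ ≤ nn ε z := Real.le_sqrt_of_sq_le (by nlinarith [sq_nonneg ε])
lemma le_nn {ε : ℝ} (z : E3) : ε ≤ nn ε z := Real.le_sqrt_of_sq_le (by nlinarith [sq_nonneg ‖z‖])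
lemma nn_cont (ε : ℝ) : Continuous (nn ε) := by unfold nn; fun_prop

lemma nn_lip (ε : ℝ) (z w : E3) : |nn ε z - nn ε w| ≤ ‖z - w‖ := by
  have key : ∀ z w : E3, nn ε z ≤ nn ε w + ‖z - w‖ := by
    intro z w
    refine Real.sqrt_le_iff.2 ⟨by have := nn_nonneg ε w; positivity, ?_⟩
    have h1 : ‖z‖ ≤ ‖w‖ + ‖z - w‖ := by simpa using norm_add_le w (z - w)
    have h2 := norm_le_nn ε w
    have h3 := nn_sq ε w
    have h4 : ‖z‖ ^ 2 ≤ (‖w‖ + ‖z - w‖) ^ 2 := by gcongr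
    nlinarith [norm_nonneg (z - w), norm_nonneg w, mul_le_mul_of_nonneg_right h2 (norm_nonneg (z - w))]
  rw [abs_le]
  have h1 := key z w
  have h2 := key w z
  rw [norm_sub_rev] at h2
  constructor <;> linarith

lemma kk_cont {ε : ℝ} (hε : 0 < ε) (i : Fin 3) : Continuous (kk ε i) := by
  have h1 := nn_cont ε
  unfold kk
  exact Continuous.div (by fun_prop) (by fun_prop) (fun z => (pow_pos (nn_pos hε z) 3).ne')

lemma dkk_cont {ε : ℝ} (hε : 0 < ε) (l i : Fin 3) : Continuous (dkk ε l i) := by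
  have h1 := nn_cont ε
  unfold dkk
  refine Continuous.add ?_ ?_
  · exact Continuous.div (by fun_prop) (by fun_prop) (fun z => (pow_pos (nn_pos hε z) 3).ne')
  · exact Continuous.div (by fun_prop) (by fun_prop) (fun z => (pow_pos (nn_pos hε z) 5).ne')

lemma ee_apply (l i : Fin 3) : ee l i = if l = i then 1 else 0 := by
  unfold ee; simp [eq_comm]

lemma norm_sq3 (z : E3) : ‖z‖ ^ 2 = z 0 ^ 2 + z 1 ^ 2 + z 2 ^ 2 := by
  rw [EuclideanSpace.norm_sq_eq]; simp [Fin.sum_univ_three]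

lemma norm_sub_ee (z : E3) (t : ℝ) (l : Fin 3) : ‖z - t • ee l‖ ^ 2 = ‖z‖ ^ 2 - 2 * t * z l + t ^ 2 := by
  rw [norm_sq3, norm_sq3]
  simp only [PiLp.sub_apply, PiLp.smul_apply, ee_apply, smul_eq_mul]
  fin_cases l <;> simp <;> ring

lemma kk_line {ε : ℝ} (hε : 0 < ε) (l i : Fin 3) (x y : E3) :
    HasLineDerivAt ℝ (fun y => kk ε i (x - y)) (dkk ε l i (x - y)) y (ee l) := by
  unfold HasLineDerivAt
  set z := x - y
  have e1 : (fun t : ℝ => kk ε i (x - (y + t • ee l))) = fun t => (z i - t * (if l = i then 1 else 0)) / (√(‖z‖ ^ 2 - 2 * t * z l + t ^ 2 + ε ^ 2)) ^ 3 := by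
    funext t
    rw [show x - (y + t • ee l) = z - t • ee l by simp only [z]; abel]
    unfold kk nn
    rw [norm_sub_ee]
    simp [ee_apply]
  rw [e1]
  have hpos : 0 < ‖z‖ ^ 2 + ε ^ 2 := by positivity
  have hn := nn_pos hε z
  have d1 : HasDerivAt (fun t : ℝ => ‖z‖ ^ 2 - 2 * t * z l + t ^ 2 + ε ^ 2) (-2 * z l) 0 := by
    have a := (((hasDerivAt_id (0:ℝ)).const_mul 2).mul_const (z l))
    have b := (((hasDerivAt_const (0:ℝ) (‖z‖ ^ 2)).sub a).add ((hasDerivAt_id (0:ℝ)).pow 2)).add_const (ε ^ 2)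
    exact b.congr_deriv (by simp)
  have d2 := (d1.sqrt (by simpa using hpos.ne')).pow 3
  have d3 : HasDerivAt (fun t : ℝ => z i - t * (if l = i then (1:ℝ) else 0)) (-(if l = i then (1:ℝ) else 0)) 0 := by
    have a := (hasDerivAt_const (0:ℝ) (z i)).sub ((hasDerivAt_id (0:ℝ)).mul_const (if l = i then (1:ℝ) else 0))
    exact a.congr_deriv (by simp)
  have hs : √(‖z‖ ^ 2 + ε ^ 2) = nn ε z := rfl
  have d4 := d3.div d2 (by simp only [Pi.pow_apply]; simp [hs, hn.ne'])
  refine d4.congr_deriv ?_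
  simp only [Pi.pow_apply]
  by_cases h : l = i
  · simp [hs, dkk, h]
    field_simp
    try ring
  · simp [hs, dkk, h]
    field_simp
    try ring

/-- approximate identity profile -/
def rr (ε : ℝ) (z : E3) : ℝ := 3 * ε ^ 2 / nn ε z ^ 5

lemma dkk_trace {ε : ℝ} (hε : 0 < ε) (z : E3) : ∑ i, dkk ε i i z = - rr ε z := by
  have hn := nn_pos hε z
  have h1 := nn_sq ε z
  rw [norm_sq3] at h1
  have h2 : ε ^ 2 = nn ε z ^ 2 - (z 0 ^ 2 + z 1 ^ 2 + z 2 ^ 2) := by linarith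
  simp only [Fin.sum_univ_three, dkk, rr, if_true, h2]
  field_simp
  ring

lemma dkk_symm (ε : ℝ) (l i : Fin 3) (z : E3) : dkk ε l i z = dkk ε i l z := by
  unfold dkk; rcases eq_or_ne l i with h | h
  · subst h; rfl
  · simp [h, h.symm]; ring

lemma kk_ibp {ε : ℝ} (hε : 0 < ε) {f : E3 → ℝ} (hf : CSf f) (l i : Fin 3) (x : E3) :
    ∫ y, kk ε i (x - y) * pds f l y = - ∫ y, dkk ε l i (x - y) * f y := by
  have c1 : Continuous fun y => kk ε i (x - y) := (kk_cont hε i).comp (by fun_prop)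
  have c2 : Continuous fun y => dkk ε l i (x - y) := (dkk_cont hε l i).comp (by fun_prop)
  exact ibp_line (v := ee l) (cs_int (c2.mul hf.cont) hf.supp.mul_left) (cs_int (c1.mul (hf.pds l).cont) (hf.pds l).supp.mul_left)
    (cs_int (c1.mul hf.cont) hf.supp.mul_left) (fun y => kk_line hε l i x y) (fun y => hf.line l y)

/-- antisymmetric part of the gradient -/
def As (φ : E3 → E3) (i j : Fin 3) (y : E3) : ℝ := pd φ i j y - pd φ j i y

lemma bs_eps {ε : ℝ} (hε : 0 < ε) {φ : E3 → E3} (h : CSv φ) (hdiv : ∀ x, vdiv φ x = 0) (j : Fin 3) (x : E3) :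
    ∫ y, rr ε (x - y) * φ y j = ∫ y, ∑ i, kk ε i (x - y) * As φ i j y := by
  have c1 : ∀ i, Continuous fun y => kk ε i (x - y) := fun i => (kk_cont hε i).comp (by fun_prop)
  have c2 : ∀ l i, Continuous fun y => dkk ε l i (x - y) := fun l i => (dkk_cont hε l i).comp (by fun_prop)
  have I1 : ∀ i l m, Integrable fun y => kk ε i (x - y) * pd φ l m y := fun i l m =>
    cs_int ((c1 i).mul (h.pd l m).cont) (h.pd l m).supp.mul_left
  have I2 : ∀ i l m, Integrable fun y => dkk ε i l (x - y) * φ y m := fun i l m =>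
    cs_int ((c2 i l).mul (h.comp m).cont) (h.comp m).supp.mul_left
  have ibp : ∀ i l m, ∫ y, kk ε i (x - y) * pd φ l m y = - ∫ y, dkk ε l i (x - y) * φ y m := by
    intro i l m
    rw [← kk_ibp hε (h.comp m)]
    simp only [pd_eq h.diff]
  have A : ∑ i, ∫ y, kk ε i (x - y) * pd φ i j y = ∫ y, rr ε (x - y) * φ y j := by
    simp only [ibp]
    rw [Finset.sum_neg_distrib, ← integral_finsetSum _ (fun i _ => I2 i i j), ← integral_neg]
    congr 1; funext y
    rw [← Finset.sum_mul, dkk_trace hε]; ring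
  have B : ∑ i, ∫ y, kk ε i (x - y) * pd φ j i y = 0 := by
    have : ∀ i, ∫ y, kk ε i (x - y) * pd φ j i y = ∫ y, kk ε j (x - y) * pd φ i i y := by
      intro i
      rw [ibp, ibp]; simp only [dkk_symm ε j i]
    simp only [this]
    rw [← integral_finsetSum _ (fun i _ => I1 j i i)]
    have : ∀ y, ∑ i, kk ε j (x - y) * pd φ i i y = 0 := by
      intro y
      rw [← Finset.mul_sum, show ∑ i, pd φ i i y = 0 from hdiv y, mul_zero]
    simp [this]
  have C : ∫ y, ∑ i, kk ε i (x - y) * As φ i j y = ∑ i, ((∫ y, kk ε i (x - y) * pd φ i j y) - ∫ y, kk ε i (x - y) * pd φ j i y) := by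
    simp only [As, mul_sub]
    have I3 : ∀ i, Integrable (fun y => kk ε i (x-y) * pd φ i j y - kk ε i (x-y) * pd φ j i y) := fun i => (I1 i i j).sub (I1 i j i)
    rw [integral_finsetSum _ (fun i _ => I3 i)]
    exact Finset.sum_congr rfl fun i _ => integral_sub (I1 i i j) (I1 i j i)
  rw [C, Finset.sum_sub_distrib, A, B, sub_zero]
end

section
section
variable {Ω : Set E3}

lemma rr_cont {ε : ℝ} (hε : 0 < ε) : Continuous (rr ε) := by
  have h1 := nn_cont ε
  unfold rr
  exact Continuous.div (by fun_prop) (by fun_prop) (fun z => (pow_pos (nn_pos hε z) 5).ne')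

lemma rr_pos {ε : ℝ} (hε : 0 < ε) (z : E3) : 0 < rr ε z := by
  have := nn_pos hε z
  unfold rr; positivity

lemma rr_int : Integrable (rr 1) := by
  have h := (integrable_rpow_neg_one_add_norm_sq (E := E3) (μ := volume) (r := 5) (by simp; norm_num)).const_mul 3
  refine h.congr (Eventually.of_forall fun z => ?_)
  have hp : (0:ℝ) < 1 + ‖z‖ ^ 2 := by positivity
  simp only [rr, nn]
  rw [show (-5/2 : ℝ) = -((1/2) * (5:ℕ)) by norm_num, Real.rpow_neg hp.le, Real.rpow_mul hp.le, Real.rpow_natCast, ← Real.sqrt_eq_rpow]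
  rw [one_pow, add_comm]; ring

/-- normalising constant (equal to `4π`) -/
def cBS : ℝ := ∫ z : E3, rr 1 z

lemma cBS_pos : 0 < cBS := by
  unfold cBS
  rw [integral_pos_iff_support_of_nonneg (fun z => (rr_pos one_pos z).le) rr_int]
  have : Function.support (rr 1) = Set.univ := by
    ext z; simp [(rr_pos one_pos z).ne']
  rw [this]; simp

lemma rr_scale {ε : ℝ} (hε : 0 < ε) (z : E3) : rr ε (ε • z) = (ε ^ 3)⁻¹ * rr 1 z := by
  have h1 : nn ε (ε • z) = ε * nn 1 z := by
    unfold nn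
    rw [norm_smul, Real.norm_of_nonneg hε.le, show (ε * ‖z‖) ^ 2 + ε ^ 2 = ε ^ 2 * (‖z‖ ^ 2 + 1 ^ 2) by ring,
      Real.sqrt_mul (by positivity), Real.sqrt_sq hε.le]
  have := nn_pos one_pos z
  unfold rr
  rw [h1]; field_simp

lemma rr_subst {ε : ℝ} (hε : 0 < ε) (f : E3 → ℝ) (x : E3) :
    ∫ y, rr ε (x - y) * f y = ∫ z, rr 1 z * f (x - ε • z) := by
  have h1 := integral_sub_left_eq_self (fun z => rr ε z * f (x - z)) volume x
  simp only [_root_.sub_sub_cancel] at h1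
  rw [h1]
  have h2 := Measure.integral_comp_smul (volume : Measure E3) (fun z => rr ε z * f (x - z)) ε
  simp only [finrank_euclideanSpace, Fintype.card_fin, smul_eq_mul] at h2
  rw [abs_of_pos (by positivity)] at h2
  simp only [rr_scale hε] at h2
  simp only [mul_assoc] at h2
  rw [integral_const_mul] at h2
  exact (mul_left_cancel₀ (by positivity) h2).symm

lemma rr_lim {f : E3 → ℝ} (hf : CSf f) (x : E3) :
    Tendsto (fun n : ℕ => ∫ y, rr (1/(n+1:ℝ)) (x - y) * f y) atTop (𝓝 (cBS * f x)) := by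
  have hp : ∀ n : ℕ, 0 < 1/(n+1:ℝ) := fun n => by positivity
  simp only [rr_subst (hp _)]
  obtain ⟨M, hM, hb⟩ := hf.bdd
  have e : cBS * f x = ∫ z, rr 1 z * f x := by rw [integral_mul_const]; rfl
  rw [e]
  have hfc := hf.cont
  refine tendsto_integral_of_dominated_convergence (fun z => rr 1 z * M) (fun n => ?_) (rr_int.mul_const M) (fun n => Eventually.of_forall fun z => ?_)
    (Eventually.of_forall fun z => ?_)
  · exact ((rr_cont one_pos).mul (by fun_prop)).aestronglyMeasurable
  · rw [norm_mul, Real.norm_of_nonneg (rr_pos one_pos z).le]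
    exact mul_le_mul_of_nonneg_left (hb _) (rr_pos one_pos z).le
  · refine Tendsto.const_mul _ ?_
    have h1 : Tendsto (fun n : ℕ => x - (1/(n+1:ℝ)) • z) atTop (𝓝 (x - (0:ℝ) • z)) :=
      tendsto_const_nhds.sub (tendsto_one_div_add_atTop_nhds_zero_nat.smul_const z)
    simp only [zero_smul, sub_zero] at h1
    exact (hfc.tendsto x).comp h1

lemma coord_le (z : E3) (i : Fin 3) : |z i| ≤ ‖z‖ := by
  simpa using EuclideanSpace.norm_eq z ▸ PiLp.norm_apply_le z i

lemma kk_le (ε : ℝ) (i : Fin 3) (z : E3) : |kk ε i z| ≤ (‖z‖⁻¹) ^ 2 := by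
  rcases eq_or_ne z 0 with rfl | hz
  · simp [kk]
  have hz' := norm_pos_iff.2 hz
  unfold kk
  have h1 := norm_le_nn ε z
  rw [abs_div, abs_of_nonneg (pow_nonneg (nn_nonneg ε z) 3)]
  calc _ ≤ ‖z‖ / ‖z‖ ^ 3 := by gcongr; exact coord_le z i
    _ = _ := by field_simp

lemma kk_le_eps {ε : ℝ} (hε : 0 < ε) (i : Fin 3) (z : E3) : |kk ε i z| ≤ (ε⁻¹) ^ 2 := by
  have h0 := nn_pos hε z
  have h1 := norm_le_nn ε z
  have h2 := le_nn (ε := ε) z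
  unfold kk
  rw [abs_div, abs_of_nonneg (pow_nonneg (nn_nonneg ε z) 3)]
  calc _ ≤ nn ε z / nn ε z ^ 3 := by gcongr; exact (coord_le z i).trans h1
    _ = (nn ε z)⁻¹ ^ 2 := by field_simp
    _ ≤ _ := by gcongr

lemma kk_meas (ε : ℝ) (i : Fin 3) : Measurable (kk ε i) := by
  have h1 := (nn_cont ε).measurable
  unfold kk
  exact Measurable.div (by fun_prop) (h1.pow_const 3)

lemma kk_lim (i : Fin 3) (z : E3) : Tendsto (fun n : ℕ => kk (1/(n+1:ℝ)) i z) atTop (𝓝 (kk 0 i z)) := by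
  rcases eq_or_ne z 0 with rfl | hz
  · simp [kk]
  have hz' := norm_pos_iff.2 hz
  have hc : ContinuousAt (fun ε : ℝ => z i / (√(‖z‖ ^ 2 + ε ^ 2)) ^ 3) 0 := by
    refine ContinuousAt.div (by fun_prop) (by fun_prop) ?_
    simp [hz]
  exact hc.tendsto.comp tendsto_one_div_add_atTop_nhds_zero_nat

lemma As_le (φ : E3 → E3) (i j : Fin 3) (y : E3) : |As φ i j y| ≤ ‖vcurl φ y‖ := by
  have h := coord_le (vcurl φ y)
  have h0 := h 0
  have h1 := h 1
  have h2 := h 2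
  simp only [vcurl, mk3_0, mk3_1, mk3_2] at h0 h1 h2
  simp only [vcurl]
  unfold As
  fin_cases i <;> fin_cases j <;> simp only [Fin.isValue, Fin.zero_eta, Fin.mk_one, Fin.reduceFinMk, sub_self, abs_zero, norm_nonneg] <;>
    first | assumption | (rw [abs_sub_comm]; assumption)

lemma IsTest.csv {φ : E3 → E3} (h : IsTest Ω φ) : CSv φ := ⟨h.smooth, h.compsupp⟩

lemma curl_out {φ : E3 → E3} (h : IsTest Ω φ) {y : E3} (hy : y ∉ Ω) : vcurl φ y = 0 := by
  have h1 : fderiv ℝ φ y = 0 := by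
    by_contra hne
    exact hy (h.suppin (support_fderiv_subset ℝ hne))
  simp [vcurl, pd, h1, mk3_eq]

lemma As_meas {φ : E3 → E3} (h : CSv φ) (i j : Fin 3) : Measurable (As φ i j) :=
  ((h.pd i j).sub (h.pd j i)).cont.measurable

lemma curl_bdd {φ : E3 → E3} (h : CSv φ) : ∃ M, 0 ≤ M ∧ ∀ y, ‖vcurl φ y‖ ≤ M := by
  obtain ⟨M, hM⟩ := h.curl_cont.bounded_above_of_compact_support h.curl_supp
  exact ⟨|M|, abs_nonneg _, fun y => (hM y).trans (le_abs_self M)⟩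

lemma edist_m2 (x y : E3) : ENNReal.ofReal ((‖x - y‖⁻¹) ^ 2) ≤ edist x y ^ (-2:ℝ) := by
  rcases eq_or_ne x y with rfl | h
  · simp
  have hp : 0 < ‖x - y‖ := norm_pos_iff.2 (sub_ne_zero.2 h)
  rw [edist_dist, dist_eq_norm, ENNReal.ofReal_rpow_of_pos hp]
  refine le_of_eq ?_
  congr 1
  rw [Real.rpow_neg hp.le, inv_pow]; norm_num

lemma dom_int (hΩ : IsLipschitzDomain Ω) {φ : E3 → E3} (h : IsTest Ω φ) {x : E3} (hx : x ∈ Ω) :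
    Integrable fun y => (‖x - y‖⁻¹) ^ 2 * ‖vcurl φ y‖ := by
  have hm : Measurable fun y => (‖x - y‖⁻¹) ^ 2 * ‖vcurl φ y‖ := by
    have := h.csv.curl_cont.measurable
    fun_prop
  refine ⟨hm.aestronglyMeasurable, ?_⟩
  obtain ⟨M, hM, hb⟩ := curl_bdd h.csv
  obtain ⟨C, hC, H⟩ := S1 hΩ (s := 0) (γ := 2) le_rfl (by norm_num) (by norm_num) (by norm_num)
  rw [HasFiniteIntegral]
  have e : ∫⁻ y, ‖(‖x - y‖⁻¹) ^ 2 * ‖vcurl φ y‖‖ₑ ≤ ∫⁻ y, Ω.indicator (fun y => edist x y ^ (-2:ℝ) * ENNReal.ofReal M) y := by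
    refine lintegral_mono fun y => ?_
    by_cases hy : y ∈ Ω
    · rw [Set.indicator_of_mem hy, Real.enorm_of_nonneg (by positivity), ENNReal.ofReal_mul (by positivity)]
      gcongr
      · exact edist_m2 x y
      · exact hb y
    · simp [hy, curl_out h hy]
  refine e.trans_lt ?_
  rw [lintegral_indicator hΩ.isOpen.measurableSet, lintegral_mul_const' _ _ (by simp)]
  have := H x hx
  simp only [neg_zero, ENNReal.rpow_zero, mul_one] at this
  exact ENNReal.mul_lt_top (this.trans_lt hC.lt_top) (by simp)

lemma bs0 (hΩ : IsLipschitzDomain Ω) {φ : E3 → E3} (h : IsTestSol Ω φ) (j : Fin 3) {x : E3} (hx : x ∈ Ω) :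
    cBS * φ x j = ∫ y, ∑ i, kk 0 i (x - y) * As φ i j y := by
  have hv := h.toIsTest.csv
  refine tendsto_nhds_unique (rr_lim (hv.comp j) x) ?_
  have hp : ∀ n : ℕ, 0 < 1/(n+1:ℝ) := fun n => by positivity
  simp only [bs_eps (hp _) hv h.sol]
  refine tendsto_integral_of_dominated_convergence (fun y => 3 * ((‖x - y‖⁻¹) ^ 2 * ‖vcurl φ y‖)) (fun n => ?_)
    ((dom_int hΩ h.toIsTest hx).const_mul 3) (fun n => Eventually.of_forall fun y => ?_) (Eventually.of_forall fun y => ?_)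
  · refine Measurable.aestronglyMeasurable ?_
    exact Finset.measurable_fun_sum _ fun i _ => ((kk_meas _ i).comp (by fun_prop)).mul (As_meas hv i j)
  · refine (norm_sum_le _ _).trans ?_
    refine (Finset.sum_le_sum (g := fun _ => (‖x - y‖⁻¹) ^ 2 * ‖vcurl φ y‖) fun i _ => ?_).trans (by simp)
    rw [norm_mul]
    exact mul_le_mul (kk_le _ _ _) (As_le _ _ _ _) (norm_nonneg _) (by positivity)
  · exact tendsto_finsetSum _ fun i _ => (kk_lim i _).mul_const _

/-- generic bound for Biot-Savart type integrals -/
lemma bs_bound (hΩ : IsLipschitzDomain Ω) {φ : E3 → E3} (h : IsTest Ω φ) (j : Fin 3) {K : Fin 3 → E3 → ℝ} {k : E3 → ℝ≥0∞}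
    (hk : ∀ i, ∀ y ∈ Ω, ENNReal.ofReal |K i y| ≤ k y) :
    ENNReal.ofReal |∫ y, ∑ i, K i y * As φ i j y| ≤ 3 * ∫⁻ y in Ω, k y * ‖vcurl φ y‖ₑ := by
  rw [← Real.norm_eq_abs, ofReal_norm_eq_enorm]
  refine (enorm_integral_le_lintegral_enorm _).trans ?_
  rw [← lintegral_const_mul' _ _ (by simp), ← lintegral_indicator hΩ.isOpen.measurableSet]
  refine lintegral_mono fun y => ?_
  by_cases hy : y ∈ Ω
  · rw [Set.indicator_of_mem hy]
    refine (enorm_sum_le _ _).trans ?_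
    refine (Finset.sum_le_sum (g := fun _ => k y * ‖vcurl φ y‖ₑ) fun i _ => ?_).trans (by simp)
    rw [enorm_mul]
    refine mul_le_mul' ?_ ?_
    · rw [← ofReal_norm_eq_enorm]; exact hk i y hy
    · rw [enorm_le_iff_norm_le, Real.norm_eq_abs]; exact As_le _ _ _ _
  · have : ∀ i, As φ i j y = 0 := fun i => by
      have := As_le φ i j y
      rw [curl_out h hy] at this
      simpa using this
    simp [this]
end
end

section
section
variable {Ω : Set E3}

lemma kk_lip {ε t : ℝ} (ht : 0 < t) (i : Fin 3) {z w : E3} (hz : t ≤ nn ε z) (hw : t ≤ nn ε w) :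
    |kk ε i z - kk ε i w| ≤ 4 * ‖z - w‖ / t ^ 3 := by
  set a := nn ε z
  set b := nn ε w
  set δ := ‖z - w‖
  have ha : 0 < a := ht.trans_le hz
  have hb : 0 < b := ht.trans_le hw
  have hδ : 0 ≤ δ := norm_nonneg _
  have h1 : |a - b| ≤ δ := nn_lip ε z w
  have h2 : |z i - w i| ≤ δ := by simpa using coord_le (z - w) i
  have h3 : |w i| ≤ b := (coord_le w i).trans (norm_le_nn ε w)
  have e : kk ε i z - kk ε i w = (z i - w i) * (a⁻¹) ^ 3 + w i * ((b - a) * (b⁻¹ * (a⁻¹) ^ 3 + (b⁻¹) ^ 2 * (a⁻¹) ^ 2 + (b⁻¹) ^ 3 * a⁻¹)) := by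
    change z i / a ^ 3 - w i / b ^ 3 = _
    field_simp
    ring
  have ha' : a⁻¹ ≤ t⁻¹ := inv_anti₀ ht hz
  have hb' : b⁻¹ ≤ t⁻¹ := inv_anti₀ ht hw
  rw [e]
  calc _ ≤ |z i - w i| * (a⁻¹) ^ 3 + |w i| * (|b - a| * (b⁻¹ * (a⁻¹) ^ 3 + (b⁻¹) ^ 2 * (a⁻¹) ^ 2 + (b⁻¹) ^ 3 * a⁻¹)) := by
        refine (abs_add_le _ _).trans (le_of_eq ?_)
        rw [abs_mul, abs_mul, abs_mul, abs_of_nonneg (a := (a⁻¹)^3) (by positivity), abs_of_nonneg (a := b⁻¹ * (a⁻¹) ^ 3 + _ + _) (by positivity)]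
    _ ≤ δ * (a⁻¹) ^ 3 + b * (δ * (b⁻¹ * (a⁻¹) ^ 3 + (b⁻¹) ^ 2 * (a⁻¹) ^ 2 + (b⁻¹) ^ 3 * a⁻¹)) := by
        rw [abs_sub_comm b a]; gcongr
    _ = δ * ((a⁻¹) ^ 3 + (a⁻¹) ^ 3 + b⁻¹ * (a⁻¹) ^ 2 + (b⁻¹) ^ 2 * a⁻¹) := by field_simp; ring
    _ ≤ δ * ((t⁻¹) ^ 3 + (t⁻¹) ^ 3 + t⁻¹ * (t⁻¹) ^ 2 + (t⁻¹) ^ 2 * t⁻¹) := by gcongr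
    _ = _ := by field_simp; ring

lemma kk_diff0 {t : ℝ} (ht : 0 < t) (i : Fin 3) {z : E3} (hz : z ≠ 0) :
    |kk (t ^ 8) i z - kk 0 i z| ≤ 3 * t * ‖z‖ ^ (-(2 + 1/8) : ℝ) := by
  set ε := t ^ 8 with hεd
  have hε : 0 < ε := by positivity
  set r := ‖z‖ with hr
  have hr0 : 0 < r := norm_pos_iff.2 hz
  set n := nn ε z with hn
  have hn0 : 0 < n := nn_pos hε z
  have hrn : r ≤ n := norm_le_nn ε z
  have hnr : n ≤ r + ε := Real.sqrt_le_iff.2 ⟨by positivity, by nlinarith [mul_pos hr0 hε]⟩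
  have hi : n⁻¹ ^ 3 ≤ r⁻¹ ^ 3 := by gcongr
  have e : |kk ε i z - kk 0 i z| = |z i| * ((r⁻¹) ^ 3 - (n⁻¹) ^ 3) := by
    unfold kk
    rw [nn_zero, abs_sub_comm, div_eq_mul_inv, div_eq_mul_inv, ← mul_sub, abs_mul, ← inv_pow, ← inv_pow, abs_of_nonneg (sub_nonneg.2 hi)]
  have h1 : |kk ε i z - kk 0 i z| ≤ (r⁻¹) ^ 2 := by
    rw [e]
    calc _ ≤ r * ((r⁻¹) ^ 3 - 0) := by gcongr; exacts [coord_le z i, by positivity]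
      _ = _ := by field_simp; ring
  have h2 : |kk ε i z - kk 0 i z| ≤ 3 * (ε / r) * (r⁻¹) ^ 2 := by
    rw [e]
    have h3 : (r⁻¹) ^ 3 - (n⁻¹) ^ 3 = (n - r) * (r⁻¹ * (n⁻¹) ^ 3 + (r⁻¹) ^ 2 * (n⁻¹) ^ 2 + (r⁻¹) ^ 3 * n⁻¹) := by
      field_simp; ring
    have h4 : n⁻¹ ≤ r⁻¹ := by gcongr
    calc _ ≤ r * (ε * (r⁻¹ * (r⁻¹) ^ 3 + (r⁻¹) ^ 2 * (r⁻¹) ^ 2 + (r⁻¹) ^ 3 * r⁻¹)) := by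
          rw [h3]
          gcongr
          · exact coord_le z i
          · linarith
      _ = _ := by field_simp; ring
  have h5 : ‖z‖ ^ (-(2 + 1/8) : ℝ) = (r⁻¹) ^ 2 * r ^ (-(1/8) : ℝ) := by
    rw [neg_add, Real.rpow_add hr0, Real.rpow_neg hr0.le 2]; norm_num
  rw [h5]
  have h6 : t * r ^ (-(1/8) : ℝ) = (ε / r) ^ (1/8 : ℝ) := by
    rw [Real.div_rpow hε.le hr0.le, Real.rpow_neg hr0.le, hεd, ← Real.rpow_natCast, ← Real.rpow_mul ht.le]
    norm_num [div_eq_mul_inv]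
  have hpos : 0 < ε / r := by positivity
  rcases le_total 1 (ε / r) with h | h
  · have : 1 ≤ (ε / r) ^ (1/8 : ℝ) := Real.one_le_rpow h (by norm_num)
    nlinarith [sq_nonneg (r⁻¹)]
  · have : ε / r ≤ (ε / r) ^ (1/8 : ℝ) := by
      conv_lhs => rw [← Real.rpow_one (ε / r)]
      exact Real.rpow_le_rpow_of_exponent_ge hpos h (by norm_num)
    have := mul_le_mul_of_nonneg_right this (sq_nonneg r⁻¹)
    calc _ ≤ _ := h2
      _ ≤ 3 * ((ε / r) ^ (1/8 : ℝ) * r⁻¹ ^ 2) := by linarith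
      _ = _ := by rw [← h6]; ring

lemma kk_diff0E {t : ℝ} (ht : 0 < t) (i : Fin 3) (x y : E3) :
    ENNReal.ofReal |kk 0 i (x - y) - kk (t ^ 8) i (x - y)| ≤ ENNReal.ofReal (3 * t) * edist x y ^ (-(2 + 1/8) : ℝ) := by
  rcases eq_or_ne x y with rfl | h
  · simp [kk]
  have hz := sub_ne_zero.2 h
  have hp : 0 < ‖x - y‖ := norm_pos_iff.2 hz
  rw [edist_dist, dist_eq_norm, ENNReal.ofReal_rpow_of_pos hp, ← ENNReal.ofReal_mul (by positivity), abs_sub_comm]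
  exact ENNReal.ofReal_le_ofReal (kk_diff0 ht i hz)

lemma enorm_le_sum (z : E3) : ‖z‖ₑ ≤ ∑ j, ‖z j‖ₑ := by
  have : z = ∑ j, (z j) • ee j := by
    ext i; simp [ee, Fin.sum_univ_three]
    fin_cases i <;> simp
  conv_lhs => rw [this]
  refine (enorm_sum_le _ _).trans (Finset.sum_le_sum fun j _ => ?_)
  rw [enorm_smul]
  have : ‖ee j‖ₑ = 1 := by
    rw [← ofReal_norm]; simp [ee]
  rw [this, mul_one]

lemma cube_add (a b : ℝ≥0∞) : (a + b) ^ 3 ≤ 8 * (a ^ 3 + b ^ 3) := by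
  calc _ ≤ (max a b + max a b) ^ 3 := by gcongr; exacts [le_max_left _ _, le_max_right _ _]
    _ = 8 * (max a b) ^ 3 := by ring
    _ ≤ _ := by
        gcongr
        rcases le_total a b with h | h
        · rw [max_eq_right h]; exact le_add_self
        · rw [max_eq_left h]; exact le_self_add

lemma cube_add3 (a b c : ℝ≥0∞) : (a + b + c) ^ 3 ≤ 64 * (a ^ 3 + b ^ 3 + c ^ 3) := by
  calc _ ≤ 8 * ((a + b) ^ 3 + c ^ 3) := cube_add _ _
    _ ≤ 8 * (8 * (a ^ 3 + b ^ 3) + 8 * c ^ 3) := by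
        gcongr
        · exact cube_add _ _
        · exact le_mul_of_one_le_left' (by norm_num)
    _ = _ := by ring

lemma exists_small {A η : ℝ≥0∞} (hA : A ≠ ⊤) (hη : η ≠ 0) : ∃ t : ℝ, 0 < t ∧ A * ENNReal.ofReal t ^ 3 ≤ η := by
  have h1 : 0 < min 1 (η / (A + 1)) := lt_min one_pos (ENNReal.div_pos hη (by finiteness))
  obtain ⟨r, hr0, hr1⟩ := ENNReal.lt_iff_exists_nnreal_btwn.1 h1
  refine ⟨r, by simpa using hr0, ?_⟩
  have h2 : (r : ℝ≥0∞) ≤ 1 := hr1.le.trans (min_le_left _ _)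
  have h3 : (r : ℝ≥0∞) ≤ η / (A + 1) := hr1.le.trans (min_le_right _ _)
  rw [ENNReal.ofReal_coe_nnreal]
  calc A * (r:ℝ≥0∞) ^ 3 ≤ (A + 1) * r := by
        gcongr
        · exact le_self_add
        · exact pow_le_of_le_one zero_le h2 (by norm_num)
    _ ≤ (A + 1) * (η / (A + 1)) := by gcongr
    _ ≤ η := ENNReal.mul_div_le

lemma cBS_mul (z : E3) (j : Fin 3) : ENNReal.ofReal cBS * ‖z j‖ₑ = ENNReal.ofReal |cBS * z j| := by
  rw [abs_mul, ENNReal.ofReal_mul (abs_nonneg _), abs_of_pos cBS_pos, ← Real.norm_eq_abs, ofReal_norm]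

lemma kk_leE (ε : ℝ) (i : Fin 3) (x y : E3) : ENNReal.ofReal |kk ε i (x - y)| ≤ edist x y ^ (-2 : ℝ) :=
  (ENNReal.ofReal_le_ofReal (kk_le ε i _)).trans (edist_m2 x y)

/-- weighted embedding -/
lemma M8b (hΩ : IsLipschitzDomain Ω) {α : ℝ} (h0 : 6/5 ≤ α) (h1 : α < 3/2) :
    ∃ C : ℝ≥0∞, C ≠ ⊤ ∧ ∀ φ, IsTestSol Ω φ →
      ∫⁻ x in Ω, dE Ω x ^ (-(α/2)) * ‖φ x‖ₑ ^ 3 ≤ C * ∫⁻ x in Ω, dE Ω x ^ α * ‖vcurl φ x‖ₑ ^ 3 := by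
  obtain ⟨C, hC, H⟩ := P2 hΩ h0 h1 le_rfl (by norm_num)
  set c := ENNReal.ofReal cBS
  have hc : c ≠ 0 := by simpa [c] using cBS_pos
  have hcT : c ≠ ⊤ := by simp [c]
  refine ⟨(c⁻¹ * 9) ^ 3 * C, by finiteness, fun φ h => ?_⟩
  have hm : Measurable fun y => ‖vcurl φ y‖ₑ := h.toIsTest.csv.curl_cont.measurable.enorm
  have H' := H _ hm
  simp only [add_zero] at H'
  have key : ∀ x ∈ Ω, ‖φ x‖ₑ ≤ (c⁻¹ * 9) * ∫⁻ y in Ω, edist x y ^ (-2:ℝ) * ‖vcurl φ y‖ₑ := by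
    intro x hx
    have h2 : ∀ j, c * ‖φ x j‖ₑ ≤ 3 * ∫⁻ y in Ω, edist x y ^ (-2:ℝ) * ‖vcurl φ y‖ₑ := by
      intro j
      rw [cBS_mul, bs0 hΩ h j hx]
      exact bs_bound hΩ h.toIsTest j (fun i y _ => kk_leE 0 i x y)
    calc ‖φ x‖ₑ = c⁻¹ * (c * ‖φ x‖ₑ) := by rw [← mul_assoc, ENNReal.inv_mul_cancel hc hcT, one_mul]
      _ ≤ c⁻¹ * (∑ j, c * ‖φ x j‖ₑ) := by rw [← Finset.mul_sum]; gcongr; exact enorm_le_sum _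
      _ ≤ c⁻¹ * (∑ j : Fin 3, 3 * ∫⁻ y in Ω, edist x y ^ (-2:ℝ) * ‖vcurl φ y‖ₑ) := mul_le_mul_right (Finset.sum_le_sum fun j _ => h2 j) _
      _ = _ := by simp; ring
  calc _ ≤ ∫⁻ x in Ω, (c⁻¹ * 9) ^ 3 * (dE Ω x ^ (-(α/2)) * (∫⁻ y in Ω, edist x y ^ (-2:ℝ) * ‖vcurl φ y‖ₑ) ^ 3) := by
        refine setLIntegral_mono' hΩ.isOpen.measurableSet fun x hx => ?_
        calc _ ≤ dE Ω x ^ (-(α/2)) * ((c⁻¹ * 9) * ∫⁻ y in Ω, edist x y ^ (-2:ℝ) * ‖vcurl φ y‖ₑ) ^ 3 := by gcongr; exact key x hx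
          _ = _ := by ring
    _ = (c⁻¹ * 9) ^ 3 * ∫⁻ x in Ω, (dE Ω x ^ (-(α/2)) * (∫⁻ y in Ω, edist x y ^ (-2:ℝ) * ‖vcurl φ y‖ₑ) ^ 3) := lintegral_const_mul' _ _ (by finiteness)
    _ ≤ _ := by rw [mul_assoc]; gcongr
end
end

section
section
variable {Ω : Set E3}

/-- Hölder -/
lemma L1_le (hΩ : IsLipschitzDomain Ω) {α : ℝ} (h0 : 6/5 ≤ α) (h1 : α < 3/2) :
    ∃ C : ℝ≥0∞, C ≠ ⊤ ∧ ∀ h : E3 → ℝ≥0∞, AEMeasurable h (volume.restrict Ω) →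
      (∫⁻ x in Ω, h x) ^ 3 ≤ C * ∫⁻ x in Ω, dE Ω x ^ α * h x ^ 3 := by
  have hT := total_int hΩ (s := α/2) (by linarith) (by linarith)
  refine ⟨(∫⁻ y in Ω, dE Ω y ^ (-(α/2))) ^ 2, by finiteness, fun h hh => ?_⟩
  have H := holder3 (μ := volume.restrict Ω) (k := fun _ => 1) (p := fun y => dE Ω y ^ (-(α/2))) (h := h) aemeasurable_const
    (dE_meas.pow_const _).aemeasurable hh ?_
  · simp only [one_mul] at H
    refine H.trans (le_of_eq ?_)
    congr 1
    refine setLIntegral_congr_fun hΩ.isOpen.measurableSet fun x hx => ?_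
    rw [← ENNReal.rpow_mul]
    congr 2; ring
  · filter_upwards [ae_Om hΩ] with y hy
    exact ⟨(ENNReal.rpow_pos (pos_iff_ne_zero.2 (dE_ne0 hΩ hy)) (dE_neT y)).ne', ENNReal.rpow_ne_top_of_ne_zero (dE_ne0 hΩ hy) (dE_neT y)⟩

/-- Biot-Savart functional -/
def BSf (ε : ℝ) (φ : E3 → E3) (j : Fin 3) (x : E3) : ℝ := ∫ y, ∑ i, kk ε i (x - y) * As φ i j y

lemma bs_intg {ε : ℝ} (hε : 0 < ε) {φ : E3 → E3} (h : CSv φ) (j : Fin 3) (x : E3) :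
    Integrable fun y => ∑ i, kk ε i (x - y) * As φ i j y := by
  refine integrable_finsetSum _ fun i _ => ?_
  have c := ((h.pd i j).sub (h.pd j i))
  exact cs_int (((kk_cont hε i).comp (by fun_prop)).mul c.cont) c.supp.mul_left

lemma bs_intg0 (hΩ : IsLipschitzDomain Ω) {φ : E3 → E3} (h : IsTest Ω φ) (j : Fin 3) {x : E3} (hx : x ∈ Ω) :
    Integrable fun y => ∑ i, kk 0 i (x - y) * As φ i j y := by
  refine integrable_finsetSum _ fun i _ => ?_
  refine (dom_int hΩ h hx).mono' (((kk_meas _ i).comp (by fun_prop)).mul (As_meas h.csv i j)).aestronglyMeasurable (Eventually.of_forall fun y => ?_)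
  rw [norm_mul]
  exact mul_le_mul (kk_le _ _ _) (As_le _ _ _ _) (norm_nonneg _) (by positivity)

lemma ofReal_abs_le_add (a b : ℝ) : ENNReal.ofReal |a| ≤ ENNReal.ofReal |a - b| + ENNReal.ofReal |b| := by
  rw [← ENNReal.ofReal_add (abs_nonneg _) (abs_nonneg _)]
  apply ENNReal.ofReal_le_ofReal
  simpa using abs_add_le (a - b) b

/-- compactness estimate -/
lemma M8c (hΩ : IsLipschitzDomain Ω) {α : ℝ} (h0 : 6/5 ≤ α) (h1 : α < 3/2) {η : ℝ≥0∞} (hη : η ≠ 0) :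
    ∃ ε : ℝ, 0 < ε ∧ ∃ P : Finset E3, ∃ C : ℝ≥0∞, C ≠ ⊤ ∧ ∀ φ, IsTestSol Ω φ →
      ∫⁻ x in Ω, dE Ω x ^ (-(α/2)) * ‖φ x‖ₑ ^ 3 ≤ η * (∫⁻ x in Ω, dE Ω x ^ α * ‖vcurl φ x‖ₑ ^ 3)
        + C * ∑ p ∈ P, ∑ j, ENNReal.ofReal |BSf ε φ j p| ^ 3 := by
  obtain ⟨C2, hC2, H2⟩ := P2 hΩ h0 h1 (θ := 1/8) (by norm_num) le_rfl
  obtain ⟨C1, hC1, H1⟩ := L1_le hΩ h0 h1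
  have hT := total_int hΩ (s := α/2) (by linarith) (by linarith)
  set T := ∫⁻ y in Ω, dE Ω y ^ (-(α/2))
  set c := ENNReal.ofReal cBS
  have hc : c ≠ 0 := by simpa [c] using cBS_pos
  have hcT : c ≠ ⊤ := by simp [c]
  have hη2 : η / 2 ≠ 0 := by simp [hη]
  obtain ⟨t, ht, hts⟩ := exists_small (A := (c⁻¹) ^ 3 * 64 * 9 ^ 3 * 3 ^ 3 * C2) (by finiteness) hη2
  obtain ⟨u, hu, hus⟩ := exists_small (A := (c⁻¹) ^ 3 * 64 * 9 ^ 3 * T * C1) (by finiteness) hη2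
  set ε := t ^ 8 with hε
  have hε0 : 0 < ε := by positivity
  set δ := u * ε ^ 3 / 4 with hδ
  have hδ0 : 0 < δ := by positivity
  obtain ⟨P, hPs, hPf, hP⟩ := finite_cover_balls_of_compact (hΩ.isBounded.isCompact_closure) hδ0
  refine ⟨ε, hε0, hPf.toFinset, (c⁻¹) ^ 3 * 64 * 64 * T, by finiteness, fun φ h => ?_⟩
  have hv := h.toIsTest.csv
  have hm : Measurable fun y => ‖vcurl φ y‖ₑ := hv.curl_cont.measurable.enorm
  set S := ∑ p ∈ hPf.toFinset, ∑ j, ENNReal.ofReal |BSf ε φ j p| ^ 3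
  set E : E3 → ℝ≥0∞ := fun x => ∫⁻ y in Ω, edist x y ^ (-(2 + 1/8) : ℝ) * ‖vcurl φ y‖ₑ with hE
  set L := ∫⁻ y in Ω, ‖vcurl φ y‖ₑ with hL
  have key : ∀ x ∈ Ω, ‖φ x‖ₑ ^ 3 ≤ (c⁻¹) ^ 3 * 64 * ((9 * ENNReal.ofReal (3 * t) * E x) ^ 3 + (9 * ENNReal.ofReal u * L) ^ 3 + 64 * S) := by
    intro x hx
    obtain ⟨p, hpP, hp⟩ := Set.mem_iUnion₂.1 (hP (subset_closure hx))
    have h2 : ∀ j, c * ‖φ x j‖ₑ ≤ 3 * ENNReal.ofReal (3 * t) * E x + 3 * ENNReal.ofReal u * L + ENNReal.ofReal |BSf ε φ j p| := by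
      intro j
      rw [cBS_mul, bs0 hΩ h j hx]
      refine (ofReal_abs_le_add _ (BSf ε φ j x)).trans ?_
      rw [add_assoc]
      refine add_le_add ?_ ((ofReal_abs_le_add _ (BSf ε φ j p)).trans (add_le_add_left ?_ _))
      · unfold BSf
        rw [← integral_sub (bs_intg0 hΩ h.toIsTest j hx) (bs_intg hε0 hv j x)]
        simp only [← Finset.sum_sub_distrib, ← sub_mul]
        refine (bs_bound hΩ h.toIsTest j (k := fun y => ENNReal.ofReal (3 * t) * edist x y ^ (-(2 + 1/8) : ℝ)) (fun i y _ => kk_diff0E ht i x y)).trans ?_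
        simp only [mul_assoc]
        rw [lintegral_const_mul' _ _ ENNReal.ofReal_ne_top]
      · unfold BSf
        rw [← integral_sub (bs_intg hε0 hv j x) (bs_intg hε0 hv j p)]
        simp only [← Finset.sum_sub_distrib, ← sub_mul]
        refine (bs_bound hΩ h.toIsTest j (k := fun y => ENNReal.ofReal u) (fun i y _ => ENNReal.ofReal_le_ofReal ?_)).trans ?_
        · refine (kk_lip hε0 i (le_nn _) (le_nn _)).trans ?_
          rw [sub_sub_sub_cancel_right, ← dist_eq_norm, div_le_iff₀ (by positivity)]
          rw [Metric.mem_ball] at hp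
          linarith
        · rw [lintegral_const_mul' _ _ (by simp), mul_assoc]
    have h3 : c * ‖φ x‖ₑ ≤ 9 * ENNReal.ofReal (3 * t) * E x + 9 * ENNReal.ofReal u * L + ∑ j, ENNReal.ofReal |BSf ε φ j p| := by
      calc _ ≤ ∑ j, c * ‖φ x j‖ₑ := by rw [← Finset.mul_sum]; gcongr; exact enorm_le_sum _
        _ ≤ ∑ j, (3 * ENNReal.ofReal (3 * t) * E x + 3 * ENNReal.ofReal u * L + ENNReal.ofReal |BSf ε φ j p|) := Finset.sum_le_sum fun j _ => h2 j
        _ = _ := by rw [Finset.sum_add_distrib]; simp; ring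
    have h4 : (∑ j, ENNReal.ofReal |BSf ε φ j p|) ^ 3 ≤ 64 * S := by
      rw [Fin.sum_univ_three]
      refine (cube_add3 _ _ _).trans ?_
      gcongr
      rw [← Fin.sum_univ_three (fun j => ENNReal.ofReal |BSf ε φ j p| ^ 3)]
      exact Finset.single_le_sum (f := fun p => ∑ j, ENNReal.ofReal |BSf ε φ j p| ^ 3) (fun _ _ => zero_le) (hPf.mem_toFinset.2 hpP)
    calc ‖φ x‖ₑ ^ 3 = (c⁻¹ * (c * ‖φ x‖ₑ)) ^ 3 := by rw [← mul_assoc, ENNReal.inv_mul_cancel hc hcT, one_mul]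
      _ ≤ (c⁻¹ * (9 * ENNReal.ofReal (3 * t) * E x + 9 * ENNReal.ofReal u * L + ∑ j, ENNReal.ofReal |BSf ε φ j p|)) ^ 3 := by gcongr
      _ ≤ (c⁻¹) ^ 3 * (64 * ((9 * ENNReal.ofReal (3 * t) * E x) ^ 3 + (9 * ENNReal.ofReal u * L) ^ 3 + (∑ j, ENNReal.ofReal |BSf ε φ j p|) ^ 3)) := by
          rw [mul_pow]; gcongr; exact cube_add3 _ _ _
      _ ≤ (c⁻¹) ^ 3 * (64 * ((9 * ENNReal.ofReal (3 * t) * E x) ^ 3 + (9 * ENNReal.ofReal u * L) ^ 3 + 64 * S)) := by gcongr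
      _ = _ := by ring
  set a := (c⁻¹) ^ 3 * 64 * 9 ^ 3 * ENNReal.ofReal (3 * t) ^ 3 with ha
  set b := (c⁻¹) ^ 3 * 64 * (9 * ENNReal.ofReal u * L) ^ 3 + (c⁻¹) ^ 3 * 64 * 64 * S with hb
  have hmE : Measurable E := by
    have : Measurable (Function.uncurry fun x y : E3 => edist x y ^ (-(2 + 1/8) : ℝ) * ‖vcurl φ y‖ₑ) :=
      (measurable_edist.pow_const _).mul (hm.comp measurable_snd)
    exact this.lintegral_prod_right'
  have hI : ∫⁻ x in Ω, dE Ω x ^ (-(α/2)) * ‖φ x‖ₑ ^ 3 ≤ a * (∫⁻ x in Ω, dE Ω x ^ (-(α/2)) * E x ^ 3) + T * b := by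
    calc _ ≤ ∫⁻ x in Ω, (a * (dE Ω x ^ (-(α/2)) * E x ^ 3) + dE Ω x ^ (-(α/2)) * b) := by
          refine setLIntegral_mono' hΩ.isOpen.measurableSet fun x hx => ?_
          refine (mul_le_mul_right (key x hx) _).trans (le_of_eq ?_)
          rw [ha, hb]; ring
      _ = _ := by
          have m1 : Measurable fun x => dE Ω x ^ (-(α/2)) * E x ^ 3 := (dE_meas.pow_const _).mul (hmE.pow_const _)
          have m2 : Measurable fun x => dE Ω x ^ (-(α/2)) := dE_meas.pow_const _
          rw [lintegral_add_left (m1.const_mul a), lintegral_const_mul _ m1, lintegral_mul_const _ m2]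
  refine hI.trans ?_
  set W := ∫⁻ x in Ω, dE Ω x ^ α * ‖vcurl φ x‖ₑ ^ 3 with hW
  have hw1 : a * (∫⁻ x in Ω, dE Ω x ^ (-(α/2)) * E x ^ 3) ≤ η / 2 * W := by
    calc _ ≤ a * (C2 * W) := by gcongr; exact H2 _ hm
      _ = ((c⁻¹) ^ 3 * 64 * 9 ^ 3 * 3 ^ 3 * C2 * ENNReal.ofReal t ^ 3) * W := by
          rw [ha, ENNReal.ofReal_mul (by norm_num)]; simp only [ENNReal.ofReal_ofNat]; ring
      _ ≤ _ := by gcongr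
  have hw2 : T * b ≤ η / 2 * W + (c⁻¹) ^ 3 * 64 * 64 * T * S := by
    have hL1 : L ^ 3 ≤ C1 * W := H1 _ hm.aemeasurable
    calc T * b = (c⁻¹) ^ 3 * 64 * 9 ^ 3 * T * ENNReal.ofReal u ^ 3 * L ^ 3 + (c⁻¹) ^ 3 * 64 * 64 * T * S := by rw [hb]; ring
      _ ≤ (c⁻¹) ^ 3 * 64 * 9 ^ 3 * T * ENNReal.ofReal u ^ 3 * (C1 * W) + (c⁻¹) ^ 3 * 64 * 64 * T * S := by gcongr
      _ = ((c⁻¹) ^ 3 * 64 * 9 ^ 3 * T * C1 * ENNReal.ofReal u ^ 3) * W + (c⁻¹) ^ 3 * 64 * 64 * T * S := by ring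
      _ ≤ _ := by gcongr
  calc _ ≤ η / 2 * W + (η / 2 * W + (c⁻¹) ^ 3 * 64 * 64 * T * S) := add_le_add hw1 hw2
    _ = _ := by rw [← add_assoc, ← add_mul, ENNReal.add_halves]
end
end

section
section
variable {Ω : Set E3}

lemma ball_sub_Om (hΩ : IsLipschitzDomain Ω) {z x : E3} (hz : z ∈ Ω) (hx : dist x z < dB Ω z) : x ∈ Ω := by
  by_contra hn
  have hc : IsConnected (Metric.ball z (dB Ω z)) := (convex_ball z _).isConnected ⟨z, Metric.mem_ball_self (dB_pos hΩ hz)⟩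
  have hf : ∀ y ∈ Metric.ball z (dB Ω z), y ∉ frontier Ω := by
    intro y hy1 hy2
    have : dB Ω z ≤ dist z y := Metric.infDist_le_dist_of_mem hy2
    rw [Metric.mem_ball, dist_comm] at hy1
    linarith
  have hcov : ∀ y ∈ Metric.ball z (dB Ω z), y ∉ Ω → y ∈ (closure Ω)ᶜ := by
    intro y hy hyn hcl
    exact hf y hy (by rw [hΩ.isOpen.frontier_eq]; exact ⟨hcl, hyn⟩)
  obtain ⟨y, _, hy1, hy2⟩ := hc.isPreconnected Ω (closure Ω)ᶜ hΩ.isOpen isClosed_closure.isOpen_compl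
    (fun y hy => (em (y ∈ Ω)).imp id (hcov y hy)) ⟨z, Metric.mem_ball_self (dB_pos hΩ hz), hz⟩ ⟨x, hx, hcov x hx hn⟩
  exact hy2 (subset_closure hy1)

/-- real version of the kernel `KE` -/
def KR (Ω : Set E3) (x y : E3) : ℝ := (‖x - y‖⁻¹) ^ 2 * (‖x - y‖ + dB Ω x)⁻¹

lemma KR_nonneg (x y : E3) : 0 ≤ KR Ω x y := by
  have := dB_nonneg (Ω := Ω) x
  unfold KR; positivity

lemma KR_le (hΩ : IsLipschitzDomain Ω) {x : E3} (hx : x ∈ Ω) (y : E3) : ENNReal.ofReal (KR Ω x y) ≤ KE Ω x y := by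
  have hd := dB_pos hΩ hx
  unfold KR KE
  rw [ENNReal.ofReal_mul (by positivity), ENNReal.ofReal_inv_of_pos (by positivity), ENNReal.ofReal_add (norm_nonneg _) hd.le]
  rw [edist_dist, dist_eq_norm, ← dist_eq_norm, ← edist_dist]
  gcongr
  · rw [dist_eq_norm]; exact edist_m2 x y
  · exact le_of_eq rfl

lemma ker_near {z x y : E3} (hΩ : IsLipschitzDomain Ω) (hz : z ∈ Ω) (hx : dist x z < dB Ω z / 4) (hy : dist y z < dB Ω z / 2) (i : Fin 3) :
    |kk 0 i (x - y)| ≤ 72 * dB Ω z * KR Ω x y := by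
  have hd := dB_pos hΩ hz
  have hx0 : 0 < dB Ω x := dB_pos hΩ (ball_sub_Om hΩ hz (by linarith))
  refine (kk_le 0 i _).trans ?_
  unfold KR
  have h1 : ‖x - y‖ + dB Ω x ≤ 2 * dB Ω z := by
    have := dB_le (Ω := Ω) x z
    have := dist_triangle_right x y z
    rw [← dist_eq_norm]; linarith
  have h2 : 1 ≤ 72 * dB Ω z * (‖x - y‖ + dB Ω x)⁻¹ := by
    rw [← div_eq_mul_inv, le_div_iff₀ (by positivity)]; linarith
  nlinarith [sq_nonneg (‖x - y‖⁻¹)]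

lemma ker_far {z x y : E3} (hΩ : IsLipschitzDomain Ω) (hz : z ∈ Ω) (hx : dist x z < dB Ω z / 4) (hy : dB Ω z / 2 ≤ dist y z) (i : Fin 3) :
    |kk 0 i (x - y) - kk 0 i (z - y)| ≤ 72 * dB Ω z * KR Ω x y := by
  have hd := dB_pos hΩ hz
  have hx0 : 0 < dB Ω x := dB_pos hΩ (ball_sub_Om hΩ hz (by linarith))
  set b := ‖z - y‖ with hb
  have hb' : dist y z = b := by rw [dist_comm, dist_eq_norm]
  rw [hb'] at hy
  have hb0 : 0 < b := by linarith
  set a := ‖x - y‖ with ha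
  have h1 : b ≤ a + dist x z := by
    rw [ha, ← dist_eq_norm, ← hb', dist_comm y z, dist_comm x z]; linarith [dist_triangle z x y]
  have h2 : a ≤ b + dist x z := by
    rw [ha, ← dist_eq_norm, ← hb', dist_comm y z]; linarith [dist_triangle x z y]
  have h3 := dB_le (Ω := Ω) x z
  have ha0 : b / 2 ≤ a := by linarith
  have ha00 : 0 < a := by linarith
  have h4 := kk_lip (ε := 0) (t := b / 2) (by positivity) i (z := x - y) (w := z - y) (by rw [nn_zero]; exact ha0) (by rw [nn_zero]; linarith)
  rw [sub_sub_sub_cancel_right, ← dist_eq_norm] at h4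
  refine h4.trans ?_
  have h5 : (9 * b ^ 3)⁻¹ ≤ KR Ω x y := by
    unfold KR
    rw [inv_pow, ← mul_inv]
    refine inv_anti₀ (by positivity) ?_
    calc a ^ 2 * (a + dB Ω x) ≤ (3 / 2 * b) ^ 2 * (4 * b) := by gcongr <;> linarith
      _ = _ := by ring
  calc _ ≤ 4 * (dB Ω z / 4) / (b / 2) ^ 3 := by gcongr
    _ = 72 * dB Ω z * (9 * b ^ 3)⁻¹ := by field_simp; ring
    _ ≤ _ := by gcongr

lemma osc (hΩ : IsLipschitzDomain Ω) {φ : E3 → E3} (h : IsTestSol Ω φ) {z : E3} (hz : z ∈ Ω) :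
    ∃ c : E3, ∀ x, dist x z < dB Ω z / 4 → ∀ j, ENNReal.ofReal cBS * ‖φ x j - c j‖ₑ ≤
      3 * ENNReal.ofReal (72 * dB Ω z) * ∫⁻ y in Ω, KE Ω x y * ‖vcurl φ y‖ₑ := by
  classical
  set S : Set E3 := {y | dB Ω z / 2 ≤ dist y z} with hS
  have hSm : MeasurableSet S := (isClosed_le continuous_const (by fun_prop)).measurableSet
  set I : Fin 3 → ℝ := fun j => ∫ y, S.indicator (fun y => ∑ i, kk 0 i (z - y) * As φ i j y) y with hI
  refine ⟨WithLp.toLp 2 fun j => cBS⁻¹ * I j, fun x hx j => ?_⟩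
  have hd := dB_pos hΩ hz
  have hxΩ : x ∈ Ω := ball_sub_Om hΩ hz (by linarith)
  have e0 : ‖φ x j - (WithLp.toLp 2 fun j => cBS⁻¹ * I j : E3) j‖ₑ = ‖φ x j - cBS⁻¹ * I j‖ₑ := rfl
  rw [e0]
  have e1 : ENNReal.ofReal cBS * ‖φ x j - cBS⁻¹ * I j‖ₑ = ENNReal.ofReal |cBS * φ x j - I j| := by
    rw [show cBS * φ x j - I j = cBS * (φ x j - cBS⁻¹ * I j) by rw [mul_sub, ← mul_assoc, mul_inv_cancel₀ cBS_pos.ne', one_mul]]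
    rw [abs_mul, ENNReal.ofReal_mul (abs_nonneg _), abs_of_pos cBS_pos, ← Real.norm_eq_abs, ofReal_norm]
  rw [e1, bs0 hΩ h j hxΩ, hI]
  rw [← integral_sub (bs_intg0 hΩ h.toIsTest j hxΩ) ((bs_intg0 hΩ h.toIsTest j hz).indicator hSm)]
  have e2 : ∀ y, (∑ i, kk 0 i (x - y) * As φ i j y) - S.indicator (fun y => ∑ i, kk 0 i (z - y) * As φ i j y) y
      = ∑ i, (kk 0 i (x - y) - if y ∈ S then kk 0 i (z - y) else 0) * As φ i j y := by
    intro y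
    by_cases hy : y ∈ S
    · simp [hy, ← Finset.sum_sub_distrib, sub_mul]
    · simp [hy]
  simp only [e2]
  refine (bs_bound hΩ h.toIsTest j (k := fun y => ENNReal.ofReal (72 * dB Ω z) * KE Ω x y) (fun i y _ => ?_)).trans ?_
  · refine (ENNReal.ofReal_le_ofReal ?_).trans ((ENNReal.ofReal_mul (q := KR Ω x y) (by positivity)).le.trans (mul_le_mul_right (KR_le hΩ hxΩ y) _))
    by_cases hy : y ∈ S
    · rw [if_pos hy]; exact ker_far hΩ hz hx hy i
    · rw [if_neg hy, sub_zero]; exact ker_near hΩ hz hx (not_le.1 hy) i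
  · simp only [mul_assoc]
    rw [lintegral_const_mul' _ _ ENNReal.ofReal_ne_top]

lemma cutoff : ∃ M : ℝ, 0 < M ∧ ∀ (z : E3) (ρ : ℝ), 0 < ρ → ∃ ζ : E3 → ℝ, CSf ζ ∧ (∀ x, |ζ x| ≤ 1) ∧ (∀ x ∈ Metric.ball z ρ, ζ x = 1) ∧
    (∀ x, x ∉ Metric.ball z (2 * ρ) → ζ x = 0) ∧ (∀ i x, |pds ζ i x| ≤ M / ρ) ∧ (∀ i x, x ∉ Metric.ball z (2 * ρ) → pds ζ i x = 0) := by
  let χ : ContDiffBump (0 : E3) := ⟨1, 3/2, one_pos, by norm_num⟩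
  have hχ : CSf χ := ⟨χ.contDiff, χ.hasCompactSupport⟩
  choose M hM hb using fun i => (hχ.pds i).bdd
  refine ⟨1 + ∑ i, M i, by have := Finset.sum_nonneg fun i (_ : i ∈ Finset.univ) => hM i; linarith, fun z ρ hρ => ?_⟩
  set ζ : E3 → ℝ := fun x => χ (ρ⁻¹ • (x - z)) with hζ
  have hsm : ContDiff ℝ (⊤ : ℕ∞) ζ := χ.contDiff.comp (by fun_prop)
  have hout : ∀ x, x ∉ Metric.ball z (2 * ρ) → 2 ≤ ‖ρ⁻¹ • (x - z)‖ := by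
    intro x hx
    rw [Metric.mem_ball, not_lt, dist_eq_norm] at hx
    rw [norm_smul, Real.norm_of_nonneg (by positivity), inv_mul_eq_div, le_div_iff₀ hρ]; exact hx
  have hz0 : ∀ x, x ∉ Metric.ball z (2 * ρ) → ζ x = 0 := by
    intro x hx
    apply χ.zero_of_le_dist
    rw [dist_zero_right]
    have := hout x hx
    change (3/2:ℝ) ≤ _
    linarith
  have hpds : ∀ i x, pds ζ i x = ρ⁻¹ * pds χ i (ρ⁻¹ • (x - z)) := by
    intro i x
    have h1 : HasFDerivAt (fun x : E3 => ρ⁻¹ • (x - z)) (ρ⁻¹ • ContinuousLinearMap.id ℝ E3) x :=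
      ((hasFDerivAt_id x).sub_const z).const_smul ρ⁻¹
    have h2 := ((hχ.diff (ρ⁻¹ • (x - z))).hasFDerivAt.comp x h1).fderiv
    unfold pds
    have h3 : fderiv ℝ ζ x = (fderiv ℝ χ (ρ⁻¹ • (x - z))).comp (ρ⁻¹ • ContinuousLinearMap.id ℝ E3) := h2
    rw [h3]; simp
  refine ⟨ζ, ⟨hsm, ?_⟩, ?_, ?_, hz0, ?_, ?_⟩
  · refine HasCompactSupport.intro (isCompact_closedBall z (2 * ρ)) fun x hx => hz0 x fun h => hx (Metric.ball_subset_closedBall h)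
  · intro x
    rw [abs_of_nonneg χ.nonneg]; exact χ.le_one
  · intro x hx
    apply χ.one_of_mem_closedBall
    rw [Metric.mem_closedBall, dist_zero_right, norm_smul, Real.norm_of_nonneg (by positivity), inv_mul_eq_div]
    change _ ≤ (1:ℝ)
    rw [div_le_one hρ, ← dist_eq_norm]; exact (Metric.mem_ball.1 hx).le
  · intro i x
    rw [hpds, abs_mul, abs_of_pos (inv_pos.2 hρ), inv_mul_eq_div]
    gcongr
    refine (hb i _).trans ?_
    have := Finset.single_le_sum (f := M) (fun i _ => hM i) (Finset.mem_univ i)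
    linarith
  · intro i x hx
    rw [hpds]
    have h2 := hout x hx
    have : fderiv ℝ χ (ρ⁻¹ • (x - z)) = 0 := by
      by_contra hne
      have h3 := support_fderiv_subset ℝ hne
      rw [χ.tsupport_eq, Metric.mem_closedBall, dist_zero_right] at h3
      have : ‖ρ⁻¹ • (x - z)‖ ≤ (3/2:ℝ) := h3
      linarith
    simp [pds, this]
end
end

section
section
variable {Ω : Set E3}

lemma lint_cube {f : E3 → ℝ} (h0 : ∀ x, 0 ≤ f x) (hi : Integrable fun x => f x ^ 3) :
    ENNReal.ofReal (∫ x, f x ^ 3) = ∫⁻ x, ENNReal.ofReal (f x) ^ 3 := by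
  rw [ofReal_integral_eq_lintegral_ofReal hi (Eventually.of_forall fun x => pow_nonneg (h0 x) 3)]
  refine lintegral_congr fun x => ?_
  rw [ENNReal.ofReal_pow (h0 x)]

lemma cz_mainE {U : E3 → E3} (h : CSv U) (k j : Fin 3) :
    ∫⁻ x, ‖pd U k j x‖ₑ ^ 3 ≤ 1417176 * ((∫⁻ x, ‖vcurl U x‖ₑ ^ 3) + ∫⁻ x, ‖vdiv U x‖ₑ ^ 3) := by
  have h1 := lint_cube (f := fun x => |pd U k j x|) (fun x => abs_nonneg _) (h.pd k j).cube_int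
  have h2 := lint_cube (f := fun x => ‖vcurl U x‖) (fun x => norm_nonneg _) h.curl_int
  have h3 := lint_cube (f := fun x => |vdiv U x|) (fun x => abs_nonneg _) h.div.cube_int
  simp only [← Real.norm_eq_abs, ofReal_norm] at h1 h2 h3
  rw [← h1, ← h2, ← h3, ← ENNReal.ofReal_add (integral_nonneg fun x => by positivity) (integral_nonneg fun x => by positivity)]
  have := cz_main h k j
  simp only [← Real.norm_eq_abs] at this
  refine (ENNReal.ofReal_le_ofReal this).trans ?_
  rw [ENNReal.ofReal_mul (by norm_num)]
  simp

lemma CSv.pd_mul {φ : E3 → E3} {ζ : E3 → ℝ} (hφ : Differentiable ℝ φ) (hζ : Differentiable ℝ ζ) (c : E3) (i j : Fin 3) (x : E3) :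
    _root_.pd (fun x => ζ x • (φ x - c)) i j x = ζ x * _root_.pd φ i j x + _root_.pds ζ i x * (φ x j - c j) := by
  rw [pd_eq (by fun_prop), pd_eq hφ]
  unfold _root_.pds
  have h1 : HasFDerivAt (fun y => φ y j) (fderiv ℝ (fun y => φ y j) x) x := by
    refine DifferentiableAt.hasFDerivAt ?_
    exact ((EuclideanSpace.proj (𝕜 := ℝ) j : E3 →L[ℝ] ℝ).differentiable.comp hφ) x
  have h2 := (hζ x).hasFDerivAt.mul (h1.sub_const (c j))
  have h3 : fderiv ℝ (fun y => (ζ y • (φ y - c)) j) x = _ := h2.fderiv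
  rw [h3]
  simp; ring

lemma loc_est (hΩ : IsLipschitzDomain Ω) : ∃ C : ℝ≥0∞, C ≠ ⊤ ∧ ∀ φ, IsTestSol Ω φ → ∀ z ∈ Ω, ∀ k j,
    ∫⁻ x in Metric.ball z (dB Ω z / 8), ‖pd φ k j x‖ₑ ^ 3 ≤
      C * ∫⁻ x in Metric.ball z (dB Ω z / 4), (‖vcurl φ x‖ₑ + ∫⁻ y in Ω, KE Ω x y * ‖vcurl φ y‖ₑ) ^ 3 := by
  obtain ⟨M, hM, hcut⟩ := cutoff
  set c := ENNReal.ofReal cBS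
  have hc : c ≠ 0 := by simpa [c] using cBS_pos
  have hcT : c ≠ ⊤ := by simp [c]
  set B := 3 + 6 * (c⁻¹ * 9 * ENNReal.ofReal (576 * M)) with hB
  refine ⟨1417176 * 2 * B ^ 3, by finiteness, fun φ h z hz k j => ?_⟩
  have hd := dB_pos hΩ hz
  obtain ⟨a, ha⟩ := osc hΩ h hz
  obtain ⟨ζ, hζ, hζ1, hζe, hζ0, hζd, hζd0⟩ := hcut z (dB Ω z / 8) (by positivity)
  have hv := h.toIsTest.csv
  rw [show 2 * (dB Ω z / 8) = dB Ω z / 4 by ring] at hζ0 hζd0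
  set V := Metric.ball z (dB Ω z / 4) with hV
  set N : E3 → ℝ≥0∞ := fun x => ∫⁻ y in Ω, KE Ω x y * ‖vcurl φ y‖ₑ with hN
  set U : E3 → E3 := fun x => ζ x • (φ x - a) with hU
  have hUc : CSv U := ⟨hζ.smooth.smul (hv.smooth.sub contDiff_const), hζ.supp.smul_right⟩
  have hpd : ∀ i j x, pd U i j x = ζ x * pd φ i j x + pds ζ i x * (φ x j - a j) := fun i j x => CSv.pd_mul hv.diff hζ.diff a i j x
  have hosc : ∀ x ∈ V, ∀ i l, ‖pds ζ i x * (φ x l - a l)‖ₑ ≤ (c⁻¹ * 9 * ENNReal.ofReal (576 * M)) * N x := by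
    intro x hx i l
    have h1 := ha x hx l
    have h2 : ‖φ x l - a l‖ₑ ≤ c⁻¹ * (3 * ENNReal.ofReal (72 * dB Ω z) * N x) := by
      calc _ = c⁻¹ * (c * ‖φ x l - a l‖ₑ) := by rw [← mul_assoc, ENNReal.inv_mul_cancel hc hcT, one_mul]
        _ ≤ _ := by gcongr
    have h3 : ‖pds ζ i x‖ₑ ≤ ENNReal.ofReal (M / (dB Ω z / 8)) := by
      rw [← ofReal_norm]; exact ENNReal.ofReal_le_ofReal (hζd i x)
    have h4 : ENNReal.ofReal (M / (dB Ω z / 8)) * ENNReal.ofReal (72 * dB Ω z) = ENNReal.ofReal (576 * M) := by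
      rw [← ENNReal.ofReal_mul (by positivity)]; congr 1; field_simp; norm_num
    rw [enorm_mul]
    calc _ ≤ ENNReal.ofReal (M / (dB Ω z / 8)) * (c⁻¹ * (3 * ENNReal.ofReal (72 * dB Ω z) * N x)) := by gcongr
      _ = c⁻¹ * 3 * (ENNReal.ofReal (M / (dB Ω z / 8)) * ENNReal.ofReal (72 * dB Ω z)) * N x := by ring
      _ ≤ _ := by rw [h4]; gcongr; norm_num
  have hAs : ∀ x ∈ V, ∀ i l, ‖pd U i l x - pd U l i x‖ₑ ≤ ‖vcurl φ x‖ₑ + 2 * ((c⁻¹ * 9 * ENNReal.ofReal (576 * M)) * N x) := by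
    intro x hx i l
    rw [hpd, hpd, show ζ x * pd φ i l x + pds ζ i x * (φ x l - a l) - (ζ x * pd φ l i x + pds ζ l x * (φ x i - a i))
      = ζ x * As φ i l x + (pds ζ i x * (φ x l - a l) - pds ζ l x * (φ x i - a i)) by unfold As; ring]
    refine (enorm_add_le _ _).trans (add_le_add ?_ (enorm_sub_le.trans ?_))
    · rw [enorm_le_iff_norm_le, norm_mul]
      calc _ ≤ 1 * ‖vcurl φ x‖ := mul_le_mul (hζ1 x) (As_le φ i l x) (abs_nonneg _) zero_le_one
        _ = _ := one_mul _
    · rw [two_mul]; exact add_le_add (hosc x hx i l) (hosc x hx l i)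
  have hcurl : ∀ x, ‖vcurl U x‖ₑ ^ 3 ≤ V.indicator (fun x => B ^ 3 * (‖vcurl φ x‖ₑ + N x) ^ 3) x := by
    intro x
    by_cases hx : x ∈ V
    · rw [Set.indicator_of_mem hx, ← mul_pow]
      gcongr
      refine (enorm_le_sum _).trans ?_
      rw [Fin.sum_univ_three]
      simp only [vcurl, mk3_0, mk3_1, mk3_2]
      refine (add_le_add (add_le_add (hAs x hx 1 2) (hAs x hx 2 0)) (hAs x hx 0 1)).trans ?_
      simp only [vcurl]
      generalize ‖mk3 (pd φ 1 2 x - pd φ 2 1 x) (pd φ 2 0 x - pd φ 0 2 x) (pd φ 0 1 x - pd φ 1 0 x)‖ₑ = w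
      rw [hB]
      generalize c⁻¹ * 9 * ENNReal.ofReal (576 * M) = q
      calc _ = 3 * w + 6 * q * N x := by ring
        _ ≤ 3 * w + 6 * q * N x + (6 * q * w + 3 * N x) := le_self_add
        _ = _ := by ring
    · have : vcurl U x = 0 := by
        have : ∀ i j, pd U i j x = 0 := fun i j => by rw [hpd, hζ0 x hx, hζd0 i x hx]; ring
        simp [vcurl, this, mk3_eq]
      simp [this]
  have hdiv : ∀ x, ‖vdiv U x‖ₑ ^ 3 ≤ V.indicator (fun x => B ^ 3 * (‖vcurl φ x‖ₑ + N x) ^ 3) x := by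
    intro x
    have e : vdiv U x = ∑ i, pds ζ i x * (φ x i - a i) := by
      unfold vdiv
      simp only [hpd]
      rw [Finset.sum_add_distrib, ← Finset.mul_sum, show ∑ i, pd φ i i x = 0 from h.sol x]; ring
    by_cases hx : x ∈ V
    · rw [Set.indicator_of_mem hx, ← mul_pow, e]
      gcongr
      refine (enorm_sum_le _ _).trans ((Finset.sum_le_sum fun i _ => hosc x hx i i).trans ?_)
      rw [hB]
      generalize c⁻¹ * 9 * ENNReal.ofReal (576 * M) = q
      simp only [Finset.sum_const, Finset.card_univ, Fintype.card_fin, nsmul_eq_mul, Nat.cast_ofNat]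
      calc _ ≤ 3 * (q * N x) + (3 * ‖vcurl φ x‖ₑ + 6 * q * ‖vcurl φ x‖ₑ + 3 * N x + 3 * q * N x) := le_self_add
        _ = _ := by ring
    · have : vdiv U x = 0 := by
        rw [e]; exact Finset.sum_eq_zero fun i _ => by rw [hζd0 i x hx, zero_mul]
      simp [this]
  calc _ = ∫⁻ x in Metric.ball z (dB Ω z / 8), ‖pd U k j x‖ₑ ^ 3 := by
        refine setLIntegral_congr_fun measurableSet_ball fun x hx => ?_
        have e : U =ᶠ[𝓝 x] fun y => φ y - a := by
          filter_upwards [Metric.isOpen_ball.mem_nhds hx] with y hy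
          simp [hU, hζe y hy]
        simp only [pd, e.fderiv_eq, fderiv_sub_const]
    _ ≤ ∫⁻ x, ‖pd U k j x‖ₑ ^ 3 := setLIntegral_le_lintegral _ _
    _ ≤ _ := cz_mainE hUc k j
    _ ≤ 1417176 * ((∫⁻ x, V.indicator (fun x => B ^ 3 * (‖vcurl φ x‖ₑ + N x) ^ 3) x) + ∫⁻ x, V.indicator (fun x => B ^ 3 * (‖vcurl φ x‖ₑ + N x) ^ 3) x) := by
        gcongr with x x
        · exact hcurl x
        · exact hdiv x
    _ = _ := by
        rw [lintegral_indicator measurableSet_ball, lintegral_const_mul' _ _ (by finiteness)]; ring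
end
end

section
section
variable {Ω : Set E3}

lemma rpow_neg_le4 {X d : ℝ≥0∞} (h : X ≤ 2 * d) {s : ℝ} (hs0 : 0 ≤ s) (hs1 : s ≤ 2) : d ^ (-s) ≤ 4 * X ^ (-s) := by
  have h1 := rpow_neg_le one_le_two (by simp) h (s := s/2) (by linarith) (by linarith)
  have e : ∀ y : ℝ≥0∞, y ^ (-s) = (y ^ (-(s/2))) ^ 2 := fun y => by
    rw [← ENNReal.rpow_natCast, ← ENNReal.rpow_mul]; congr 1; push_cast; ring
  rw [e, e]
  calc _ ≤ (2 * X ^ (-(s/2))) ^ 2 := by gcongr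
    _ = _ := by ring

lemma swapA (hΩ : IsLipschitzDomain Ω) {w g : E3 → ℝ≥0∞} (hw : Measurable w) (hg : Measurable g) (r : ℝ) :
    ∫⁻ z in Ω, w z * ∫⁻ x in Metric.ball z (dB Ω z / r), g x = ∫⁻ x, g x * ∫⁻ z in Ω ∩ {z | dist x z < dB Ω z / r}, w z := by
  have hA : MeasurableSet {p : E3 × E3 | dist p.2 p.1 < dB Ω p.1 / r} := by
    have := dB_cont (Ω := Ω)
    exact (isOpen_lt (by fun_prop) (by fun_prop)).measurableSet
  set A := {p : E3 × E3 | dist p.2 p.1 < dB Ω p.1 / r}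
  have hz : ∀ x, MeasurableSet {z | dist x z < dB Ω z / r} := fun x => by
    have := dB_cont (Ω := Ω)
    exact (isOpen_lt (by fun_prop) (by fun_prop)).measurableSet
  have hm : Measurable (Function.uncurry fun z x => A.indicator (fun p : E3 × E3 => w p.1 * g p.2) (z, x)) := by
    exact ((hw.comp measurable_fst).mul (hg.comp measurable_snd)).indicator hA
  calc _ = ∫⁻ z in Ω, ∫⁻ x, A.indicator (fun p : E3 × E3 => w p.1 * g p.2) (z, x) := by
        refine lintegral_congr fun z => ?_
        rw [← lintegral_const_mul _ hg, ← lintegral_indicator measurableSet_ball]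
        rfl
    _ = ∫⁻ x, ∫⁻ z in Ω, A.indicator (fun p : E3 × E3 => w p.1 * g p.2) (z, x) := lintegral_lintegral_swap hm.aemeasurable
    _ = _ := by
        refine lintegral_congr fun x => ?_
        rw [← lintegral_const_mul _ hw, Set.inter_comm, ← setLIntegral_indicator (hz x)]
        refine lintegral_congr fun z => ?_
        by_cases h : dist x z < dB Ω z / r
        · rw [Set.indicator_of_mem (show (z, x) ∈ A from h), Set.indicator_of_mem (show z ∈ {z | dist x z < dB Ω z / r} from h), mul_comm]
        · rw [Set.indicator_of_notMem (show (z, x) ∉ A from h), Set.indicator_of_notMem (show z ∉ {z | dist x z < dB Ω z / r} from h)]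

lemma vol_ball (x : E3) {r : ℝ} (hr : 0 ≤ r) : volume (Metric.ball x r) = ENNReal.ofReal r ^ 3 * volume (Metric.ball (0:E3) 1) := by
  rw [Measure.addHaar_ball _ _ hr]; simp [ENNReal.ofReal_pow hr]

lemma dE_comb (hΩ : IsLipschitzDomain Ω) {x : E3} (hx : x ∈ Ω) (α : ℝ) : dE Ω x ^ (-(3 - α)) * dE Ω x ^ 3 = dE Ω x ^ α := by
  rw [← ENNReal.rpow_natCast, ← ENNReal.rpow_add _ _ (dE_ne0 hΩ hx) (dE_neT x)]
  congr 1; push_cast; ring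

lemma dE_two {x z : E3} (h : dB Ω x ≤ 2 * dB Ω z) : dE Ω x ≤ 2 * dE Ω z := by
  unfold dE
  refine (ENNReal.ofReal_le_ofReal h).trans ?_
  rw [ENNReal.ofReal_mul (by norm_num)]; simp

lemma F1 (hΩ : IsLipschitzDomain Ω) {α : ℝ} (h0 : 6/5 ≤ α) (h1 : α < 3/2) {g : E3 → ℝ≥0∞} (hg : Measurable g) :
    ∫⁻ z in Ω, dE Ω z ^ (-(3 - α)) * ∫⁻ x in Metric.ball z (dB Ω z / 4), g x ≤
      4 * volume (Metric.ball (0:E3) 1) * ∫⁻ x in Ω, dE Ω x ^ α * g x := by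
  rw [swapA hΩ (dE_meas.pow_const _) hg, ← lintegral_const_mul' _ _ (by finiteness), ← lintegral_indicator hΩ.isOpen.measurableSet]
  refine lintegral_mono fun x => ?_
  by_cases hx : x ∈ Ω
  · rw [Set.indicator_of_mem hx]
    have hd := dB_pos hΩ hx
    have : ∫⁻ z in Ω ∩ {z | dist x z < dB Ω z / 4}, dE Ω z ^ (-(3 - α)) ≤ ∫⁻ z in Metric.ball x (dB Ω x), 4 * dE Ω x ^ (-(3 - α)) := by
      refine (setLIntegral_mono' (hΩ.isOpen.measurableSet.inter ?_) (g := fun _ => 4 * dE Ω x ^ (-(3 - α))) fun z hz => ?_).trans (lintegral_mono_set fun z hz => ?_)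
      · have := dB_cont (Ω := Ω)
        exact (isOpen_lt (by fun_prop) (by fun_prop)).measurableSet
      · have h3 : dist x z < dB Ω z / 4 := hz.2
        have h4 := dB_le (Ω := Ω) x z
        exact rpow_neg_le4 (dE_two (by linarith [dB_nonneg (Ω := Ω) z])) (by linarith) (by linarith)
      · have h3 : dist x z < dB Ω z / 4 := hz.2
        have h4 := dB_le (Ω := Ω) z x
        rw [Metric.mem_ball, dist_comm]
        rw [dist_comm z x] at h4
        linarith
    calc _ ≤ g x * ∫⁻ z in Metric.ball x (dB Ω x), 4 * dE Ω x ^ (-(3 - α)) := by gcongr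
      _ = 4 * volume (Metric.ball (0:E3) 1) * ((dE Ω x ^ (-(3 - α)) * dE Ω x ^ 3) * g x) := by
          rw [setLIntegral_const, vol_ball x hd.le, dE]; ring
      _ = _ := by rw [dE_comb hΩ hx]
  · have : Ω ∩ {z | dist x z < dB Ω z / 4} = ∅ := by
      ext z
      simp only [Set.mem_inter_iff, Set.mem_ofPred_eq, Set.mem_empty_iff_false, iff_false, not_and]
      intro hz h
      exact hx (ball_sub_Om hΩ hz (by linarith [dB_pos hΩ hz]))
    simp [this]

lemma F2 (hΩ : IsLipschitzDomain Ω) {α : ℝ} (h0 : 6/5 ≤ α) (h1 : α < 3/2) {g : E3 → ℝ≥0∞} (hg : Measurable g) :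
    volume (Metric.ball (0:E3) 1) * (ENNReal.ofReal (1/16)) ^ 3 * ∫⁻ x in Ω, dE Ω x ^ α * g x ≤
      4 * ∫⁻ z in Ω, dE Ω z ^ (-(3 - α)) * ∫⁻ x in Metric.ball z (dB Ω z / 8), g x := by
  rw [swapA hΩ (dE_meas.pow_const _) hg, ← lintegral_const_mul' _ _ (by finiteness), ← lintegral_const_mul' _ _ (by finiteness), ← lintegral_indicator hΩ.isOpen.measurableSet]
  refine lintegral_mono fun x => ?_
  by_cases hx : x ∈ Ω
  · rw [Set.indicator_of_mem hx]
    have hd := dB_pos hΩ hx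
    have : ∫⁻ z in Metric.ball x (1/16 * dB Ω x), dE Ω x ^ (-(3 - α)) ≤ 4 * ∫⁻ z in Ω ∩ {z | dist x z < dB Ω z / 8}, dE Ω z ^ (-(3 - α)) := by
      rw [← lintegral_const_mul' _ _ (by simp)]
      refine (setLIntegral_mono' measurableSet_ball (g := fun z => 4 * dE Ω z ^ (-(3 - α))) fun z hz => ?_).trans (lintegral_mono_set fun z hz => ?_)
      · have h3 : dist z x < 1/16 * dB Ω x := hz
        have h4 := dB_le (Ω := Ω) z x
        exact rpow_neg_le4 (dE_two (by linarith)) (by linarith) (by linarith)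
      · have h3 : dist z x < 1/16 * dB Ω x := hz
        have h4 := dB_le (Ω := Ω) x z
        rw [dist_comm] at h4
        refine ⟨ball_sub_Om hΩ hx (by linarith), ?_⟩
        rw [Set.mem_ofPred_eq, dist_comm]
        linarith
    rw [setLIntegral_const, vol_ball x (by positivity), ENNReal.ofReal_mul (by norm_num)] at this
    calc _ = g x * (dE Ω x ^ (-(3 - α)) * ((ENNReal.ofReal (1/16) * ENNReal.ofReal (dB Ω x)) ^ 3 * volume (Metric.ball (0:E3) 1))) := by
          rw [← dE_comb hΩ hx, dE]; ring
      _ ≤ _ := mul_le_mul_right this _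
      _ = _ := by ring
  · simp [hx]

/-- weighted div-curl estimate -/
lemma WCZ (hΩ : IsLipschitzDomain Ω) {α : ℝ} (h0 : 6/5 ≤ α) (h1 : α < 3/2) :
    ∃ C : ℝ≥0∞, C ≠ ⊤ ∧ ∀ φ, IsTestSol Ω φ → ∀ k j,
      ∫⁻ x in Ω, dE Ω x ^ α * ‖pd φ k j x‖ₑ ^ 3 ≤ C * ∫⁻ x in Ω, dE Ω x ^ α * ‖vcurl φ x‖ₑ ^ 3 := by
  obtain ⟨C1, hC1, H1⟩ := loc_est hΩ
  obtain ⟨C2, hC2, H2⟩ := P1 hΩ h0 h1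
  set v := volume (Metric.ball (0:E3) 1)
  set b := v * (ENNReal.ofReal (1/16)) ^ 3 with hb
  have hv0 : v ≠ 0 := (Metric.measure_ball_pos _ _ one_pos).ne'
  have hvT : v ≠ ⊤ := measure_ball_lt_top.ne
  have hb0 : b ≠ 0 := mul_ne_zero hv0 (pow_ne_zero _ (by simp))
  have hbT : b ≠ ⊤ := by finiteness
  refine ⟨b⁻¹ * (4 * (C1 * (4 * v * (8 * (1 + C2))))), by finiteness, fun φ h k j => ?_⟩
  have hv := h.toIsTest.csv
  have hm : Measurable fun y => ‖vcurl φ y‖ₑ := hv.curl_cont.measurable.enorm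
  set W := ∫⁻ x in Ω, dE Ω x ^ α * ‖vcurl φ x‖ₑ ^ 3 with hW
  set N : E3 → ℝ≥0∞ := fun x => ∫⁻ y in Ω, KE Ω x y * ‖vcurl φ y‖ₑ with hN
  have hNm : Measurable N := by
    have : Measurable (Function.uncurry fun x y : E3 => KE Ω x y * ‖vcurl φ y‖ₑ) := KE_meas.mul (hm.comp measurable_snd)
    exact this.lintegral_prod_right'
  have hg : Measurable fun x => ‖pd φ k j x‖ₑ ^ 3 := (hv.pd k j).cont.measurable.enorm.pow_const 3
  have hg2 : Measurable fun x => (‖vcurl φ x‖ₑ + N x) ^ 3 := (hm.add hNm).pow_const 3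
  have s1 := F2 hΩ h0 h1 hg
  have s2 := F1 hΩ h0 h1 hg2
  have s3 : ∫⁻ x in Ω, dE Ω x ^ α * (‖vcurl φ x‖ₑ + N x) ^ 3 ≤ 8 * (1 + C2) * W := by
    calc _ ≤ ∫⁻ x in Ω, 8 * (dE Ω x ^ α * ‖vcurl φ x‖ₑ ^ 3 + dE Ω x ^ α * N x ^ 3) := by
          refine lintegral_mono fun x => ?_
          refine (mul_le_mul_right (cube_add _ _) _).trans (le_of_eq ?_); ring
      _ = 8 * (W + ∫⁻ x in Ω, dE Ω x ^ α * N x ^ 3) := by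
          have m1 : Measurable fun x => dE Ω x ^ α * ‖vcurl φ x‖ₑ ^ 3 := (dE_meas.pow_const _).mul (hm.pow_const _)
          rw [lintegral_const_mul' _ _ (by simp), lintegral_add_left m1]
      _ ≤ 8 * (W + C2 * W) := by gcongr; exact H2 _ hm
      _ = _ := by ring
  have s4 : ∫⁻ z in Ω, dE Ω z ^ (-(3 - α)) * ∫⁻ x in Metric.ball z (dB Ω z / 8), ‖pd φ k j x‖ₑ ^ 3 ≤
      C1 * ∫⁻ z in Ω, dE Ω z ^ (-(3 - α)) * ∫⁻ x in Metric.ball z (dB Ω z / 4), (‖vcurl φ x‖ₑ + N x) ^ 3 := by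
    rw [← lintegral_const_mul' _ _ hC1]
    refine setLIntegral_mono' hΩ.isOpen.measurableSet fun z hz => ?_
    refine (mul_le_mul_right (H1 φ h z hz k j) _).trans (le_of_eq ?_); ring
  have s5 : b * ∫⁻ x in Ω, dE Ω x ^ α * ‖pd φ k j x‖ₑ ^ 3 ≤ 4 * (C1 * (4 * v * (8 * (1 + C2) * W))) := by
    refine s1.trans ?_
    gcongr
    refine s4.trans ?_
    gcongr
    refine s2.trans ?_
    gcongr
  calc _ = b⁻¹ * (b * ∫⁻ x in Ω, dE Ω x ^ α * ‖pd φ k j x‖ₑ ^ 3) := by rw [← mul_assoc, ENNReal.inv_mul_cancel hb0 hbT, one_mul]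
    _ ≤ b⁻¹ * (4 * (C1 * (4 * v * (8 * (1 + C2) * W)))) := by gcongr
    _ = _ := by ring
end
end

section
section Brouwer
set_option linter.unusedSectionVars false
variable {E : Type*} [NormedAddCommGroup E] [InnerProductSpace ℝ E] [FiniteDimensional ℝ E]
  [MeasurableSpace E] [BorelSpace E]

lemma brw_vol_pos : (0:ℝ) < (volume (Metric.ball (0:E) 1)).toReal :=
  ENNReal.toReal_pos (Metric.measure_ball_pos volume (0:E) one_pos).ne' measure_ball_lt_top.ne

lemma brw_small : ∃ δ : ℝ, 0 < δ ∧ ∀ A : E →L[ℝ] E, ‖A‖ < δ →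
    0 < (ContinuousLinearMap.id ℝ E + A).det := by
  have hc : Continuous (fun A : E →L[ℝ] E => (ContinuousLinearMap.id ℝ E + A).det) :=
    ContinuousLinearMap.continuous_det.comp (continuous_const.add continuous_id)
  have h0 : (0:ℝ) < (ContinuousLinearMap.id ℝ E + (0 : E →L[ℝ] E)).det := by
    simp [ContinuousLinearMap.det]
  have := (hc.tendsto 0).eventually (lt_mem_nhds h0)
  rcases Metric.eventually_nhds_iff.1 this with ⟨δ, hδ, h⟩
  exact ⟨δ, hδ, fun A hA => h (by simpa using hA)⟩

lemma brw_B1 (g : E → E) (L : ℝ≥0) (hL : LipschitzWith L g)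
    (hout : ∀ x, x ∉ Metric.ball (0:E) 1 → g x = 0)
    (hd : ∀ x ∈ Metric.ball (0:E) 1, DifferentiableAt ℝ g x) :
    ∃ τ : ℝ, 0 < τ ∧ ∀ t : ℝ, 0 < t → t ≤ τ →
      ∫ x in Metric.ball (0:E) 1, (ContinuousLinearMap.id ℝ E + t • fderiv ℝ g x).det
        = (volume (Metric.ball (0:E) 1)).toReal := by
  obtain ⟨δ, hδ, hdet⟩ := brw_small (E := E)
  set m := min δ 1 with hm
  have hm0 : 0 < m := lt_min hδ one_pos
  refine ⟨m / (2 * (L + 1)), by positivity, fun t ht htle => ?_⟩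
  have hLp : (0:ℝ) ≤ L := L.2
  have htL : t * L < m := by
    have h1 : t * (2 * (L + 1)) ≤ m := by rwa [le_div_iff₀ (by positivity)] at htle
    nlinarith
  have htL1 : t * L < 1 := lt_of_lt_of_le htL (min_le_right _ _)
  have htLd : t * L < δ := lt_of_lt_of_le htL (min_le_left _ _)
  set f : E → E := fun x => x + t • g x with hf
  have happ : ApproximatesLinearOn f ((ContinuousLinearEquiv.refl ℝ E : E ≃L[ℝ] E) : E →L[ℝ] E)
      Set.univ (Real.toNNReal t * L) := by
    intro x _ y _
    have : f x - f y - ((ContinuousLinearEquiv.refl ℝ E : E ≃L[ℝ] E) : E →L[ℝ] E) (x - y)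
        = t • (g x - g y) := by
      simp [hf, smul_sub]; abel
    rw [this, norm_smul, Real.norm_eq_abs, abs_of_pos ht]
    have := hL.dist_le_mul x y
    rw [dist_eq_norm, dist_eq_norm] at this
    push_cast
    rw [Real.coe_toNNReal _ ht.le, mul_assoc]
    gcongr
  have hcN : Subsingleton E ∨ Real.toNNReal t * L <
      ‖((ContinuousLinearEquiv.refl ℝ E).symm : E →L[ℝ] E)‖₊⁻¹ := by
    rcases subsingleton_or_nontrivial E with h | h
    · exact Or.inl h
    · right
      have : ‖((ContinuousLinearEquiv.refl ℝ E).symm : E →L[ℝ] E)‖₊ = 1 := by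
        ext; simpa using ContinuousLinearMap.norm_id (𝕜 := ℝ) (E := E)
      rw [this, inv_one, ← NNReal.coe_lt_coe]
      push_cast
      rw [Real.coe_toNNReal _ ht.le]; exact htL1
  have hinj : Function.Injective f := Set.injOn_univ.1 (happ.injOn hcN)
  have hsurj : Function.Surjective f := happ.surjective hcN
  have himg : f '' Metric.ball (0:E) 1 = Metric.ball (0:E) 1 := by
    ext y
    constructor
    · rintro ⟨x, hx, rfl⟩
      by_contra hy
      have : f (f x) = f x := by simp [hf] ; right; simpa [hf] using hout _ hy
      have := hinj this
      rw [this] at hy; exact hy hx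
    · intro hy
      obtain ⟨x, rfl⟩ := hsurj y
      refine ⟨x, ?_, rfl⟩
      by_contra hx
      have : f x = x := by simp [hf, hout x hx]
      rw [this] at hy; exact hx hy
  have hder : ∀ x ∈ Metric.ball (0:E) 1, HasFDerivWithinAt f
      (ContinuousLinearMap.id ℝ E + t • fderiv ℝ g x) (Metric.ball (0:E) 1) x := by
    intro x hx
    exact ((hasFDerivAt_id x).add ((hd x hx).hasFDerivAt.const_smul t)).hasFDerivWithinAt
  have key := integral_image_eq_integral_abs_det_fderiv_smul (volume : Measure E)
    measurableSet_ball hder hinj.injOn (fun _ => (1:ℝ))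
  rw [himg] at key
  have e1 : ∫ x in Metric.ball (0:E) 1, (1:ℝ) = (volume (Metric.ball (0:E) 1)).toReal := by
    simp [Measure.real]
  rw [← e1, key]
  refine setIntegral_congr_fun measurableSet_ball fun x hx => ?_
  have : 0 < (ContinuousLinearMap.id ℝ E + t • fderiv ℝ g x).det := by
    apply hdet
    rw [norm_smul, Real.norm_eq_abs, abs_of_pos ht]
    refine lt_of_le_of_lt ?_ htLd
    gcongr
    exact norm_fderiv_le_of_lipschitz ℝ hL
  simp [abs_of_pos this]

lemma brw_interp (τ : ℝ) (hτ : 0 < τ) : ∃ (N : ℕ) (c s : Fin N → ℝ),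
    (∑ j, c j = 1) ∧ (∀ j, 0 < s j ∧ s j ≤ τ) ∧ ∀ A : E →L[ℝ] E,
      (ContinuousLinearMap.id ℝ E + A).det
        = ∑ j, c j * (ContinuousLinearMap.id ℝ E + s j • A).det := by
  classical
  set n := Module.finrank ℝ E with hn
  set v : Fin (n+1) → ℝ := fun j => τ * ((j:ℕ) + 1) / (n + 1) with hv
  have hvinj : Function.Injective v := by
    intro i j hij
    simp only [hv] at hij
    have h1 : (0:ℝ) < n + 1 := by positivity
    rw [div_left_inj' h1.ne'] at hij
    have := mul_left_cancel₀ hτ.ne' hij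
    have : (i:ℕ) = (j:ℕ) := by exact_mod_cast (add_right_cancel this)
    exact Fin.ext this
  refine ⟨n+1, fun j => (Lagrange.basis Finset.univ v j).eval 1, v, ?_, ?_, ?_⟩
  · have := Lagrange.sum_basis (s := Finset.univ) (v := v) hvinj.injOn Finset.univ_nonempty
    have h2 := congrArg (Polynomial.eval (1:ℝ)) this
    rw [Polynomial.eval_finsetSum] at h2
    simpa using h2
  · intro j
    simp only [hv]
    refine ⟨by positivity, ?_⟩
    rw [div_le_iff₀ (by positivity)]
    have : ((j:ℕ):ℝ) ≤ n := by exact_mod_cast Nat.lt_succ_iff.1 j.2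
    nlinarith
  · intro A
    set b := Module.finBasis ℝ E
    set M := LinearMap.toMatrix b b (A : E →ₗ[ℝ] E) with hM
    set p : Polynomial ℝ := Matrix.det ((Polynomial.X : Polynomial ℝ) • M.map Polynomial.C
      + (1 : Matrix _ _ ℝ).map Polynomial.C) with hp
    have hpe : ∀ t : ℝ, p.eval t = (ContinuousLinearMap.id ℝ E + t • A).det := by
      intro t
      rw [ContinuousLinearMap.det, ← LinearMap.det_toMatrix b]
      have : LinearMap.toMatrix b b ((ContinuousLinearMap.id ℝ E + t • A : E →L[ℝ] E) : E →ₗ[ℝ] E)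
          = 1 + t • M := by
        rw [hM]
        simp [LinearMap.toMatrix_id]
      rw [this, hp, ← Polynomial.coe_evalRingHom, RingHom.map_det]
      congr 1
      ext i j
      simp [Matrix.map_apply, Matrix.one_apply, add_comm]
      split_ifs <;> simp [mul_comm]
    have hdeg : p.degree < (Finset.univ : Finset (Fin (n+1))).card := by
      refine lt_of_le_of_lt Polynomial.degree_le_natDegree ?_
      have := Polynomial.natDegree_det_X_add_C_le M 1
      rw [Fintype.card_fin] at this
      simp only [Finset.card_univ, Fintype.card_fin]
      exact_mod_cast Nat.lt_succ_of_le this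
    have := Lagrange.eq_interpolate (s := Finset.univ) (v := v) hvinj.injOn hdeg
    have h2 := congrArg (Polynomial.eval (1:ℝ)) this
    rw [Lagrange.interpolate_apply, Polynomial.eval_finsetSum, hpe, one_smul] at h2
    rw [h2]
    refine Finset.sum_congr rfl fun j _ => ?_
    rw [Polynomial.eval_mul, Polynomial.eval_C, hpe]; ring

lemma brw_B2 (g : E → E) (L : ℝ≥0) (hL : LipschitzWith L g)
    (hout : ∀ x, x ∉ Metric.ball (0:E) 1 → g x = 0)
    (hd : ∀ x ∈ Metric.ball (0:E) 1, DifferentiableAt ℝ g x) :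
      ∫ x in Metric.ball (0:E) 1, (ContinuousLinearMap.id ℝ E + fderiv ℝ g x).det
        = (volume (Metric.ball (0:E) 1)).toReal := by
  obtain ⟨τ, hτ, h⟩ := brw_B1 g L hL hout hd
  obtain ⟨N, c, s, hc, hs, hA⟩ := brw_interp (E := E) τ hτ
  have hAA : (fun x => (ContinuousLinearMap.id ℝ E + fderiv ℝ g x).det) = fun x => ∑ j, c j * (ContinuousLinearMap.id ℝ E + s j • fderiv ℝ g x).det := funext fun x => hA _
  rw [hAA, integral_finsetSum]
  · simp_rw [integral_const_mul]
    calc _ = ∑ j, c j * (volume (Metric.ball (0:E) 1)).toReal :=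
          Finset.sum_congr rfl fun j _ => by rw [h _ (hs j).1 (hs j).2]
      _ = _ := by rw [← Finset.sum_mul, hc, one_mul]
  · intro j _
    apply Integrable.const_mul
    by_contra hni
    have := h _ (hs j).1 (hs j).2
    rw [integral_undef hni] at this
    exact brw_vol_pos.ne this

/-- No `C¹` retraction. -/
lemma brw_noretract (r : E → E) (hr : ∀ x ∈ Metric.closedBall (0:E) 1, ContDiffAt ℝ 1 r x)
    (h1 : ∀ x ∈ Metric.closedBall (0:E) 1, ‖r x‖ = 1)
    (h2 : ∀ x, ‖x‖ = 1 → r x = x) : False := by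
  classical
  have hcd : ContDiffOn ℝ 1 (fun x => r x - x) (Metric.closedBall (0:E) 1) := fun x hx =>
    ((hr x hx).sub contDiffAt_id).contDiffWithinAt
  obtain ⟨K, hK⟩ : ∃ K, LipschitzOnWith K (fun x => r x - x) (Metric.closedBall (0:E) 1) := by
    apply LocallyLipschitzOn.exists_lipschitzOnWith_of_compact (isCompact_closedBall _ _)
    intro x hx
    have := ((hr x hx).sub contDiffAt_id).exists_lipschitzOnWith
    obtain ⟨K, t, ht, hK⟩ := this
    exact ⟨K, t, mem_nhdsWithin_of_mem_nhds ht, hK⟩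
  set g : E → E := fun x => if x ∈ Metric.ball (0:E) 1 then r x - x else 0 with hg
  have hgcl : ∀ x ∈ Metric.closedBall (0:E) 1, g x = r x - x := by
    intro x hx
    by_cases hb : x ∈ Metric.ball (0:E) 1
    · simp only [hg, if_pos hb]
    · simp only [hg, if_neg hb]
      have : ‖x‖ = 1 := by
        simp at hx hb; linarith
      rw [h2 x this, sub_self]
  have hgout : ∀ x, x ∉ Metric.ball (0:E) 1 → g x = 0 := fun x hx => by simp only [hg, if_neg hx]
  -- global Lipschitz
  have hmix : ∀ x ∈ Metric.ball (0:E) 1, ∀ y, y ∉ Metric.ball (0:E) 1 →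
      dist (g x) (g y) ≤ K * dist x y := by
    intro x hx y hy
    simp only [Metric.mem_ball, dist_zero_right, not_lt] at hx hy
    -- point on segment with norm one
    have hcont : Continuous (fun t : ℝ => ‖AffineMap.lineMap x y t‖) := by
      exact (AffineMap.lineMap_continuous (R := ℝ)).norm
    obtain ⟨t, ht, hzt⟩ : ∃ t ∈ Set.Icc (0:ℝ) 1, ‖AffineMap.lineMap x y t‖ = 1 := by
      have := intermediate_value_Icc (zero_le_one (α := ℝ)) hcont.continuousOn
      exact this ⟨by simpa using hx.le, by simpa using hy⟩
    set z : E := AffineMap.lineMap x y t with hz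
    have hxz : dist x z ≤ dist x y := by
      rw [hz, dist_left_lineMap]
      have : ‖t‖ ≤ 1 := by rw [Real.norm_eq_abs, abs_of_nonneg ht.1]; exact ht.2
      calc _ ≤ 1 * dist x y := by gcongr
        _ = _ := one_mul _
    have hgz : g z = 0 := hgout z (by simp [hzt])
    have hgy : g y = 0 := hgout y (by simpa using hy)
    rw [hgy, ← hgz, hgcl x (by simpa using hx.le), hgcl z (by simp [hzt])]
    refine (hK.dist_le_mul x (by simpa using hx.le) z (by simp [hzt])).trans ?_
    gcongr
  have hgL : LipschitzWith K g := by
    apply LipschitzWith.of_dist_le_mul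
    intro x y
    by_cases hx : x ∈ Metric.ball (0:E) 1 <;> by_cases hy : y ∈ Metric.ball (0:E) 1
    · rw [hgcl x (Metric.ball_subset_closedBall hx), hgcl y (Metric.ball_subset_closedBall hy)]
      exact hK.dist_le_mul x (Metric.ball_subset_closedBall hx) y (Metric.ball_subset_closedBall hy)
    · exact hmix x hx y hy
    · rw [dist_comm, dist_comm x y]; exact hmix y hy x hx
    · rw [hgout x hx, hgout y hy]; simp; positivity
  have hgd : ∀ x ∈ Metric.ball (0:E) 1, HasFDerivAt g (fderiv ℝ r x - ContinuousLinearMap.id ℝ E) x := by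
    intro x hx
    have h3 : HasFDerivAt (fun x => r x - x) (fderiv ℝ r x - ContinuousLinearMap.id ℝ E) x :=
      ((hr x (Metric.ball_subset_closedBall hx)).differentiableAt one_ne_zero).hasFDerivAt.sub
        (hasFDerivAt_id x)
    refine h3.congr_of_eventuallyEq ?_
    filter_upwards [Metric.isOpen_ball.mem_nhds hx] with y hy
    exact hgcl y (Metric.ball_subset_closedBall hy)
  have := brw_B2 g K hgL hgout (fun x hx => (hgd x hx).differentiableAt)
  have hz : ∫ x in Metric.ball (0:E) 1, (ContinuousLinearMap.id ℝ E + fderiv ℝ g x).det = 0 := by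
    rw [← integral_zero (α := E) (G := ℝ) (μ := volume.restrict (Metric.ball (0:E) 1))]
    refine setIntegral_congr_fun measurableSet_ball fun x hx => ?_
    beta_reduce
    rw [(hgd x hx).fderiv, add_sub_cancel]
    have hxc := Metric.ball_subset_closedBall hx
    have hrd : HasFDerivAt r (fderiv ℝ r x) x :=
      ((hr x hxc).differentiableAt one_ne_zero).hasFDerivAt
    have hsq : HasFDerivAt (fun y => inner ℝ (r y) (r y)) (0 : E →L[ℝ] ℝ) x := by
      have : HasFDerivAt (fun _ : E => (1:ℝ)) (0 : E →L[ℝ] ℝ) x := hasFDerivAt_const _ _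
      refine this.congr_of_eventuallyEq ?_
      filter_upwards [Metric.isOpen_ball.mem_nhds hx] with y hy
      rw [real_inner_self_eq_norm_sq, h1 y (Metric.ball_subset_closedBall hy)]; norm_num
    have hort : ∀ w, inner ℝ (r x) (fderiv ℝ r x w) = 0 := by
      intro w
      have h4 := (hrd.inner ℝ hrd).unique hsq
      have h5 := congrArg (fun L : E →L[ℝ] ℝ => L w) h4
      simp [fderivInnerCLM_apply] at h5
      rw [real_inner_comm] at h5
      have h6 := real_inner_comm (r x) (fderiv ℝ r x w)
      linarith
    rw [ContinuousLinearMap.det]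
    by_contra hne
    have hu : IsUnit (LinearMap.det (fderiv ℝ r x : E →ₗ[ℝ] E)) := isUnit_iff_ne_zero.2 hne
    have hs : Function.Surjective (fderiv ℝ r x : E →ₗ[ℝ] E) :=
      LinearMap.range_eq_top.1 ((LinearMap.isUnit_iff_range_eq_top _).1 ((LinearMap.isUnit_iff_isUnit_det _).2 hu))
    obtain ⟨w, hw⟩ := hs (r x)
    have h7 := hort w
    rw [show fderiv ℝ r x w = r x from hw, real_inner_self_eq_norm_sq, h1 x hxc] at h7
    norm_num at h7
  rw [hz] at this
  exact brw_vol_pos.ne this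

lemma brw_zero_smooth (P : E → E) (hP : ContDiff ℝ 1 P)
    (hpos : ∀ x, ‖x‖ = 1 → 0 < inner ℝ (P x) x) : ∃ x, ‖x‖ ≤ 1 ∧ P x = 0 := by
  by_contra! hne
  set f : E → E := fun x => - (‖P x‖⁻¹ • P x) with hf
  have hfn : ∀ x ∈ Metric.closedBall (0:E) 1, ‖f x‖ = 1 := by
    intro x hx
    have := norm_ne_zero_iff.2 (hne x (by simpa using hx))
    simp only [hf, norm_neg, norm_smul, norm_inv, norm_norm]
    exact inv_mul_cancel₀ this
  have hfx : ∀ x ∈ Metric.closedBall (0:E) 1, x - f x ≠ 0 := by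
    intro x hx h0
    have hxf : x = f x := sub_eq_zero.1 h0
    have hx1 : ‖x‖ = 1 := by rw [hxf]; exact hfn x hx
    have h3 := hpos x hx1
    have : inner ℝ (P x) x = - ‖P x‖ := by
      rw [congrArg (inner ℝ (P x)) hxf]
      simp only [hf, inner_neg_right, inner_smul_right, real_inner_self_eq_norm_sq]
      have := norm_ne_zero_iff.2 (hne x (by simpa using hx))
      field_simp
    have := norm_nonneg (P x)
    linarith
  set μ : E → ℝ := fun x => 2 * (1 - inner ℝ (f x) x) / ‖x - f x‖ ^ 2 with hμ
  refine brw_noretract (fun x => f x + μ x • (x - f x)) ?_ ?_ ?_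
  · intro x hx
    have hPx := hne x (by simpa using hx)
    have hPc : ContDiffAt ℝ 1 P x := hP.contDiffAt
    have hfc : ContDiffAt ℝ 1 f x :=
      (((hPc.norm ℝ hPx).inv (norm_ne_zero_iff.2 hPx)).smul hPc).neg
    have hsub : ContDiffAt ℝ 1 (fun x => x - f x) x := contDiffAt_id.sub hfc
    have hμc : ContDiffAt ℝ 1 μ x :=
      ContDiffAt.div (contDiffAt_const.mul (contDiffAt_const.sub (hfc.inner ℝ contDiffAt_id)))
        (hsub.norm_sq ℝ) (by have := norm_ne_zero_iff.2 (hfx x hx); positivity)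
    exact hfc.add (hμc.smul hsub)
  · intro x hx
    have h1 := hfn x hx
    have h2 := norm_ne_zero_iff.2 (hfx x hx)
    have : ‖f x + μ x • (x - f x)‖ ^ 2 = 1 := by
      rw [norm_add_sq_real, inner_smul_right, norm_smul, mul_pow, Real.norm_eq_abs, sq_abs, h1,
        inner_sub_right, real_inner_self_eq_norm_sq, h1]
      simp only [hμ]
      field_simp
      ring
    have h3 : 0 ≤ ‖f x + μ x • (x - f x)‖ := norm_nonneg _
    nlinarith
  · intro x hx
    have hxc : x ∈ Metric.closedBall (0:E) 1 := by simp [hx]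
    have h1 := hfn x hxc
    have h2 := norm_ne_zero_iff.2 (hfx x hxc)
    have : μ x = 1 := by
      simp only [hμ]
      rw [div_eq_one_iff_eq (by positivity), norm_sub_sq_real, h1, hx, real_inner_comm]
      ring
    simp [this]

/-- Zero of a continuous vector field which points outward on the unit sphere. -/
lemma brw_zero (P : E → E) (hP : Continuous P)
    (hpos : ∀ x, ‖x‖ = 1 → 0 ≤ inner ℝ (P x) x) : ∃ x, ‖x‖ ≤ 1 ∧ P x = 0 := by
  have hk : ∀ k : ℕ, ∃ x, ‖x‖ ≤ 1 ∧ ‖P x‖ ≤ 3 * (1 / ((k:ℝ) + 1)) := by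
    intro k
    set ε : ℝ := 1 / ((k:ℝ) + 1) with hε
    have hεp : 0 < ε := by positivity
    obtain ⟨Q, hQ, hQd, -⟩ := hP.exists_contDiff_approx 1 (ε := fun _ => ε) continuous_const
      (fun _ => hεp)
    obtain ⟨x, hx, hx0⟩ := brw_zero_smooth (fun x => Q x + (2 * ε) • x)
      (by exact (hQ.of_le (by norm_num)).add (contDiff_id.const_smul (2 * ε))) (by
        intro x hx
        rw [inner_add_left, inner_smul_left, real_inner_self_eq_norm_sq, hx]
        have h1 := hpos x hx
        have h2 : |inner ℝ (Q x - P x) x| ≤ ε := by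
          refine (abs_real_inner_le_norm _ _).trans ?_
          rw [hx, mul_one, ← dist_eq_norm]
          exact (hQd x).le
        rw [inner_sub_left] at h2
        have := abs_le.1 h2
        simp
        linarith)
    refine ⟨x, hx, ?_⟩
    have e : P x = (P x - Q x) - (2 * ε) • x := by
      have : Q x = - ((2 * ε) • x) := eq_neg_of_add_eq_zero_left hx0
      rw [this]; abel
    rw [e]
    refine (norm_sub_le _ _).trans ?_
    rw [← dist_eq_norm, dist_comm, norm_smul, Real.norm_eq_abs, abs_of_pos (by positivity)]
    have := (hQd x).le
    nlinarith
  choose x hx hPx using hk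
  obtain ⟨y, hy, φ, hφ, hlim⟩ := (isCompact_closedBall (0:E) 1).tendsto_subseq
    (x := x) (fun k => by simpa using hx k)
  refine ⟨y, by simpa using hy, ?_⟩
  have h1 : Tendsto (fun k => ‖P (x (φ k))‖) atTop (𝓝 ‖P y‖) :=
    ((hP.tendsto y).comp hlim).norm
  have h2 : Tendsto (fun k => ‖P (x (φ k))‖) atTop (𝓝 0) := by
    refine squeeze_zero (fun _ => norm_nonneg _) (fun k => hPx (φ k)) ?_
    have := (tendsto_one_div_add_atTop_nhds_zero_nat (𝕜 := ℝ)).const_mul 3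
    rw [mul_zero] at this
    exact this.comp hφ.tendsto_atTop
  exact norm_eq_zero.1 (tendsto_nhds_unique h1 h2)

end Brouwer
end

section
section Abst
variable {X : Type*} [NormedAddCommGroup X] [NormedSpace ℝ X]

lemma abs_weak_lim [CompleteSpace X]
    (hCl : ∀ a b : X, ‖(1/2:ℝ) • (a + b)‖ ^ 3 + ‖(1/2:ℝ) • (a - b)‖ ^ 3 ≤ (‖a‖ ^ 3 + ‖b‖ ^ 3) / 2)
    {ι : Type*} (U : Ultrafilter ι) (x : ι → X) (M : ℝ) (hM : ∀ i, ‖x i‖ ≤ M) :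
    ∃ x0 : X, ∀ ℓ : X →L[ℝ] ℝ, Tendsto (fun i => ℓ (x i)) U (𝓝 (ℓ x0)) := by
  classical
  set C : Set ι → Set X := fun S => closure (convexHull ℝ (x '' S)) with hC
  have hCmono : ∀ S T, S ⊆ T → C S ⊆ C T := fun S T h =>
    closure_mono (convexHull_mono (Set.image_mono h))
  have hCne : ∀ S ∈ U, (C S).Nonempty := by
    intro S hS
    obtain ⟨i, hi⟩ := U.nonempty_of_mem hS
    exact ⟨x i, subset_closure (subset_convexHull ℝ _ ⟨i, hi, rfl⟩)⟩
  have hCconv : ∀ S, Convex ℝ (C S) := fun S => (convex_convexHull ℝ _).closure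
  set m : Set ι → ℝ := fun S => sInf ((fun y : X => ‖y‖) '' C S) with hm
  have hbdd : ∀ S, BddBelow ((fun y : X => ‖y‖) '' C S) := fun S =>
    ⟨0, by rintro _ ⟨y, -, rfl⟩; exact norm_nonneg y⟩
  have hmle : ∀ S, ∀ y ∈ C S, m S ≤ ‖y‖ := fun S y hy => csInf_le (hbdd S) ⟨y, hy, rfl⟩
  have hm0 : ∀ S, 0 ≤ m S := fun S => Real.sInf_nonneg (by rintro _ ⟨y, -, rfl⟩; exact norm_nonneg y)
  have hmM : ∀ S ∈ U, m S ≤ M := by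
    intro S hS
    obtain ⟨i, hi⟩ := U.nonempty_of_mem hS
    exact (hmle S (x i) (subset_closure (subset_convexHull ℝ _ ⟨i, hi, rfl⟩))).trans (hM i)
  set I : Set ℝ := m '' {S | S ∈ U} with hI
  have hIb : BddAbove I := ⟨M, by rintro _ ⟨S, hS, rfl⟩; exact hmM S hS⟩
  have hIne : I.Nonempty := ⟨_, Set.univ, univ_mem, rfl⟩
  set m1 := sSup I with hm1
  have hle1 : ∀ S ∈ U, m S ≤ m1 := fun S hS => le_csSup hIb ⟨S, hS, rfl⟩
  have hm10 : 0 ≤ m1 := (hm0 Set.univ).trans (hle1 _ univ_mem)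
  set D : Set ι → ℝ → Set X := fun S ε => {y ∈ C S | ‖y‖ ^ 3 < m1 ^ 3 + ε} with hD
  have hDne : ∀ S ∈ U, ∀ ε > 0, (D S ε).Nonempty := by
    intro S hS ε hε
    have hcont : Tendsto (fun t : ℝ => t ^ 3) (𝓝 m1) (𝓝 (m1 ^ 3)) := (continuous_pow 3).tendsto m1
    obtain ⟨δ, hδ, hδ'⟩ := Metric.eventually_nhds_iff.1
      (hcont.eventually (gt_mem_nhds (show m1 ^ 3 < m1 ^ 3 + ε by linarith)))
    have h1 : m S < m1 + δ / 2 := by have := hle1 S hS; linarith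
    obtain ⟨_, ⟨y, hy, rfl⟩, hy2⟩ := exists_lt_of_csInf_lt ((hCne S hS).image _) h1
    refine ⟨y, hy, ?_⟩
    have h2 : (m1 + δ/2) ^ 3 < m1 ^ 3 + ε := hδ' (by simp [abs_of_pos hδ, hδ])
    have h3 : ‖y‖ ^ 3 ≤ (m1 + δ/2)^3 := pow_le_pow_left₀ (norm_nonneg _) hy2.le 3
    linarith
  set B : FilterBasis X :=
    { sets := {d | ∃ S ∈ U, ∃ ε > 0, d = D S ε}
      nonempty := ⟨_, Set.univ, univ_mem, 1, one_pos, rfl⟩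
      inter_sets := by
        rintro _ _ ⟨S, hS, ε, hε, rfl⟩ ⟨T, hT, η, hη, rfl⟩
        refine ⟨_, ⟨S ∩ T, inter_mem hS hT, min ε η, lt_min hε hη, rfl⟩, ?_⟩
        rintro y ⟨hy, hy2⟩
        have := min_le_left ε η
        have := min_le_right ε η
        exact ⟨⟨hCmono _ _ Set.inter_subset_left hy, by linarith⟩,
          ⟨hCmono _ _ Set.inter_subset_right hy, by linarith⟩⟩ } with hB
  have hBmem : ∀ S ∈ U, ∀ ε > 0, D S ε ∈ B.filter := fun S hS ε hε =>
    B.mem_filter_iff.2 ⟨D S ε, ⟨S, hS, ε, hε, rfl⟩, subset_rfl⟩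
  have hcau : Cauchy B.filter := by
    rw [Metric.cauchy_iff]
    constructor
    · refine ⟨fun h => ?_⟩
      have : (∅ : Set X) ∈ B.filter := by rw [h]; trivial
      obtain ⟨_, ⟨S, hS, ε, hε, rfl⟩, hs⟩ := B.mem_filter_iff.1 this
      exact Set.not_nonempty_empty ((hDne S hS ε hε).mono hs)
    · intro ε hε
      set η := (ε / 2) ^ 3 / 4 with hη
      have hηp : 0 < η := by positivity
      have hcont : Tendsto (fun t : ℝ => t ^ 3) (𝓝 m1) (𝓝 (m1 ^ 3)) := (continuous_pow 3).tendsto m1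
      obtain ⟨δ, hδ, hδ'⟩ := Metric.eventually_nhds_iff.1
        (hcont.eventually (lt_mem_nhds (show m1 ^ 3 - η < m1 ^ 3 by linarith)))
      obtain ⟨_, ⟨S, hS, rfl⟩, hS2⟩ := exists_lt_of_lt_csSup hIne (show m1 - δ < sSup I by linarith)
      refine ⟨D S η, hBmem S hS η hηp, ?_⟩
      rintro a ⟨ha, ha2⟩ b ⟨hb, hb2⟩
      have h1 : m1 ^ 3 - η < (m S) ^ 3 := hδ' (by
        rw [Real.dist_eq, abs_lt]; have := hle1 S hS; constructor <;> linarith)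
      have hmid : (1/2:ℝ) • (a + b) ∈ C S := by
        have := hCconv S ha hb (show (0:ℝ) ≤ 1/2 by norm_num) (show (0:ℝ) ≤ 1/2 by norm_num)
          (by norm_num)
        rwa [← smul_add] at this
      have h2 := hmle S _ hmid
      have h3 : (m S)^3 ≤ ‖(1/2:ℝ) • (a + b)‖ ^ 3 := pow_le_pow_left₀ (hm0 S) h2 3
      have h4 := hCl a b
      have h5 : ‖(1/2:ℝ) • (a - b)‖ ^ 3 < (ε / 2) ^ 3 := by
        have : (ε / 2) ^ 3 = 4 * η := by rw [hη]; ring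
        linarith
      have h6 := lt_of_pow_lt_pow_left₀ 3 (by positivity) h5
      rw [norm_smul, ← dist_eq_norm] at h6
      norm_num at h6
      linarith
  obtain ⟨x0, hx0⟩ := CompleteSpace.complete hcau
  have hmem : ∀ S ∈ U, x0 ∈ C S := by
    intro S hS
    have : NeBot B.filter := hcau.1
    refine isClosed_closure.mem_of_frequently_of_tendsto (b := B.filter) (f := id) ?_ hx0
    refine Eventually.frequently ?_
    filter_upwards [hBmem S hS 1 one_pos] with y hy using hy.1
  refine ⟨x0, fun ℓ => ?_⟩
  have hcomp : IsCompact (Metric.closedBall (0:ℝ) (‖ℓ‖ * M)) := isCompact_closedBall _ _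
  obtain ⟨c, -, hc⟩ := hcomp.ultrafilter_le_nhds (U.map fun i => ℓ (x i)) (by
    rw [le_principal_iff]
    show (fun i => ℓ (x i)) ⁻¹' _ ∈ (U : Filter ι)
    refine mem_of_superset univ_mem ?_
    intro i _
    simp only [Set.mem_preimage, mem_closedBall_zero_iff]
    exact (ℓ.le_opNorm _).trans (mul_le_mul_of_nonneg_left (hM i) (norm_nonneg _)))
  have hc' : Tendsto (fun i => ℓ (x i)) U (𝓝 c) := hc
  have : ℓ x0 = c := by
    refine eq_of_abs_sub_le_all fun ε hε => ?_
    have hS : {i | |ℓ (x i) - c| ≤ ε} ∈ U := by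
      have := hc' (Metric.closedBall_mem_nhds c hε)
      filter_upwards [this] with i hi
      simpa [Real.dist_eq] using hi
    have h1 := hmem _ hS
    have h2 : C {i | |ℓ (x i) - c| ≤ ε} ⊆ ℓ ⁻¹' (Metric.closedBall c ε) := by
      refine closure_minimal (convexHull_min ?_ ?_) (Metric.isClosed_closedBall.preimage ℓ.continuous)
      · rintro _ ⟨i, hi, rfl⟩
        simpa [Real.dist_eq] using hi
      · exact (convex_closedBall c ε).linear_preimage ℓ.toLinearMap
    simpa [Real.dist_eq] using h2 h1
  rw [this]; exact hc'

/-- Galerkin step. -/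
lemma abs_galerkin (T : X → X →L[ℝ] ℝ) (hT : Continuous T) (r0 : ℝ) (hr0 : 0 < r0)
    (hpos : ∀ x, r0 ≤ ‖x‖ → 0 ≤ T x x) (V : Submodule ℝ X) [FiniteDimensional ℝ V] :
    ∃ x ∈ V, ∀ h ∈ V, T x h = 0 := by
  set n := Module.finrank ℝ V with hn
  have e : EuclideanSpace ℝ (Fin n) ≃L[ℝ] V :=
    ContinuousLinearEquiv.ofFinrankEq (by simp [hn])
  set R : ℝ := r0 * (‖(e.symm : V →L[ℝ] EuclideanSpace ℝ (Fin n))‖ + 1) with hR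
  have hRp : 0 < R := by positivity
  set x : EuclideanSpace ℝ (Fin n) → X := fun z => R • (e z : X) with hx
  have hxc : Continuous x := (continuous_subtype_val.comp e.continuous).const_smul R
  set P : EuclideanSpace ℝ (Fin n) → EuclideanSpace ℝ (Fin n) := fun z =>
    WithLp.toLp 2 fun i => T (x z) (e (EuclideanSpace.single i 1) : X) with hP
  have hPc : Continuous P := by
    refine (PiLp.continuous_toLp 2 _).comp (continuous_pi fun i => ?_)
    exact (hT.comp hxc).clm_apply continuous_const
  have hinner : ∀ z w, inner ℝ (P z) w = T (x z) (e w : X) := by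
    intro z w
    have hw : w = ∑ i, w i • EuclideanSpace.single i (1:ℝ) := by
      ext j
      simp [Finset.sum_apply, Pi.single_apply]
    conv_rhs => rw [hw]
    rw [map_sum, Submodule.coe_sum, map_sum, PiLp.inner_apply]
    refine Finset.sum_congr rfl fun i _ => ?_
    rw [map_smul, Submodule.coe_smul, map_smul, smul_eq_mul]
    simp [hP]
  obtain ⟨z, hz, hz0⟩ := brw_zero P hPc (by
    intro z hz
    rw [hinner]
    have h1 : r0 ≤ ‖x z‖ := by
      have h2 : ‖z‖ ≤ ‖(e.symm : V →L[ℝ] EuclideanSpace ℝ (Fin n))‖ * ‖e z‖ := by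
        have := (e.symm : V →L[ℝ] EuclideanSpace ℝ (Fin n)).le_opNorm (e z)
        simpa using this
      rw [hz] at h2
      have h3 : ‖x z‖ = R * ‖e z‖ := by
        simp only [hx]; rw [norm_smul, Real.norm_eq_abs, abs_of_pos hRp]; simp
      rw [h3, hR, mul_assoc]
      have : 0 ≤ ‖e z‖ := norm_nonneg _
      nlinarith
    have h4 := hpos _ h1
    have h5 : T (x z) (x z) = R * T (x z) (e z : X) := by
      simp only [hx]; rw [map_smul, smul_eq_mul]
    rw [h5] at h4
    exact nonneg_of_mul_nonneg_right h4 hRp)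
  refine ⟨x z, V.smul_mem _ (e z).2, fun h hh => ?_⟩
  have := hinner z (e.symm ⟨h, hh⟩)
  rw [hz0, inner_zero_left] at this
  simpa using this.symm

theorem abs_exist [CompleteSpace X]
    (hCl : ∀ a b : X, ‖(1/2:ℝ) • (a + b)‖ ^ 3 + ‖(1/2:ℝ) • (a - b)‖ ^ 3 ≤ (‖a‖ ^ 3 + ‖b‖ ^ 3) / 2)
    (A K : X → X →L[ℝ] ℝ) (hA : Continuous A) (hK : Continuous K)
    (hmono : ∀ x y, 0 ≤ (A x - A y) (x - y)) (c : ℝ) (hc : 0 < c)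
    (hcoer : ∀ x, c * ‖x‖ ^ 3 ≤ A x x) (hK0 : ∀ x, K x x = 0)
    (hKw : ∀ (U : Ultrafilter (Finset X)) (x : Finset X → X) (M : ℝ) (x0 : X),
      (∀ i, ‖x i‖ ≤ M) → (∀ ℓ : X →L[ℝ] ℝ, Tendsto (fun i => ℓ (x i)) U (𝓝 (ℓ x0))) →
      ∀ h, Tendsto (fun i => K (x i) h) U (𝓝 (K x0 h)))
    (L : X →L[ℝ] ℝ) : ∃ x, ∀ h, A x h + K x h = L h := by
  classical
  set r0 : ℝ := ‖L‖ / c + 1 with hr0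
  have hr0p : 0 < r0 := by positivity
  have hbig : ∀ x : X, r0 ≤ ‖x‖ → L x < c * ‖x‖ ^ 3 := by
    intro x hx
    have h1 : ‖L‖ < c * ‖x‖ := by
      have : ‖L‖ / c < ‖x‖ := by linarith
      rw [div_lt_iff₀ hc] at this; linarith
    have h2 : (1:ℝ) ≤ ‖x‖ := le_trans (by rw [hr0]; have : 0 ≤ ‖L‖ / c := by positivity
                                          linarith) hx
    have h3 := (le_abs_self _).trans (L.le_opNorm x)
    have h4 : ‖L‖ * ‖x‖ < c * ‖x‖ * ‖x‖ := by gcongr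
    have h5 : c * ‖x‖ * ‖x‖ * 1 ≤ c * ‖x‖ * ‖x‖ * ‖x‖ := by gcongr
    calc L x ≤ ‖L‖ * ‖x‖ := h3
      _ < c * ‖x‖ * ‖x‖ := h4
      _ ≤ c * ‖x‖ * ‖x‖ * ‖x‖ := by linarith
      _ = _ := by ring
  have hgal : ∀ S : Finset X, ∃ x ∈ Submodule.span ℝ (S : Set X), ‖x‖ ≤ r0 ∧
      ∀ h ∈ Submodule.span ℝ (S : Set X), A x h + K x h - L h = 0 := by
    intro S
    have : FiniteDimensional ℝ (Submodule.span ℝ (S : Set X)) := inferInstance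
    obtain ⟨x, hx, hx2⟩ := abs_galerkin (fun x => A x + K x - L) ((hA.add hK).sub continuous_const)
      r0 hr0p (by
        intro x hx
        have h1 := hbig x hx
        have h2 := hcoer x
        have h3 := hK0 x
        simp only [_root_.sub_apply, _root_.add_apply]
        linarith) (Submodule.span ℝ (S : Set X))
    refine ⟨x, hx, ?_, hx2⟩
    by_contra! hgt
    have h1 := hbig x hgt.le
    have h2 := hcoer x
    have h3 := hK0 x
    have h4 := hx2 x hx
    simp only [_root_.sub_apply, _root_.add_apply] at h4
    linarith
  choose x hxS hxb hxe using hgal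
  set U : Ultrafilter (Finset X) := Ultrafilter.of atTop with hU
  have hUle : (U : Filter (Finset X)) ≤ atTop := Ultrafilter.of_le _
  obtain ⟨x0, hx0⟩ := abs_weak_lim hCl U x r0 hxb
  have hKlim := hKw U x r0 x0 hxb hx0
  have hminty : ∀ y, 0 ≤ L (x0 - y) + K x0 y - A y (x0 - y) := by
    intro y
    have ht : Tendsto (fun S => L (x S - y) + K (x S) y - A y (x S - y)) U
        (𝓝 (L (x0 - y) + K x0 y - A y (x0 - y))) := by
      refine ((?_ : Tendsto _ _ _).add (hKlim y)).sub ?_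
      · simp only [map_sub]; exact (hx0 L).sub tendsto_const_nhds
      · simp only [map_sub]; exact (hx0 (A y)).sub tendsto_const_nhds
    refine ge_of_tendsto ht ?_
    have : ∀ᶠ S in atTop, y ∈ (S : Finset X) := by
      filter_upwards [eventually_ge_atTop ({y} : Finset X)] with S hS
      exact hS (by simp)
    filter_upwards [hUle this] with S hS
    have hyS : y ∈ Submodule.span ℝ (S : Set X) := Submodule.subset_span (by simpa using hS)
    have h1 := hxe S _ (Submodule.sub_mem _ (hxS S) hyS)
    have h2 := hmono (x S) y
    have h3 := hK0 (x S)
    simp only [_root_.sub_apply, map_sub] at *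
    linarith
  refine ⟨x0, ?_⟩
  have hge : ∀ h, 0 ≤ L h - K x0 h - A x0 h := by
    intro h
    have hcont : Tendsto (fun s : ℝ => L h - K x0 h - A (x0 - s • h) h) (𝓝[>] 0)
        (𝓝 (L h - K x0 h - A x0 h)) := by
      have : Continuous (fun s : ℝ => L h - K x0 h - A (x0 - s • h) h) :=
        continuous_const.sub ((hA.comp (by fun_prop)).clm_apply continuous_const)
      have h2 := (this.tendsto 0).mono_left (nhdsWithin_le_nhds (s := Set.Ioi 0))
      simpa using h2
    refine ge_of_tendsto hcont ?_
    filter_upwards [self_mem_nhdsWithin] with s hs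
    have hs' : (0:ℝ) < s := hs
    have h1 := hminty (x0 - s • h)
    have h3 := hK0 x0
    rw [_root_.sub_sub_cancel] at h1
    simp only [map_sub, map_smul, smul_eq_mul] at h1
    have h4 : 0 ≤ s * (L h - K x0 h - A (x0 - s • h) h) := by
      have := h1
      linarith
    exact nonneg_of_mul_nonneg_right h4 hs'
  intro h
  have h1 := hge h
  have h2 := hge (-h)
  simp only [map_neg] at h2
  linarith

end Abst
end

section
instance fact_one_three : Fact ((1:ℝ≥0∞) ≤ 3) := ⟨by norm_num⟩
lemma e32 : (3/2 : ℝ≥0∞) = ENNReal.ofReal (3/2) := by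
  rw [ENNReal.ofReal_div_of_pos (by norm_num)]; norm_num
instance fact_one_32 : Fact ((1:ℝ≥0∞) ≤ 3/2) := ⟨by
  rw [e32, ← ENNReal.ofReal_one]; exact ENNReal.ofReal_le_ofReal (by norm_num)⟩
lemma inv3 : (3:ℝ≥0∞)⁻¹ = ENNReal.ofReal (1/3) := by
  rw [ENNReal.ofReal_div_of_pos (by norm_num)]; norm_num
lemma inv32 : (3/2:ℝ≥0∞)⁻¹ = ENNReal.ofReal (2/3) := by
  rw [e32, ← ENNReal.ofReal_inv_of_pos (by norm_num)]; norm_num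
instance ht33 : ENNReal.HolderTriple 3 3 (3/2) := ⟨by
  rw [inv3, inv32, ← ENNReal.ofReal_add (by norm_num) (by norm_num)]; norm_num⟩
instance hc32 : ENNReal.HolderConjugate (3/2) 3 := ⟨by
  rw [inv3, inv32, ← ENNReal.ofReal_add (by norm_num) (by norm_num)]; norm_num⟩

section
variable {T : Type*} [MeasurableSpace T] {μ : Measure T} {E : Type*} [NormedAddCommGroup E]

lemma Lp3_enorm (f : Lp E 3 μ) : ‖f‖ₑ ^ 3 = ∫⁻ a, ‖f a‖ₑ ^ 3 ∂μ := by
  rw [Lp.enorm_def, eLpNorm_eq_lintegral_rpow_enorm_toReal (by norm_num) (by norm_num)]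
  have : (3:ℝ≥0∞).toReal = 3 := by norm_num
  rw [this, ← ENNReal.rpow_natCast, ← ENNReal.rpow_mul]
  norm_num

lemma Lp3_integrable (f : Lp E 3 μ) : Integrable (fun a => ‖f a‖ ^ 3) μ := by
  have := (Lp.memLp f).integrable_norm_rpow (by norm_num) (by norm_num)
  refine this.congr (Eventually.of_forall fun a => ?_)
  have h3 : (3:ℝ≥0∞).toReal = ((3:ℕ):ℝ) := by norm_num
  simp only [h3, Real.rpow_natCast]

lemma Lp3_norm (f : Lp E 3 μ) : ‖f‖ ^ 3 = ∫ a, ‖f a‖ ^ 3 ∂μ := by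
  have h := Lp3_enorm f
  have h2 := ofReal_integral_eq_lintegral_ofReal (Lp3_integrable f) (Eventually.of_forall fun a => by positivity)
  have h3 : ENNReal.ofReal (‖f‖ ^ 3) = ENNReal.ofReal (∫ a, ‖f a‖ ^ 3 ∂μ) := by
    rw [h2, ENNReal.ofReal_pow (norm_nonneg _), ofReal_norm, h]
    refine lintegral_congr fun a => ?_
    rw [ENNReal.ofReal_pow (norm_nonneg _), ofReal_norm]
  exact (ENNReal.ofReal_eq_ofReal_iff (by positivity) (integral_nonneg fun a => by positivity)).1 h3

lemma memLp3_of {f : T → E} (hm : AEStronglyMeasurable f μ) (h : ∫⁻ a, ‖f a‖ₑ ^ 3 ∂μ < ⊤) : MemLp f 3 μ := by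
  refine ⟨hm, ?_⟩
  rw [eLpNorm_lt_top_iff_lintegral_rpow_enorm_lt_top (by norm_num) (by norm_num)]
  have h3 : (3:ℝ≥0∞).toReal = ((3:ℕ):ℝ) := by norm_num
  simpa only [h3, ENNReal.rpow_natCast] using h

lemma memLp32_of {f : T → E} (hm : AEStronglyMeasurable f μ) (h : ∫⁻ a, ‖f a‖ₑ ^ (3/2:ℝ) ∂μ < ⊤) : MemLp f (3/2) μ := by
  refine ⟨hm, ?_⟩
  rw [e32, eLpNorm_lt_top_iff_lintegral_rpow_enorm_lt_top (by norm_num) (by norm_num)]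
  rwa [ENNReal.toReal_ofReal (by norm_num)]
end

section
variable {H : Type*} [NormedAddCommGroup H] [InnerProductSpace ℝ H]

lemma clark_real {a b s t : ℝ} (ha : 0 ≤ a) (hb : 0 ≤ b) (hs : 0 ≤ s) (ht : 0 ≤ t)
    (h : s ^ 2 + t ^ 2 = (a ^ 2 + b ^ 2) / 2) : s ^ 3 + t ^ 3 ≤ (a ^ 3 + b ^ 3) / 2 := by
  set R := √(s ^ 2 + t ^ 2)
  have hR0 : 0 ≤ R := Real.sqrt_nonneg _
  have hR : R ^ 2 = s ^ 2 + t ^ 2 := Real.sq_sqrt (by positivity)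
  have h1 : s ≤ R := Real.le_sqrt_of_sq_le (by nlinarith [sq_nonneg t])
  have h2 : t ≤ R := Real.le_sqrt_of_sq_le (by nlinarith [sq_nonneg s])
  have h3 : s ^ 3 + t ^ 3 ≤ R ^ 3 := by
    have e1 := mul_le_mul_of_nonneg_left h1 (sq_nonneg s)
    have e2 := mul_le_mul_of_nonneg_left h2 (sq_nonneg t)
    have : R ^ 3 = s ^ 2 * R + t ^ 2 * R := by rw [← add_mul, ← hR]; ring
    rw [this]; nlinarith
  refine h3.trans ?_
  refine (sq_le_sq₀ (by positivity) (by positivity)).1 ?_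
  have e : (R ^ 3) ^ 2 = ((a ^ 2 + b ^ 2) / 2) ^ 3 := by rw [← h, ← hR]; ring
  rw [e]
  have : ((a ^ 3 + b ^ 3) / 2) ^ 2 - ((a ^ 2 + b ^ 2) / 2) ^ 3 =
    (a - b) ^ 2 * (a ^ 4 + 2 * a ^ 3 * b + 2 * a * b ^ 3 + b ^ 4) / 8 := by ring
  have h4 : 0 ≤ (a - b) ^ 2 * (a ^ 4 + 2 * a ^ 3 * b + 2 * a * b ^ 3 + b ^ 4) / 8 := by positivity
  linarith

lemma clark_pt (a b : H) : ‖(1/2:ℝ) • (a + b)‖ ^ 3 + ‖(1/2:ℝ) • (a - b)‖ ^ 3 ≤ (‖a‖ ^ 3 + ‖b‖ ^ 3) / 2 := by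
  refine clark_real (norm_nonneg _) (norm_nonneg _) (norm_nonneg _) (norm_nonneg _) ?_
  rw [norm_smul, norm_smul]
  have := parallelogram_law_with_norm ℝ a b
  norm_num
  nlinarith

lemma clark_Lp {T : Type*} [MeasurableSpace T] {μ : Measure T} (f g : Lp H 3 μ) :
    ‖(1/2:ℝ) • (f + g)‖ ^ 3 + ‖(1/2:ℝ) • (f - g)‖ ^ 3 ≤ (‖f‖ ^ 3 + ‖g‖ ^ 3) / 2 := by
  rw [Lp3_norm, Lp3_norm, Lp3_norm f, Lp3_norm g, ← integral_add (Lp3_integrable _) (Lp3_integrable _),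
    ← integral_add (Lp3_integrable _) (Lp3_integrable _), ← integral_div]
  refine integral_mono_ae ((Lp3_integrable _).add (Lp3_integrable _)) (((Lp3_integrable _).add (Lp3_integrable _)).div_const _) ?_
  filter_upwards [Lp.coeFn_smul (1/2:ℝ) (f + g), Lp.coeFn_smul (1/2:ℝ) (f - g), Lp.coeFn_add f g, Lp.coeFn_sub f g] with a h1 h2 h3 h4
  rw [h1, h2, Pi.smul_apply, Pi.smul_apply, h3, h4]
  exact clark_pt (f a) (g a)

lemma mono_pt (a b : H) : 0 ≤ inner ℝ (‖a‖ • a - ‖b‖ • b) (a - b) := by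
  have h := real_inner_le_norm a b
  have e : inner ℝ (‖a‖ • a - ‖b‖ • b) (a - b) = ‖a‖ ^ 3 + ‖b‖ ^ 3 - (‖a‖ + ‖b‖) * inner ℝ a b := by
    simp only [inner_sub_left, inner_sub_right, real_inner_smul_left, real_inner_self_eq_norm_sq, real_inner_comm a b]
    ring
  rw [e]
  have h1 : (‖a‖ + ‖b‖) * inner ℝ a b ≤ (‖a‖ + ‖b‖) * (‖a‖ * ‖b‖) := mul_le_mul_of_nonneg_left h (by positivity)
  have h2 : ‖a‖ ^ 3 + ‖b‖ ^ 3 - (‖a‖ + ‖b‖) * (‖a‖ * ‖b‖) = (‖a‖ + ‖b‖) * (‖a‖ - ‖b‖) ^ 2 := by ring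
  have h3 : 0 ≤ (‖a‖ + ‖b‖) * (‖a‖ - ‖b‖) ^ 2 := by positivity
  linarith
end

section
variable {T : Type*} [MeasurableSpace T] {μ : Measure T} {H : Type*} [NormedAddCommGroup H] [InnerProductSpace ℝ H]

/-- the pointwise norm of an `L³` function -/
def nrmLp (f : Lp H 3 μ) : Lp ℝ 3 μ := lipschitzWith_one_norm.compLp norm_zero f
lemma nrmLp_cont : Continuous (nrmLp : Lp H 3 μ → Lp ℝ 3 μ) :=
  lipschitzWith_one_norm.continuous_compLp norm_zero
lemma nrmLp_ae (f : Lp H 3 μ) : nrmLp f =ᵐ[μ] fun a => ‖f a‖ := LipschitzWith.coeFn_compLp _ _ _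

/-- the map `f ↦ |f| f` from `L³` to `L^{3/2}` -/
def ptw (f : Lp H 3 μ) : Lp H (3/2) μ := (ContinuousLinearMap.lsmul ℝ ℝ).holderL μ 3 3 (3/2) (nrmLp f) f
lemma ptw_cont : Continuous (ptw : Lp H 3 μ → Lp H (3/2) μ) := by
  unfold ptw
  exact ((((ContinuousLinearMap.lsmul ℝ ℝ).holderL μ 3 3 (3/2)).continuous.comp nrmLp_cont)).clm_apply continuous_id
lemma ptw_ae (f : Lp H 3 μ) : ptw f =ᵐ[μ] fun a => ‖f a‖ • f a := by
  unfold ptw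
  rw [ContinuousLinearMap.holderL_apply_apply]
  filter_upwards [(ContinuousLinearMap.lsmul ℝ ℝ (E := H)).coeFn_holder (r := 3/2) (nrmLp f) f, nrmLp_ae f] with a h1 h2
  rw [h1, h2]; rfl

/-- the pairing form -/
def AA (f : Lp H 3 μ) : Lp H 3 μ →L[ℝ] ℝ := (innerSL ℝ).lpPairing μ (3/2) 3 (ptw f)
lemma AA_cont : Continuous (AA : Lp H 3 μ → Lp H 3 μ →L[ℝ] ℝ) :=
  ((innerSL ℝ).lpPairing μ (3/2) 3).continuous.comp ptw_cont
lemma AA_eq (f g : Lp H 3 μ) : AA f g = ∫ a, ‖f a‖ * inner ℝ (f a) (g a) ∂μ := by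
  unfold AA
  rw [ContinuousLinearMap.lpPairing_eq_integral]
  refine integral_congr_ae ?_
  filter_upwards [ptw_ae f] with a h
  rw [h]; exact real_inner_smul_left _ _ _
lemma AA_int (f g : Lp H 3 μ) : Integrable (fun a => ‖f a‖ * inner ℝ (f a) (g a)) μ := by
  have := (innerSL ℝ (E := H)).memLp_of_bilin 1 (Lp.memLp (ptw f)) (Lp.memLp g)
  refine (memLp_one_iff_integrable.1 this).congr ?_
  filter_upwards [ptw_ae f] with a h
  rw [h]; exact real_inner_smul_left _ _ _
lemma AA_self (f : Lp H 3 μ) : AA f f = ‖f‖ ^ 3 := by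
  rw [AA_eq, Lp3_norm]
  refine integral_congr_ae (Eventually.of_forall fun a => ?_)
  simp only [real_inner_self_eq_norm_sq]; ring
lemma AA_mono (f g : Lp H 3 μ) : 0 ≤ (AA f - AA g) (f - g) := by
  rw [_root_.sub_apply, AA_eq, AA_eq, ← integral_sub (AA_int _ _) (AA_int _ _)]
  refine integral_nonneg_of_ae ?_
  filter_upwards [Lp.coeFn_sub f g] with a h
  rw [h]
  refine (mono_pt (f a) (g a)).trans (le_of_eq ?_)
  rw [inner_sub_left, real_inner_smul_left, real_inner_smul_left]; rfl
end
end

section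
abbrev II : Type := Option (Fin 3) × Fin 3
/-- target of the weighted jet -/
abbrev HH : Type := EuclideanSpace ℝ II

lemma sum_II {M : Type*} [AddCommMonoid M] (f : II → M) : ∑ k, f k = ∑ j, f (none, j) + ∑ i, ∑ j, f (some i, j) := by
  rw [Fintype.sum_prod_type, Fintype.sum_option]

lemma HH_norm_sq (h : HH) : ‖h‖ ^ 2 = ∑ j, h (none, j) ^ 2 + ∑ i, ∑ j, h (some i, j) ^ 2 := by
  rw [EuclideanSpace.norm_sq_eq]
  simp only [Real.norm_eq_abs, sq_abs]
  exact sum_II fun k => h k ^ 2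

lemma HH_coord_le (h : HH) (k : II) : |h k| ≤ ‖h‖ := PiLp.norm_apply_le h k

lemma HH_cube (h : HH) : ‖h‖ₑ ^ 3 ≤ 1728 * ∑ k, ‖h k‖ₑ ^ 3 := by
  obtain ⟨k, -, hk⟩ := Finset.exists_max_image Finset.univ (fun k => ‖h k‖) ⟨(none, 0), Finset.mem_univ _⟩
  have h1 : ‖h‖ ≤ 12 * ‖h k‖ := by
    refine (sq_le_sq₀ (norm_nonneg _) (by positivity)).1 ?_
    rw [EuclideanSpace.norm_sq_eq]
    refine (Finset.sum_le_card_nsmul Finset.univ (fun i => ‖h i‖ ^ 2) (‖h k‖ ^ 2) fun i _ => ?_).trans ?_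
    · exact pow_le_pow_left₀ (norm_nonneg _) (hk i (Finset.mem_univ _)) 2
    · have : (Finset.univ : Finset II).card = 12 := by decide
      rw [this, nsmul_eq_mul]
      push_cast
      nlinarith [sq_nonneg ‖h k‖]
  have h2 : ‖h‖ₑ ≤ 12 * ‖h k‖ₑ := by
    rw [← ofReal_norm, ← ofReal_norm, show (12:ℝ≥0∞) = ENNReal.ofReal 12 by norm_num, ← ENNReal.ofReal_mul (by norm_num)]
    exact ENNReal.ofReal_le_ofReal h1
  calc _ ≤ (12 * ‖h k‖ₑ) ^ 3 := pow_le_pow_left' h2 3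
    _ = 1728 * ‖h k‖ₑ ^ 3 := by rw [mul_pow]; norm_num
    _ ≤ _ := mul_le_mul_right (Finset.single_le_sum (f := fun k => ‖h k‖ₑ ^ 3) (fun i _ => bot_le) (Finset.mem_univ k)) _

/-- velocity part -/
def prV : HH →L[ℝ] E3 := LinearMap.toContinuousLinearMap
  { toFun := fun h => WithLp.toLp 2 fun j => h (none, j)
    map_add' := fun a b => by ext j; simp
    map_smul' := fun c a => by ext j; simp }
lemma prV_apply (h : HH) (j : Fin 3) : prV h j = h (none, j) := rfl

/-- vorticity part -/
def prW : HH →L[ℝ] E3 := LinearMap.toContinuousLinearMap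
  { toFun := fun h => mk3 (h (some 1, 2) - h (some 2, 1)) (h (some 2, 0) - h (some 0, 2)) (h (some 0, 1) - h (some 1, 0))
    map_add' := fun a b => by ext j; fin_cases j <;> simp [mk3_0, mk3_1, mk3_2] <;> ring
    map_smul' := fun c a => by ext j; fin_cases j <;> simp [mk3_0, mk3_1, mk3_2] <;> ring }
lemma prW_apply (h : HH) : prW h = mk3 (h (some 1, 2) - h (some 2, 1)) (h (some 2, 0) - h (some 0, 2)) (h (some 0, 1) - h (some 1, 0)) := rfl

lemma mk3_smul (c a b d : ℝ) : mk3 (c * a) (c * b) (c * d) = c • mk3 a b d := by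
  ext j; fin_cases j <;> simp [mk3_0, mk3_1, mk3_2]

lemma dot3_inner (a b : E3) : dot3 a b = inner ℝ a b := by
  rw [real_inner_comm]; simp [dot3, PiLp.inner_apply]

lemma cross_norm (a b : E3) : ‖cross3 a b‖ ≤ 1 * ‖a‖ * ‖b‖ := by
  rw [one_mul]
  refine (sq_le_sq₀ (norm_nonneg _) (by positivity)).1 ?_
  rw [mul_pow, norm_sq3, norm_sq3 a, norm_sq3 b]
  simp only [cross3, mk3_0, mk3_1, mk3_2]
  nlinarith [sq_nonneg (a 0 * b 0 + a 1 * b 1 + a 2 * b 2)]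

def crossL : E3 →L[ℝ] E3 →L[ℝ] E3 := LinearMap.mkContinuous₂
  (LinearMap.mk₂ ℝ cross3
    (fun a b c => by ext j; fin_cases j <;> simp [cross3, mk3_0, mk3_1, mk3_2] <;> ring)
    (fun a b c => by ext j; fin_cases j <;> simp [cross3, mk3_0, mk3_1, mk3_2] <;> ring)
    (fun a b c => by ext j; fin_cases j <;> simp [cross3, mk3_0, mk3_1, mk3_2] <;> ring)
    (fun a b c => by ext j; fin_cases j <;> simp [cross3, mk3_0, mk3_1, mk3_2] <;> ring)) 1 cross_norm
lemma crossL_apply (a b : E3) : crossL a b = cross3 a b := rfl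
lemma cross_dot_self (a b : E3) : inner ℝ (cross3 a b) b = (0:ℝ) := by
  rw [← dot3_inner]; simp [dot3, cross3, Fin.sum_univ_three, mk3_0, mk3_1, mk3_2]; ring
lemma cross_smul (s t : ℝ) (a b : E3) : cross3 (s • a) (t • b) = (s * t) • cross3 a b := by
  ext j; fin_cases j <;> simp [cross3, mk3_0, mk3_1, mk3_2] <;> ring

/-- the weighted jet of a field -/
def jet (Ω : Set E3) (α : ℝ) (v : E3 → E3) (G : E3 → Fin 3 → Fin 3 → ℝ) (x : E3) : HH :=
  WithLp.toLp 2 fun k => match k.1 with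
    | none => dB Ω x ^ (-(α/6)) * v x k.2
    | some i => dB Ω x ^ (α/3) * G x i k.2

section
variable {Ω : Set E3} {α : ℝ}
lemma jet_none (v : E3 → E3) (G : E3 → Fin 3 → Fin 3 → ℝ) (x : E3) (j : Fin 3) :
    jet Ω α v G x (none, j) = dB Ω x ^ (-(α/6)) * v x j := rfl
lemma jet_some (v : E3 → E3) (G : E3 → Fin 3 → Fin 3 → ℝ) (x : E3) (i j : Fin 3) :
    jet Ω α v G x (some i, j) = dB Ω x ^ (α/3) * G x i j := rfl
lemma prV_jet (v : E3 → E3) (G : E3 → Fin 3 → Fin 3 → ℝ) (x : E3) :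
    prV (jet Ω α v G x) = dB Ω x ^ (-(α/6)) • v x := by
  ext j; rw [prV_apply, jet_none]; rfl
lemma prW_jet (v : E3 → E3) (G : E3 → Fin 3 → Fin 3 → ℝ) (x : E3) :
    prW (jet Ω α v G x) = dB Ω x ^ (α/3) • curlOf G x := by
  rw [prW_apply, curlOf, ← mk3_smul]; simp only [jet_some, mul_sub]
lemma curlOf_gradv (φ : E3 → E3) : curlOf (gradv φ) = vcurl φ := rfl

lemma dB_rpow_e (hΩ : IsLipschitzDomain Ω) {x : E3} (hx : x ∈ Ω) (s : ℝ) : ‖dB Ω x ^ s‖ₑ = dE Ω x ^ s := by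
  rw [Real.enorm_eq_ofReal (Real.rpow_nonneg (dB_nonneg _) _), dE, ENNReal.ofReal_rpow_of_pos (dB_pos hΩ hx)]

lemma w_cube {E : Type*} [NormedAddCommGroup E] [NormedSpace ℝ E] (hΩ : IsLipschitzDomain Ω) {x : E3} (hx : x ∈ Ω) {s t : ℝ} (hst : s * 3 = t) (w : E) :
    ‖dB Ω x ^ s • w‖ₑ ^ 3 = dE Ω x ^ t * ‖w‖ₑ ^ 3 := by
  rw [enorm_smul, mul_pow, dB_rpow_e hΩ hx, ← hst, ← ENNReal.rpow_natCast, ← ENNReal.rpow_mul]; norm_num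

lemma dB_bdd (hΩ : IsLipschitzDomain Ω) : ∃ D > 0, ∀ x ∈ Ω, dB Ω x ≤ D := by
  obtain ⟨D, hD⟩ := (hΩ.isBounded.isCompact_closure).exists_bound_of_continuousOn (dB_cont (Ω := Ω)).continuousOn
  refine ⟨max D 1, by positivity, fun x hx => ?_⟩
  have := hD x (subset_closure hx)
  exact ((le_abs_self _).trans this).trans (le_max_left _ _)

lemma curl_fin (hΩ : IsLipschitzDomain Ω) (h0 : 0 ≤ α) {φ : E3 → E3} (h : CSv φ) :
    ∫⁻ x in Ω, dE Ω x ^ α * ‖vcurl φ x‖ₑ ^ 3 < ⊤ := by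
  obtain ⟨M, hM0, hM⟩ := curl_bdd h
  obtain ⟨D, hD0, hD⟩ := dB_bdd hΩ
  have hfin : volume Ω < ⊤ := hΩ.isBounded.measure_lt_top
  calc _ ≤ ∫⁻ x in Ω, ENNReal.ofReal D ^ α * ENNReal.ofReal M ^ 3 := by
        refine setLIntegral_mono' hΩ.isOpen.measurableSet fun x hx => ?_
        refine mul_le_mul' (ENNReal.rpow_le_rpow (ENNReal.ofReal_le_ofReal (hD x hx)) h0) (pow_le_pow_left' ?_ 3)
        rw [← ofReal_norm]; exact ENNReal.ofReal_le_ofReal (hM x)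
    _ = (ENNReal.ofReal D ^ α * ENNReal.ofReal M ^ 3) * volume Ω := by rw [setLIntegral_const]
    _ < ⊤ := by
        refine ENNReal.mul_lt_top (ENNReal.mul_lt_top ?_ ?_) hfin
        · exact ENNReal.rpow_lt_top_of_nonneg h0 ENNReal.ofReal_ne_top
        · exact ENNReal.pow_lt_top ENNReal.ofReal_lt_top

lemma jet_meas {v : E3 → E3} {G : E3 → Fin 3 → Fin 3 → ℝ} (hv : Measurable v) (hG : ∀ i j, Measurable fun x => G x i j) :
    Measurable (jet Ω α v G) := by
  refine (WithLp.measurable_toLp 2 _).comp (measurable_pi_lambda _ fun k => ?_)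
  obtain ⟨o, j⟩ := k
  have hd : Measurable (dB Ω) := (dB_cont (Ω := Ω)).measurable
  have hvj : Measurable fun x => v x j := ((EuclideanSpace.proj j : E3 →L[ℝ] ℝ).continuous.measurable).comp hv
  cases o with
  | none => exact (hd.pow_const _).mul hvj
  | some i => exact (hd.pow_const _).mul (hG i j)

lemma jet_test_meas {φ : E3 → E3} (h : CSv φ) : Measurable (jet Ω α φ (gradv φ)) :=
  jet_meas h.smooth.continuous.measurable fun i j => (h.pd i j).cont.measurable

lemma jet_bound (hΩ : IsLipschitzDomain Ω) (h0 : 6/5 ≤ α) (h1 : α < 3/2) :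
    ∃ C : ℝ≥0∞, C ≠ ⊤ ∧ ∀ φ, IsTestSol Ω φ →
      ∫⁻ x in Ω, ‖jet Ω α φ (gradv φ) x‖ₑ ^ 3 ≤ C * ∫⁻ x in Ω, ‖prW (jet Ω α φ (gradv φ) x)‖ₑ ^ 3 := by
  obtain ⟨C1, hC1, H1⟩ := M8b hΩ h0 h1
  obtain ⟨C2, hC2, H2⟩ := WCZ hΩ h0 h1
  refine ⟨1728 * (∑ _k : II, (C1 + C2)), ENNReal.mul_ne_top (by simp) (ENNReal.sum_ne_top.2 fun _ _ => ENNReal.add_ne_top.2 ⟨hC1, hC2⟩), fun φ h => ?_⟩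
  have hW : ∫⁻ x in Ω, ‖prW (jet Ω α φ (gradv φ) x)‖ₑ ^ 3 = ∫⁻ x in Ω, dE Ω x ^ α * ‖vcurl φ x‖ₑ ^ 3 := by
    refine setLIntegral_congr_fun hΩ.isOpen.measurableSet fun x hx => ?_
    simp only [prW_jet, curlOf_gradv]
    exact w_cube hΩ hx (by ring) _
  rw [hW]
  set W := ∫⁻ x in Ω, dE Ω x ^ α * ‖vcurl φ x‖ₑ ^ 3
  have hm := jet_test_meas (Ω := Ω) (α := α) h.toIsTest.csv
  calc _ ≤ ∫⁻ x in Ω, 1728 * ∑ k, ‖jet Ω α φ (gradv φ) x k‖ₑ ^ 3 := lintegral_mono fun x => HH_cube _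
    _ = 1728 * ∑ k, ∫⁻ x in Ω, ‖jet Ω α φ (gradv φ) x k‖ₑ ^ 3 := by
        rw [lintegral_const_mul' _ _ (by simp), lintegral_finsetSum]
        intro k _
        exact (((EuclideanSpace.proj k : HH →L[ℝ] ℝ).continuous.measurable).comp hm).enorm.pow_const 3
    _ ≤ 1728 * ∑ k : II, (C1 + C2) * W := by
        refine mul_le_mul_right (Finset.sum_le_sum fun k _ => ?_) _
        obtain ⟨o, j⟩ := k
        cases o with
        | none =>
          refine le_trans ?_ ((H1 φ h).trans (mul_le_mul_left le_self_add _))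
          refine setLIntegral_mono' hΩ.isOpen.measurableSet fun x hx => ?_
          simp only [jet_none]
          rw [← smul_eq_mul, w_cube hΩ hx (t := -(α/2)) (by ring)]
          refine mul_le_mul_right (pow_le_pow_left' ?_ 3) _
          rw [← ofReal_norm, ← ofReal_norm]; exact ENNReal.ofReal_le_ofReal (coord_le _ _)
        | some i =>
          refine le_trans ?_ ((H2 φ h i j).trans (mul_le_mul_left le_add_self _))
          refine setLIntegral_mono' hΩ.isOpen.measurableSet fun x hx => ?_
          simp only [jet_some]
          rw [← smul_eq_mul, w_cube hΩ hx (t := α) (by ring)]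
          rfl
    _ = _ := by rw [← Finset.sum_mul, mul_assoc]

lemma jet_memLp (hΩ : IsLipschitzDomain Ω) (h0 : 6/5 ≤ α) (h1 : α < 3/2) {φ : E3 → E3} (h : IsTestSol Ω φ) :
    MemLp (jet Ω α φ (gradv φ)) 3 (volume.restrict Ω) := by
  refine memLp3_of (jet_test_meas h.toIsTest.csv).aestronglyMeasurable ?_
  obtain ⟨C, hC, H⟩ := jet_bound hΩ h0 h1
  refine (H φ h).trans_lt (ENNReal.mul_lt_top hC.lt_top ?_)
  refine lt_of_le_of_lt (le_of_eq ?_) (curl_fin (α := α) hΩ (by linarith) h.toIsTest.csv)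
  refine setLIntegral_congr_fun hΩ.isOpen.measurableSet fun x hx => ?_
  simp only [prW_jet, curlOf_gradv]
  exact w_cube hΩ hx (by ring) _
end
end

section
section
variable {Ω : Set E3} {α : ℝ}

lemma pd_add {f g : E3 → E3} (hf : Differentiable ℝ f) (hg : Differentiable ℝ g) (i j : Fin 3) (x : E3) :
    pd (f + g) i j x = pd f i j x + pd g i j x := by
  unfold pd; rw [fderiv_add (hf x) (hg x)]; rfl
lemma pd_smul (c : ℝ) {f : E3 → E3} (hf : Differentiable ℝ f) (i j : Fin 3) (x : E3) :
    pd (c • f) i j x = c * pd f i j x := by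
  unfold pd; rw [fderiv_const_smul (hf x)]; rfl

lemma IsTestSol.add {f g : E3 → E3} (hf : IsTestSol Ω f) (hg : IsTestSol Ω g) : IsTestSol Ω (f + g) where
  smooth := hf.smooth.add hg.smooth
  compsupp := hf.compsupp.add hg.compsupp
  suppin := (tsupport_add f g).trans (Set.union_subset hf.suppin hg.suppin)
  sol := fun x => by
    have h1 := hf.sol x
    have h2 := hg.sol x
    unfold vdiv at *
    simp only [pd_add hf.toIsTest.csv.diff hg.toIsTest.csv.diff, Finset.sum_add_distrib, h1, h2, add_zero]

lemma IsTestSol.smul (c : ℝ) {f : E3 → E3} (hf : IsTestSol Ω f) : IsTestSol Ω (c • f) where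
  smooth := hf.smooth.const_smul c
  compsupp := hf.compsupp.mono' ((Function.support_const_smul_subset c f).trans (subset_tsupport f))
  suppin := (closure_mono (Function.support_const_smul_subset c f)).trans hf.suppin
  sol := fun x => by
    have h1 := hf.sol x
    unfold vdiv at *
    simp only [pd_smul c hf.toIsTest.csv.diff, ← Finset.mul_sum, h1, mul_zero]

lemma IsTestSol.zero : IsTestSol Ω (0 : E3 → E3) where
  smooth := contDiff_const
  compsupp := HasCompactSupport.zero
  suppin := by simp [tsupport]
  sol := fun x => by
    unfold vdiv pd
    simp

lemma jet_add {f g : E3 → E3} (hf : IsTestSol Ω f) (hg : IsTestSol Ω g) (x : E3) :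
    jet Ω α (f + g) (gradv (f + g)) x = jet Ω α f (gradv f) x + jet Ω α g (gradv g) x := by
  ext k
  obtain ⟨o, j⟩ := k
  cases o with
  | none => simp only [PiLp.add_apply, jet_none, Pi.add_apply]; ring
  | some i => simp only [PiLp.add_apply, jet_some, gradv, pd_add hf.toIsTest.csv.diff hg.toIsTest.csv.diff]; ring

lemma jet_smul (c : ℝ) {f : E3 → E3} (hf : IsTestSol Ω f) (x : E3) :
    jet Ω α (c • f) (gradv (c • f)) x = c • jet Ω α f (gradv f) x := by
  ext k
  obtain ⟨o, j⟩ := k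
  cases o with
  | none => simp only [PiLp.smul_apply, jet_none, Pi.smul_apply, smul_eq_mul]; ring
  | some i => simp only [PiLp.smul_apply, jet_some, gradv, pd_smul c hf.toIsTest.csv.diff, smul_eq_mul]; ring

variable (Ω) in
abbrev L3 : Type := Lp HH 3 (volume.restrict Ω)

variable (Ω α) in
/-- jets of solenoidal test fields -/
def TS : Submodule ℝ (L3 Ω) where
  carrier := {f | ∃ φ, IsTestSol Ω φ ∧ f =ᵐ[volume.restrict Ω] jet Ω α φ (gradv φ)}
  zero_mem' := by
    refine ⟨0, IsTestSol.zero, ?_⟩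
    filter_upwards [Lp.coeFn_zero HH 3 (volume.restrict Ω)] with x hx
    have := jet_smul (Ω := Ω) (α := α) 0 (IsTestSol.zero (Ω := Ω)) x
    rw [zero_smul, zero_smul] at this
    rw [this]; exact hx
  add_mem' := by
    rintro a b ⟨f, hf, h1⟩ ⟨g, hg, h2⟩
    refine ⟨f + g, hf.add hg, ?_⟩
    filter_upwards [Lp.coeFn_add a b, h1, h2] with x hx h1 h2
    rw [jet_add hf hg, hx, ← h1, ← h2]; rfl
  smul_mem' := by
    rintro c a ⟨f, hf, h1⟩
    refine ⟨c • f, hf.smul c, ?_⟩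
    filter_upwards [Lp.coeFn_smul c a, h1] with x hx h1
    rw [jet_smul c hf, hx, ← h1]; rfl

variable (Ω α) in
/-- the solution space -/
abbrev XX : Submodule ℝ (L3 Ω) := (TS Ω α).topologicalClosure

lemma XX_closed_ind {P : L3 Ω → Prop} (hP : IsClosed {f | P f}) (h : ∀ f ∈ TS Ω α, P f) : ∀ f ∈ XX Ω α, P f := by
  intro f hf
  have : closure (TS Ω α : Set (L3 Ω)) ⊆ {f | P f} := closure_minimal h hP
  exact this hf

variable (Ω) in
def WL : L3 Ω →L[ℝ] Lp E3 3 (volume.restrict Ω) := prW.compLpL 3 (volume.restrict Ω)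
variable (Ω) in
def VL : L3 Ω →L[ℝ] Lp E3 3 (volume.restrict Ω) := prV.compLpL 3 (volume.restrict Ω)
lemma WL_ae (f : L3 Ω) : WL Ω f =ᵐ[volume.restrict Ω] fun x => prW (f x) := prW.coeFn_compLpL f
lemma VL_ae (f : L3 Ω) : VL Ω f =ᵐ[volume.restrict Ω] fun x => prV (f x) := prV.coeFn_compLpL f

lemma coer (hΩ : IsLipschitzDomain Ω) (h0 : 6/5 ≤ α) (h1 : α < 3/2) :
    ∃ C : ℝ, 0 < C ∧ ∀ f ∈ XX Ω α, ‖f‖ ^ 3 ≤ C * ‖WL Ω f‖ ^ 3 := by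
  obtain ⟨C, hC, H⟩ := jet_bound hΩ h0 h1
  refine ⟨C.toReal + 1, by positivity, XX_closed_ind ?_ ?_⟩
  · exact isClosed_le (by fun_prop) (by fun_prop)
  · rintro f ⟨φ, hφ, hf⟩
    have e1 : ‖f‖ₑ ^ 3 ≤ C * ‖WL Ω f‖ₑ ^ 3 := by
      rw [Lp3_enorm, Lp3_enorm]
      refine le_trans (le_of_eq ?_) ((H φ hφ).trans (le_of_eq ?_))
      · refine lintegral_congr_ae ?_
        filter_upwards [hf] with x hx
        rw [hx]
      · congr 1
        refine lintegral_congr_ae ?_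
        filter_upwards [hf, WL_ae f] with x hx h2
        rw [h2, hx]
    have e2 := ENNReal.toReal_mono (by finiteness) e1
    simp only [ENNReal.toReal_mul, ENNReal.toReal_pow, toReal_enorm] at e2
    refine e2.trans (mul_le_mul_of_nonneg_right (by linarith) (by positivity))

/-- the functional `f ↦ ∫ g f_k` -/
def lf {g : E3 → ℝ} (hg : MemLp g (3/2) (volume.restrict Ω)) (k : II) : L3 Ω →L[ℝ] ℝ :=
  ((ContinuousLinearMap.mul ℝ ℝ).lpPairing (volume.restrict Ω) (3/2) 3 hg.toLp) ∘L
    ((EuclideanSpace.proj k : HH →L[ℝ] ℝ).compLpL 3 (volume.restrict Ω))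

lemma lf_apply {g : E3 → ℝ} (hg : MemLp g (3/2) (volume.restrict Ω)) (k : II) (f : L3 Ω) :
    lf hg k f = ∫ x in Ω, g x * f x k := by
  unfold lf
  rw [ContinuousLinearMap.comp_apply, ContinuousLinearMap.lpPairing_eq_integral]
  refine integral_congr_ae ?_
  filter_upwards [hg.coeFn_toLp, (EuclideanSpace.proj k : HH →L[ℝ] ℝ).coeFn_compLpL (p := 3) f] with x h1 h2
  rw [h1, h2]; rfl

lemma lf_int {g : E3 → ℝ} (hg : MemLp g (3/2) (volume.restrict Ω)) (k : II) (f : L3 Ω) :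
    IntegrableOn (fun x => g x * f x k) Ω := by
  have := (ContinuousLinearMap.mul ℝ ℝ).memLp_of_bilin 1 hg (Lp.memLp ((EuclideanSpace.proj k : HH →L[ℝ] ℝ).compLpL 3 (volume.restrict Ω) f))
  refine (memLp_one_iff_integrable.1 this).congr ?_
  filter_upwards [(EuclideanSpace.proj k : HH →L[ℝ] ℝ).coeFn_compLpL (p := 3) f] with x h2
  rw [h2]; rfl

lemma g_memLp (hΩ : IsLipschitzDomain Ω) (h0 : 6/5 ≤ α) (h1 : α < 3/2) {b : E3 → ℝ} (hb : Measurable b) {M : ℝ} (hM : ∀ x, |b x| ≤ M) :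
    MemLp (fun x => dB Ω x ^ (-(α/3)) * b x) (3/2) (volume.restrict Ω) := by
  have hd : Measurable (dB Ω) := (dB_cont (Ω := Ω)).measurable
  refine memLp32_of ((hd.pow_const _).mul hb).aestronglyMeasurable ?_
  calc _ ≤ ∫⁻ x in Ω, dE Ω x ^ (-(α/2)) * ENNReal.ofReal M ^ (3/2:ℝ) := by
        refine setLIntegral_mono' hΩ.isOpen.measurableSet fun x hx => ?_
        rw [enorm_mul, dB_rpow_e hΩ hx, ENNReal.mul_rpow_of_nonneg _ _ (by norm_num), ← ENNReal.rpow_mul]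
        have : -(α/3) * (3/2) = -(α/2) := by ring
        rw [this]
        refine mul_le_mul_right (ENNReal.rpow_le_rpow ?_ (by norm_num)) _
        rw [← ofReal_norm]; exact ENNReal.ofReal_le_ofReal (hM x)
    _ = (∫⁻ x in Ω, dE Ω x ^ (-(α/2))) * ENNReal.ofReal M ^ (3/2:ℝ) := by
        rw [lintegral_mul_const _ (dE_meas.pow_const _)]
    _ < ⊤ := ENNReal.mul_lt_top (total_int hΩ (by linarith) (by linarith)) (ENNReal.rpow_lt_top_of_nonneg (by norm_num) ENNReal.ofReal_ne_top)

lemma rp_cancel (hΩ : IsLipschitzDomain Ω) {x : E3} (hx : x ∈ Ω) (s : ℝ) : dB Ω x ^ (-s) * dB Ω x ^ s = 1 := by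
  rw [← Real.rpow_add (dB_pos hΩ hx)]; simp

lemma comp_lem (hΩ : IsLipschitzDomain Ω) (h0 : 6/5 ≤ α) (h1 : α < 3/2) {η : ℝ} (hη : 0 < η) :
    ∃ (P : Finset E3) (l : E3 → Fin 3 → L3 Ω →L[ℝ] ℝ) (C : ℝ), 0 ≤ C ∧
      ∀ f ∈ XX Ω α, ‖VL Ω f‖ ^ 3 ≤ η * ‖WL Ω f‖ ^ 3 + C * ∑ p ∈ P, ∑ j, |l p j f| ^ 3 := by
  obtain ⟨ε, hε, P, C, hC, H⟩ := M8c hΩ h0 h1 (η := ENNReal.ofReal η) (by simpa using hη)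
  have hb : ∀ (p : E3) (i : Fin 3), MemLp (fun x => dB Ω x ^ (-(α/3)) * kk ε i (p - x)) (3/2) (volume.restrict Ω) := fun p i =>
    g_memLp hΩ h0 h1 ((kk_cont hε i).measurable.comp (by fun_prop)) fun x => kk_le_eps hε i (p - x)
  refine ⟨P, fun p j => ∑ i, (lf (hb p i) (some i, j) - lf (hb p i) (some j, i)), C.toReal, by positivity, XX_closed_ind ?_ ?_⟩
  · exact isClosed_le (by fun_prop) (by fun_prop)
  · rintro f ⟨φ, hφ, hf⟩
    have key : ∀ p j, (∑ i, (lf (hb p i) (some i, j) - lf (hb p i) (some j, i))) f = BSf ε φ j p := by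
      intro p j
      have e1 : BSf ε φ j p = ∫ y in Ω, ∑ i, kk ε i (p - y) * As φ i j y := by
        unfold BSf
        refine (setIntegral_eq_integral_of_forall_compl_eq_zero fun y hy => ?_).symm
        refine Finset.sum_eq_zero fun i _ => ?_
        have h1 := As_le φ i j y
        rw [curl_out hφ.toIsTest hy, norm_zero] at h1
        rw [abs_nonpos_iff.1 h1, mul_zero]
      rw [e1, _root_.sum_apply]
      simp only [_root_.sub_apply, lf_apply]
      have e2 : ∀ i, (∫ x in Ω, dB Ω x ^ (-(α/3)) * kk ε i (p - x) * f x (some i, j)) - (∫ x in Ω, dB Ω x ^ (-(α/3)) * kk ε i (p - x) * f x (some j, i)) =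
          ∫ x in Ω, (dB Ω x ^ (-(α/3)) * kk ε i (p - x) * f x (some i, j) - dB Ω x ^ (-(α/3)) * kk ε i (p - x) * f x (some j, i)) := fun i =>
        (integral_sub (lf_int (hb p i) _ f) (lf_int (hb p i) _ f)).symm
      have e3 : ∀ i ∈ Finset.univ, Integrable (fun x => dB Ω x ^ (-(α/3)) * kk ε i (p - x) * f x (some i, j) - dB Ω x ^ (-(α/3)) * kk ε i (p - x) * f x (some j, i)) (volume.restrict Ω) :=
        fun i _ => (lf_int (hb p i) (some i, j) f).sub (lf_int (hb p i) (some j, i) f)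
      rw [Finset.sum_congr rfl fun i _ => e2 i, ← integral_finsetSum _ e3]
      refine integral_congr_ae ?_
      filter_upwards [hf, ae_Om hΩ] with x hx hxO
      refine Finset.sum_congr rfl fun i _ => ?_
      rw [hx, jet_some, jet_some, As]
      have := rp_cancel hΩ hxO (α/3)
      simp only [gradv]
      linear_combination (kk ε i (p - x) * (pd φ i j x - pd φ j i x)) * this
    have e1 : ‖VL Ω f‖ₑ ^ 3 ≤ ENNReal.ofReal η * ‖WL Ω f‖ₑ ^ 3 + C * ∑ p ∈ P, ∑ j, ENNReal.ofReal |BSf ε φ j p| ^ 3 := by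
      rw [Lp3_enorm, Lp3_enorm]
      refine le_trans (le_of_eq ?_) ((H φ hφ).trans (le_of_eq ?_))
      · refine lintegral_congr_ae ?_
        filter_upwards [hf, VL_ae f, ae_Om hΩ] with x hx h2 hxO
        rw [h2, hx, prV_jet, w_cube hΩ hxO]; ring
      · congr 2
        refine lintegral_congr_ae ?_
        filter_upwards [hf, WL_ae f, ae_Om hΩ] with x hx h2 hxO
        rw [h2, hx, prW_jet, w_cube hΩ hxO (t := α) (by ring)]; rfl
    have hs : (∑ p ∈ P, ∑ j, ENNReal.ofReal |BSf ε φ j p| ^ 3) = ENNReal.ofReal (∑ p ∈ P, ∑ j, |BSf ε φ j p| ^ 3) := by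
      rw [ENNReal.ofReal_sum_of_nonneg fun p _ => Finset.sum_nonneg fun j _ => by positivity]
      refine Finset.sum_congr rfl fun p _ => ?_
      rw [ENNReal.ofReal_sum_of_nonneg fun j _ => by positivity]
      refine Finset.sum_congr rfl fun j _ => ?_
      rw [ENNReal.ofReal_pow (abs_nonneg _)]
    rw [hs] at e1
    have e2 := ENNReal.toReal_mono (by finiteness) e1
    rw [ENNReal.toReal_add (by finiteness) (by finiteness)] at e2
    simp only [ENNReal.toReal_mul, ENNReal.toReal_pow, toReal_enorm, ENNReal.toReal_ofReal hη.le] at e2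
    rw [ENNReal.toReal_ofReal (Finset.sum_nonneg fun p _ => Finset.sum_nonneg fun j _ => by positivity)] at e2
    simpa only [key] using e2
end
end

section
lemma kw_gen {X Y Z : Type*} [NormedAddCommGroup X] [NormedSpace ℝ X] [NormedAddCommGroup Y] [NormedSpace ℝ Y]
    [NormedAddCommGroup Z] [NormedSpace ℝ Z] (D : Z →L[ℝ] Y →L[ℝ] ℝ) (B : Y →L[ℝ] Y →L[ℝ] Z) (W V : X →L[ℝ] Y)
    {J : Type*} (U : Filter J) (x : J → X) (x0 : X) (M : ℝ) (hM : ∀ i, ‖x i‖ ≤ M)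
    (hw : ∀ l : X →L[ℝ] ℝ, Tendsto (fun i => l (x i)) U (𝓝 (l x0)))
    (hz : Tendsto (fun i => ‖V (x i - x0)‖) U (𝓝 0)) (h : X) :
    Tendsto (fun i => D (B (W (x i)) (V (x i))) (V h)) U (𝓝 (D (B (W x0) (V x0)) (V h))) := by
  have t2 : Tendsto (fun i => D (B (W (x i)) (V x0)) (V h)) U (𝓝 (D (B (W x0) (V x0)) (V h))) :=
    hw ((D.flip (V h)) ∘L ((B.flip (V x0)) ∘L W))
  have t1 : Tendsto (fun i => D (B (W (x i)) (V (x i - x0))) (V h)) U (𝓝 0) := by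
    refine squeeze_zero_norm (a := fun i => (‖D‖ * (‖B‖ * (‖W‖ * M))) * ‖V h‖ * ‖V (x i - x0)‖) (fun i => ?_) ?_
    · have b1 : ‖W (x i)‖ ≤ ‖W‖ * M := (W.le_opNorm _).trans (mul_le_mul_of_nonneg_left (hM i) (norm_nonneg _))
      have b2 : ‖B (W (x i)) (V (x i - x0))‖ ≤ ‖B‖ * (‖W‖ * M) * ‖V (x i - x0)‖ :=
        (B.le_opNorm₂ _ _).trans (mul_le_mul_of_nonneg_right (mul_le_mul_of_nonneg_left b1 (ContinuousLinearMap.opNorm_nonneg B)) (norm_nonneg _))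
      refine (D.le_opNorm₂ _ _).trans ?_
      refine (mul_le_mul_of_nonneg_right (mul_le_mul_of_nonneg_left b2 (ContinuousLinearMap.opNorm_nonneg D)) (norm_nonneg _)).trans (le_of_eq ?_)
      ring
    · simpa using hz.const_mul ((‖D‖ * (‖B‖ * (‖W‖ * M))) * ‖V h‖)
  have t3 := t1.add t2
  rw [zero_add] at t3
  refine t3.congr fun i => ?_
  simp only [map_sub, _root_.sub_apply, sub_add_cancel]

section
variable {Ω : Set E3} {α : ℝ}

variable (Ω) in
abbrev L3v : Type := Lp E3 3 (volume.restrict Ω)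
variable (Ω) in
/-- the bilinear map `(a, b) ↦ a × b` -/
def crH : L3v Ω →L[ℝ] L3v Ω →L[ℝ] Lp E3 (3/2) (volume.restrict Ω) := crossL.holderL (volume.restrict Ω) 3 3 (3/2)
variable (Ω) in
def prD : Lp E3 (3/2) (volume.restrict Ω) →L[ℝ] L3v Ω →L[ℝ] ℝ := (innerSL ℝ).lpPairing (volume.restrict Ω) (3/2) 3

lemma crH_ae (a b : L3v Ω) : crH Ω a b =ᵐ[volume.restrict Ω] fun x => cross3 (a x) (b x) := by
  unfold crH
  rw [ContinuousLinearMap.holderL_apply_apply]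
  exact crossL.coeFn_holder (r := 3/2) a b

lemma tri_eq (a b c : L3v Ω) : prD Ω (crH Ω a b) c = ∫ x in Ω, inner ℝ (cross3 (a x) (b x)) (c x) := by
  unfold prD
  rw [ContinuousLinearMap.lpPairing_eq_integral]
  refine integral_congr_ae ?_
  filter_upwards [crH_ae a b] with x h
  rw [h]; rfl

lemma tri_int (a b c : L3v Ω) : IntegrableOn (fun x => inner ℝ (cross3 (a x) (b x)) (c x)) Ω := by
  have := (innerSL ℝ (E := E3)).memLp_of_bilin 1 (Lp.memLp (crH Ω a b)) (Lp.memLp c)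
  refine (memLp_one_iff_integrable.1 this).congr ?_
  filter_upwards [crH_ae a b] with x h
  rw [h]; rfl

lemma tri_self (a b : L3v Ω) : prD Ω (crH Ω a b) b = 0 := by
  rw [tri_eq]; simp [cross_dot_self]

lemma V_strong (hΩ : IsLipschitzDomain Ω) (h0 : 6/5 ≤ α) (h1 : α < 3/2) {J : Type*} (U : Filter J) (x : J → L3 Ω) (M : ℝ)
    (hx : ∀ i, x i ∈ XX Ω α) (hM : ∀ i, ‖x i‖ ≤ M) (hw : ∀ l : L3 Ω →L[ℝ] ℝ, Tendsto (fun i => l (x i)) U (𝓝 0)) :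
    Tendsto (fun i => ‖VL Ω (x i)‖) U (𝓝 0) := by
  rw [Metric.tendsto_nhds]
  intro e he
  set B := (‖WL Ω‖ * |M|) ^ 3 + 1
  have hB : 0 < B := by positivity
  obtain ⟨P, l, C, hC, H⟩ := comp_lem hΩ h0 h1 (η := e ^ 3 / (2 * B)) (by positivity)
  have ht : Tendsto (fun i => C * ∑ p ∈ P, ∑ j, |l p j (x i)| ^ 3) U (𝓝 0) := by
    have : Tendsto (fun i => C * ∑ p ∈ P, ∑ j, |l p j (x i)| ^ 3) U (𝓝 (C * ∑ p ∈ P, ∑ _j : Fin 3, |(0:ℝ)| ^ 3)) := by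
      refine Tendsto.const_mul _ (tendsto_finsetSum _ fun p _ => tendsto_finsetSum _ fun j _ => ?_)
      exact ((hw (l p j)).abs).pow 3
    simpa using this
  filter_upwards [ht.eventually (gt_mem_nhds (show (0:ℝ) < e ^ 3 / 2 by positivity))] with i hi
  rw [Real.dist_0_eq_abs, abs_of_nonneg (norm_nonneg _)]
  refine lt_of_pow_lt_pow_left₀ 3 he.le ?_
  have h2 := H (x i) (hx i)
  have h3 : ‖WL Ω (x i)‖ ^ 3 ≤ B := by
    have : ‖WL Ω (x i)‖ ≤ ‖WL Ω‖ * |M| := ((WL Ω).le_opNorm _).trans (mul_le_mul_of_nonneg_left ((hM i).trans (le_abs_self _)) (norm_nonneg _))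
    exact (pow_le_pow_left₀ (norm_nonneg _) this 3).trans (by simp [B])
  have h4 : e ^ 3 / (2 * B) * ‖WL Ω (x i)‖ ^ 3 ≤ e ^ 3 / 2 := by
    refine (mul_le_mul_of_nonneg_left h3 (by positivity)).trans (le_of_eq ?_)
    field_simp
  linarith

lemma exist_X (hΩ : IsLipschitzDomain Ω) (h0 : 6/5 ≤ α) (h1 : α < 3/2) (L : L3 Ω →L[ℝ] ℝ) :
    ∃ x ∈ XX Ω α, ∀ h ∈ XX Ω α, AA (WL Ω x) (WL Ω h) + prD Ω (crH Ω (WL Ω x) (VL Ω x)) (VL Ω h) = L h := by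
  obtain ⟨C, hC, hco⟩ := coer hΩ h0 h1
  let s : XX Ω α →L[ℝ] L3 Ω := (XX Ω α).subtypeL
  let A : XX Ω α → XX Ω α →L[ℝ] ℝ := fun x => (AA (WL Ω x)) ∘L (WL Ω ∘L s)
  let K : XX Ω α → XX Ω α →L[ℝ] ℝ := fun x => (prD Ω (crH Ω (WL Ω x) (VL Ω x))) ∘L (VL Ω ∘L s)
  have hs : Continuous fun x : XX Ω α => (x : L3 Ω) := continuous_subtype_val
  have hW : Continuous fun x : XX Ω α => WL Ω x := (WL Ω).continuous.comp hs
  have hV : Continuous fun x : XX Ω α => VL Ω x := (VL Ω).continuous.comp hs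
  have hA : Continuous A := (AA_cont.comp hW).clm_comp continuous_const
  have hK : Continuous K := by
    refine Continuous.clm_comp ?_ continuous_const
    exact (prD Ω).continuous.comp (((crH Ω).continuous.comp hW).clm_apply hV)
  have main := abs_exist (X := XX Ω α) (fun a b => clark_Lp (a : L3 Ω) (b : L3 Ω)) A K hA hK ?_ C⁻¹ (by positivity) ?_ ?_ ?_ (L ∘L s)
  · obtain ⟨x, hx⟩ := main
    exact ⟨x, x.2, fun h hh => hx ⟨h, hh⟩⟩
  · intro x y
    have := AA_mono (WL Ω (x : L3 Ω)) (WL Ω (y : L3 Ω))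
    rw [← map_sub] at this
    exact this
  · intro x
    have e1 : A x x = ‖WL Ω (x : L3 Ω)‖ ^ 3 := AA_self _
    rw [e1]
    have := hco x x.2
    rw [inv_mul_le_iff₀ hC]
    exact this
  · intro x
    exact tri_self _ _
  · intro U x M x0 hM hw h
    have hz : Tendsto (fun i => ‖VL Ω ((x i : L3 Ω) - x0)‖) U (𝓝 0) := by
      refine V_strong hΩ h0 h1 U (fun i => (x i : L3 Ω) - x0) (M + ‖x0‖) (fun i => (XX Ω α).sub_mem (x i).2 x0.2) (fun i => ?_) fun l => ?_
      · exact (norm_sub_le _ _).trans (add_le_add_left (hM i) _)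
      · have := hw (l ∘L s)
        have h2 := this.sub_const ((l ∘L s) x0)
        rw [_root_.sub_self] at h2
        refine h2.congr fun i => ?_
        exact (map_sub l _ _).symm
    have hz' : Tendsto (fun i => ‖(VL Ω ∘L s) (x i - x0)‖) U (𝓝 0) := hz
    exact kw_gen (prD Ω) (crH Ω) (WL Ω ∘L s) (VL Ω ∘L s) U x x0 M hM hw hz' h
end
end

section
variable {Ω : Set E3} {α : ℝ}

lemma frob_nonneg (M : Fin 3 → Fin 3 → ℝ) : 0 ≤ frob M := Real.sqrt_nonneg _

lemma le_frob (M : Fin 3 → Fin 3 → ℝ) (i j : Fin 3) : |M i j| ≤ frob M := by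
  unfold frob
  rw [← Real.sqrt_sq_eq_abs]
  refine Real.sqrt_le_sqrt ?_
  refine le_trans ?_ (Finset.single_le_sum (f := fun i => ∑ j, (M i j) ^ 2) (fun i _ => Finset.sum_nonneg fun j _ => sq_nonneg _) (Finset.mem_univ i))
  exact Finset.single_le_sum (f := fun j => (M i j) ^ 2) (fun j _ => sq_nonneg _) (Finset.mem_univ j)

lemma frob_sq (M : Fin 3 → Fin 3 → ℝ) : frob M ^ 2 = ∑ i, ∑ j, M i j ^ 2 :=
  Real.sq_sqrt (Finset.sum_nonneg fun i _ => Finset.sum_nonneg fun j _ => sq_nonneg _)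

lemma jet_pt (hΩ : IsLipschitzDomain Ω) (h0 : 0 ≤ α) : ∃ C > 0, ∀ x ∈ Ω, ∀ (v : E3 → E3) (G : E3 → Fin 3 → Fin 3 → ℝ),
    dB Ω x ^ α * (‖v x‖ ^ (3:ℝ) + frob (G x) ^ (3:ℝ)) ≤ C * ‖jet Ω α v G x‖ ^ 3 := by
  obtain ⟨D, hD0, hD⟩ := dB_bdd hΩ
  refine ⟨D ^ (3 * α / 2) + 1, by positivity, fun x hx v G => ?_⟩
  have hd := dB_pos hΩ hx
  have hn := HH_norm_sq (jet Ω α v G x)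
  simp only [jet_none, jet_some, mul_pow, ← Finset.mul_sum] at hn
  have hv : ∑ j, v x j ^ 2 = ‖v x‖ ^ 2 := by
    rw [EuclideanSpace.norm_sq_eq]; simp
  rw [hv, ← frob_sq, ← mul_pow, ← mul_pow] at hn
  have n1 : dB Ω x ^ (-(α/6)) * ‖v x‖ ≤ ‖jet Ω α v G x‖ :=
    (sq_le_sq₀ (by positivity) (norm_nonneg _)).1 (by rw [hn]; nlinarith [sq_nonneg (dB Ω x ^ (α/3) * frob (G x))])
  have n2 : dB Ω x ^ (α/3) * frob (G x) ≤ ‖jet Ω α v G x‖ :=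
    (sq_le_sq₀ (mul_nonneg (by positivity) (frob_nonneg _)) (norm_nonneg _)).1 (by rw [hn]; nlinarith [sq_nonneg (dB Ω x ^ (-(α/6)) * ‖v x‖)])
  have m1 := pow_le_pow_left₀ (by positivity) n1 3
  have m2 := pow_le_pow_left₀ (mul_nonneg (by positivity) (frob_nonneg _)) n2 3
  have e1 : dB Ω x ^ α * ‖v x‖ ^ 3 = dB Ω x ^ (3 * α / 2) * (dB Ω x ^ (-(α/6)) * ‖v x‖) ^ 3 := by
    rw [mul_pow, ← Real.rpow_natCast (dB Ω x ^ (-(α/6))), ← Real.rpow_mul hd.le, ← mul_assoc, ← Real.rpow_add hd]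
    congr 2; push_cast; ring
  have e2 : dB Ω x ^ α * frob (G x) ^ 3 = (dB Ω x ^ (α/3) * frob (G x)) ^ 3 := by
    rw [mul_pow, ← Real.rpow_natCast (dB Ω x ^ (α/3)), ← Real.rpow_mul hd.le]
    congr 2; push_cast; ring
  have r3 : ∀ t : ℝ, t ^ (3:ℝ) = t ^ 3 := fun t => by rw [← Real.rpow_natCast]; norm_num
  rw [r3, r3, mul_add, e1, e2, add_mul, one_mul]
  refine add_le_add (mul_le_mul (Real.rpow_le_rpow hd.le (hD x hx) (by positivity)) m1 (by positivity) (by positivity)) m2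

lemma F_memLp (hΩ : IsLipschitzDomain Ω) {F : E3 → Fin 3 → Fin 3 → ℝ}
    (hFmeas : ∀ i j, Measurable fun x => F x i j)
    (hFint : IntegrableOn (fun x => dB Ω x ^ (-α/2) * frob (F x) ^ ((3:ℝ)/2)) Ω) (i j : Fin 3) :
    MemLp (fun x => dB Ω x ^ (-(α/3)) * F x i j) (3/2) (volume.restrict Ω) := by
  have hd : Measurable (dB Ω) := (dB_cont (Ω := Ω)).measurable
  refine memLp32_of ((hd.pow_const _).mul (hFmeas i j)).aestronglyMeasurable ?_
  refine lt_of_le_of_lt ?_ hFint.2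
  refine setLIntegral_mono' hΩ.isOpen.measurableSet fun x hx => ?_
  have hdx := dB_pos hΩ hx
  rw [enorm_mul, enorm_mul, dB_rpow_e hΩ hx, dB_rpow_e hΩ hx, ENNReal.mul_rpow_of_nonneg _ _ (by norm_num), ← ENNReal.rpow_mul]
  refine mul_le_mul' (le_of_eq (by congr 1; ring)) ?_
  rw [Real.enorm_eq_ofReal (Real.rpow_nonneg (frob_nonneg _) _), ← ENNReal.ofReal_rpow_of_nonneg (frob_nonneg _) (by norm_num)]
  refine ENNReal.rpow_le_rpow ?_ (by norm_num)
  rw [Real.enorm_eq_ofReal_abs]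
  exact ENNReal.ofReal_le_ofReal (le_frob _ i j)

lemma weakg (hΩ : IsLipschitzDomain Ω) (h0 : 6/5 ≤ α) (h1 : α < 3/2) {f : L3 Ω} (hf : f ∈ XX Ω α)
    {ψ : E3 → ℝ} (hψ : IsTestS Ω ψ) (i j : Fin 3) :
    ∫ x in Ω, (dB Ω x ^ (α/6) • prV (f x)) j * pds ψ i x = - ∫ x in Ω, (dB Ω x ^ (-(α/3)) * f x (some i, j)) * ψ x := by
  have hc : CSf ψ := ⟨hψ.smooth, hψ.compsupp⟩
  have hbc : Continuous fun x => dB Ω x ^ (α/2) * pds ψ i x :=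
    ((dB_cont (Ω := Ω)).rpow_const fun x => Or.inr (by linarith)).mul (hc.pds i).cont
  obtain ⟨M1, hM1⟩ := hbc.bounded_above_of_compact_support (hc.pds i).supp.mul_left
  obtain ⟨M2, _, hM2⟩ := hc.bdd
  have g1 := g_memLp (Ω := Ω) (α := α) hΩ h0 h1 hbc.measurable hM1
  have g2 := g_memLp (Ω := Ω) (α := α) hΩ h0 h1 hc.cont.measurable hM2
  have key : ∀ f ∈ XX Ω α, lf g1 (none, j) f = - lf g2 (some i, j) f := by
    refine XX_closed_ind (isClosed_eq (lf g1 (none, j)).continuous (lf g2 (some i, j)).continuous.neg) ?_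
    rintro u ⟨φ, hφ, hu⟩
    have hv := hφ.toIsTest.csv
    rw [lf_apply, lf_apply]
    have z : ∀ x ∉ Ω, φ x = 0 := fun x hx => image_eq_zero_of_notMem_tsupport fun h => hx (hφ.suppin h)
    have zψ : ∀ x ∉ Ω, ψ x = 0 := fun x hx => image_eq_zero_of_notMem_tsupport fun h => hx (hψ.suppin h)
    have q1 : ∫ x in Ω, dB Ω x ^ (-(α/3)) * (dB Ω x ^ (α/2) * pds ψ i x) * u x (none, j) = ∫ x, φ x j * pds ψ i x := by
      rw [← setIntegral_eq_integral_of_forall_compl_eq_zero (s := Ω) (f := fun x => φ x j * pds ψ i x) (fun x hx => by rw [z x hx]; simp)]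
      refine integral_congr_ae ?_
      filter_upwards [hu, ae_restrict_mem hΩ.isOpen.measurableSet] with x hx hm
      have hd := dB_pos hΩ hm
      rw [hx, jet_none]
      have : dB Ω x ^ (-(α/3)) * dB Ω x ^ (α/2) * dB Ω x ^ (-(α/6)) = 1 := by
        rw [← Real.rpow_add hd, ← Real.rpow_add hd, show -(α/3) + α/2 + -(α/6) = 0 by ring, Real.rpow_zero]
      linear_combination (pds ψ i x * φ x j) * this
    have q2 : ∫ x in Ω, dB Ω x ^ (-(α/3)) * ψ x * u x (some i, j) = ∫ x, pds (fun y => φ y j) i x * ψ x := by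
      rw [← setIntegral_eq_integral_of_forall_compl_eq_zero (s := Ω) (f := fun x => pds (fun y => φ y j) i x * ψ x) (fun x hx => by rw [zψ x hx]; simp)]
      refine integral_congr_ae ?_
      filter_upwards [hu, ae_restrict_mem hΩ.isOpen.measurableSet] with x hx hm
      rw [hx, jet_some, gradv, pd_eq hv.diff]
      have := rp_cancel hΩ hm (α/3)
      linear_combination (pds (fun y => φ y j) i x * ψ x) * this
    rw [q1, q2]
    exact ibp_line (((hv.comp j).pds i).mul hc).integrable ((hv.comp j).mul (hc.pds i)).integrable ((hv.comp j).mul hc).integrable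
      (fun x => (hv.comp j).line i x) (fun x => hc.line i x)
  have := key f hf
  rw [lf_apply, lf_apply] at this
  refine Eq.trans ?_ (this.trans ?_)
  · refine setIntegral_congr_fun hΩ.isOpen.measurableSet fun x hx => ?_
    have hd := dB_pos hΩ hx
    have e : dB Ω x ^ (-(α/3)) * dB Ω x ^ (α/2) = dB Ω x ^ (α/6) := by
      rw [← Real.rpow_add hd]; congr 1; ring
    simp only [PiLp.smul_apply, prV_apply, smul_eq_mul]
    rw [← e]; ring
  · congr 1
    refine integral_congr_ae (Eventually.of_forall fun x => ?_)
    simp only; ring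

lemma jet_rec (hΩ : IsLipschitzDomain Ω) (f : E3 → HH) {x : E3} (hx : x ∈ Ω) (v : E3 → E3) (G : E3 → Fin 3 → Fin 3 → ℝ)
    (hv : v x = dB Ω x ^ (α/6) • prV (f x)) (hG : ∀ i j, G x i j = dB Ω x ^ (-(α/3)) * f x (some i, j)) :
    jet Ω α v G x = f x := by
  ext k
  obtain ⟨o, j⟩ := k
  cases o with
  | none =>
    rw [jet_none, hv, PiLp.smul_apply, prV_apply, smul_eq_mul, ← mul_assoc, rp_cancel hΩ hx, one_mul]
  | some i =>
    rw [jet_some, hG, ← mul_assoc, mul_comm (dB Ω x ^ (α/3)), rp_cancel hΩ hx, one_mul]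

lemma jet_sub (v w : E3 → E3) (G K : E3 → Fin 3 → Fin 3 → ℝ) (x : E3) :
    jet Ω α (fun x => v x - w x) (fun x i j => G x i j - K x i j) x = jet Ω α v G x - jet Ω α w K x := by
  ext k
  obtain ⟨o, j⟩ := k
  cases o with
  | none => simp only [PiLp.sub_apply, jet_none]; ring
  | some i => simp only [PiLp.sub_apply, jet_some]; ring

lemma mem_W (hΩ : IsLipschitzDomain Ω) (h0 : 6/5 ≤ α) (h1 : α < 3/2) {f : L3 Ω} (hf : f ∈ XX Ω α) :
    MemW1pSigma Ω 3 α (fun x => dB Ω x ^ (α/6) • prV (f x)) (fun x i j => dB Ω x ^ (-(α/3)) * f x (some i, j)) := by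
  have hd : Measurable (dB Ω) := (dB_cont (Ω := Ω)).measurable
  have hfm : AEStronglyMeasurable f (volume.restrict Ω) := Lp.aestronglyMeasurable f
  obtain ⟨C, hC, HC⟩ := jet_pt (Ω := Ω) (α := α) hΩ (by linarith)
  have hvm : AEStronglyMeasurable (fun x => dB Ω x ^ (α/6) • prV (f x)) (volume.restrict Ω) :=
    (hd.pow_const _).aestronglyMeasurable.smul (prV.continuous.comp_aestronglyMeasurable hfm)
  have hGm : ∀ i j, AEMeasurable (fun x => dB Ω x ^ (-(α/3)) * f x (some i, j)) (volume.restrict Ω) := fun i j =>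
    (hd.pow_const _).aemeasurable.mul
      ((EuclideanSpace.proj (some i, j) : HH →L[ℝ] ℝ).continuous.comp_aestronglyMeasurable hfm).aemeasurable
  refine ⟨hvm, fun ψ hψ i j => weakg hΩ h0 h1 hf hψ i j, ?_, ?_⟩
  · refine ((Lp3_integrable f).const_mul C).mono' ?_ ?_
    · refine AEMeasurable.aestronglyMeasurable ?_
      refine (hd.pow_const _).aemeasurable.mul ((hvm.norm.aemeasurable.pow_const _).add (AEMeasurable.pow_const ?_ _))
      unfold frob
      refine AEMeasurable.sqrt ?_
      refine Finset.aemeasurable_fun_sum _ fun i _ => Finset.aemeasurable_fun_sum _ fun j _ => (hGm i j).pow_const 2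
    · filter_upwards [ae_restrict_mem hΩ.isOpen.measurableSet] with x hx
      have := HC x hx (fun x => dB Ω x ^ (α/6) • prV (f x)) (fun x i j => dB Ω x ^ (-(α/3)) * f x (some i, j))
      rw [jet_rec hΩ f hx _ _ rfl fun _ _ => rfl] at this
      rw [Real.norm_of_nonneg (mul_nonneg (Real.rpow_nonneg (dB_nonneg _) _) (add_nonneg (by positivity) (Real.rpow_nonneg (frob_nonneg _) _)))]
      exact this
  · have hcl : f ∈ closure (TS Ω α : Set (L3 Ω)) := hf
    obtain ⟨u, hu, hlim⟩ := mem_closure_iff_seq_limit.1 hcl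
    choose φ hφ hae using hu
    refine ⟨φ, hφ, ?_⟩
    have hz : Tendsto (fun n => C * ‖f - u n‖ ^ 3) atTop (𝓝 0) := by
      have a1 : Tendsto (fun n => f - u n) atTop (𝓝 (f - f)) := tendsto_const_nhds.sub hlim
      have a2 := ((a1.norm).pow 3).const_mul C
      simpa using a2
    refine squeeze_zero (fun n => integral_nonneg fun x => mul_nonneg (Real.rpow_nonneg (dB_nonneg _) _) (add_nonneg (by positivity) (Real.rpow_nonneg (frob_nonneg _) _))) (fun n => ?_) hz
    rw [Lp3_norm, ← integral_const_mul]
    refine integral_mono_of_nonneg (Eventually.of_forall fun x => mul_nonneg (Real.rpow_nonneg (dB_nonneg _) _) (add_nonneg (by positivity) (Real.rpow_nonneg (frob_nonneg _) _))) ((Lp3_integrable _).const_mul C) ?_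
    filter_upwards [ae_restrict_mem hΩ.isOpen.measurableSet, hae n, Lp.coeFn_sub f (u n)] with x hx h2 h3
    have := HC x hx (fun x => dB Ω x ^ (α/6) • prV (f x) - φ n x) (fun x i j => dB Ω x ^ (-(α/3)) * f x (some i, j) - gradv (φ n) x i j)
    rw [jet_sub (fun x => dB Ω x ^ (α/6) • prV (f x)) (φ n) (fun x i j => dB Ω x ^ (-(α/3)) * f x (some i, j)) (gradv (φ n)),
      jet_rec hΩ f hx _ _ rfl fun _ _ => rfl, ← h2] at this
    rw [h3, Pi.sub_apply]
    exact this
end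

/-- For `6/5 ≤ α < 3/2` and `F` with `∫_Ω d^{-α/2}|F|^{3/2} < ∞`, there is
a weak solution `v ∈ W^{1,3}_{0,σ}(Ω, d^α)` of `ω × v + curl(d^α|ω|ω) + ∇π = div F`,
`div v = 0`. -/
theorem generalized_BL_existence_alpha_mid
    (Ω : Set E3) (hΩ : IsLipschitzDomain Ω) (α : ℝ) (hα0 : 6/5 ≤ α) (hα : α < 3/2)
    (F : E3 → Fin 3 → Fin 3 → ℝ)
    (hFmeas : ∀ i j, Measurable fun x => F x i j)
    (hFint : IntegrableOn (fun x => dB Ω x ^ (-α/2) * frob (F x) ^ ((3:ℝ)/2)) Ω) :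
    ∃ (v : E3 → E3) (G : E3 → Fin 3 → Fin 3 → ℝ),
      MemW1pSigma Ω 3 α v G ∧
      ∀ φ : E3 → E3, IsTestSol Ω φ →
        ∫ x in Ω, (dot3 (cross3 (curlOf G x) (v x)) (φ x)
          + dB Ω x ^ α * ‖curlOf G x‖ * dot3 (curlOf G x) (vcurl φ x))
        = - ∫ x in Ω, mdot (F x) (gradv φ x) := by
  have hF := F_memLp (α := α) hΩ hFmeas hFint
  obtain ⟨f, hf, H⟩ := exist_X hΩ hα0 hα (-∑ i, ∑ j, lf (hF i j) (some i, j))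
  refine ⟨fun x => dB Ω x ^ (α/6) • prV (f x), fun x i j => dB Ω x ^ (-(α/3)) * f x (some i, j), mem_W hΩ hα0 hα hf, fun φ hφ => ?_⟩
  have hj := jet_memLp hΩ hα0 hα hφ
  have hae : hj.toLp =ᵐ[volume.restrict Ω] jet Ω α φ (gradv φ) := hj.coeFn_toLp
  have hX : hj.toLp ∈ XX Ω α := (TS Ω α).le_topologicalClosure ⟨φ, hφ, hae⟩
  generalize hj.toLp = h at hae hX
  have E := H h hX
  rw [AA_eq, tri_eq, add_comm, ← integral_add (tri_int _ _ _) (AA_int _ _)] at E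
  refine Eq.trans (integral_congr_ae ?_) (E.trans ?_)
  · filter_upwards [ae_restrict_mem hΩ.isOpen.measurableSet, hae, WL_ae f, WL_ae h, VL_ae f, VL_ae h] with x hx a1 a2 a3 a4 a5
    have hd := dB_pos hΩ hx
    have hjr : f x = jet Ω α (fun x => dB Ω x ^ (α/6) • prV (f x)) (fun x i j => dB Ω x ^ (-(α/3)) * f x (some i, j)) x :=
      (jet_rec hΩ f hx _ _ rfl fun _ _ => rfl).symm
    have b2 := a2
    rw [hjr, prW_jet] at b2
    rw [hjr, prV_jet] at a4
    rw [a1, prW_jet, curlOf_gradv] at a3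
    rw [a1, prV_jet] at a5
    rw [b2, a3, a4, a5, dot3_inner, dot3_inner, cross_smul]
    rw [real_inner_smul_left, real_inner_smul_right, real_inner_smul_left, real_inner_smul_right, norm_smul,
      Real.norm_of_nonneg (Real.rpow_nonneg hd.le _)]
    have w1 : dB Ω x ^ (α/3) * dB Ω x ^ (-(α/6)) * dB Ω x ^ (-(α/6)) = 1 := by
      rw [← Real.rpow_add hd, ← Real.rpow_add hd, show α/3 + -(α/6) + -(α/6) = 0 by ring, Real.rpow_zero]
    have w2 : dB Ω x ^ α = dB Ω x ^ (α/3) * dB Ω x ^ (α/3) * dB Ω x ^ (α/3) := by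
      rw [← Real.rpow_add hd, ← Real.rpow_add hd]; congr 1; ring
    rw [w2]
    generalize curlOf _ x = c
    generalize (dB Ω x ^ (α/6) • prV (f x)) = vv
    linear_combination (-(inner ℝ (cross3 c vv) (φ x))) * w1
  · rw [_root_.neg_apply, _root_.sum_apply]
    simp only [_root_.sum_apply, lf_apply]
    congr 1
    have q : ∀ i j, ∫ x in Ω, dB Ω x ^ (-(α/3)) * F x i j * h x (some i, j) = ∫ x in Ω, F x i j * gradv φ x i j := by
      intro i j
      refine integral_congr_ae ?_
      filter_upwards [ae_restrict_mem hΩ.isOpen.measurableSet, hae] with x hx a1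
      rw [a1, jet_some]
      linear_combination (F x i j * gradv φ x i j) * rp_cancel hΩ hx (α/3)
    have qi : ∀ i j, Integrable (fun x => F x i j * gradv φ x i j) (volume.restrict Ω) := by
      intro i j
      refine (lf_int (hF i j) (some i, j) h).congr ?_
      filter_upwards [ae_restrict_mem hΩ.isOpen.measurableSet, hae] with x hx a1
      rw [a1, jet_some]
      linear_combination (F x i j * gradv φ x i j) * rp_cancel hΩ hx (α/3)
    simp only [q, mdot]
    rw [integral_finsetSum _ fun i _ => integrable_finsetSum _ fun j _ => qi i j]
    refine Finset.sum_congr rfl fun i _ => ?_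
    rw [integral_finsetSum _ fun j _ => qi i j]
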